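/- arXiv:2404.16199 — 2 statements merged into one kernel-verified Lean document; each statement's English description precedes it below -/
import Mathlib

section
/- For all x, y ∈ ℂ at which both sides are defined (i.e. x ∉ ℤ, 2y not an odd integer, x ≠ ±y, and none of 1+x+y, 1+x−y, 1+x, 1+y, 1+2y is a nonpositive integer, and the Pochhammer denominators below never vanish), the following identity holds: ∑_{m≥0} ( F_even(x,y,m) + F_odd(x,y,m) ) = (1/8)ψ(1+x+y) + (1/8)ψ(1+x−y) − (1/4)ψ(1+x) + (1/4)ψ(1+y) − (1/2)ψ(1+2y) + 1/(8x) − γ/4 + (π/8)tan(πy) + (cot(πx)tan(πy) − 1)/(16(x−y)) − (cot(πx)tan(πy) + 1)/(16(x+y)) + (1/8)cot(πx)tan(πy)·(ψ(1+x+y) − ψ(1+x−y)). -/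
/-- The ascending Pochhammer symbol `(a)_m = a (a+1) ⋯ (a+m−1)` in `ℂ`. -/
noncomputable def pochC (a : ℂ) (m : ℕ) : ℂ := (ascPochhammer ℂ m).eval a

/-- The digamma function `ψ(z) = Γ′(z)/Γ(z)`. -/
noncomputable def digammaC (z : ℂ) : ℂ := deriv Complex.Gamma z / Complex.Gamma z

/-- The term `F_even(x,y,m)` from the ₆F₅ identity. -/
noncomputable def Feven (x y : ℂ) (m : ℕ) : ℂ :=
  -((4 * x ^ 2 - 1) * y ^ 2) / (8 * (x ^ 2 - 1) * (4 * y ^ 2 - 1)) *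
    (pochC 1 m ^ 2 * pochC (3/2 - x) m * pochC (3/2 + x) m *
      pochC (1 - y) m * pochC (1 + y) m) /
    (pochC 2 m * pochC (2 - x) m * pochC (2 + x) m *
      pochC (3/2 - y) m * pochC (3/2 + y) m) *
    (1 / (Nat.factorial m : ℂ))

/-- The term `F_odd(x,y,m)` from the ₆F₅ identity. -/
noncomputable def Fodd (x y : ℂ) (m : ℕ) : ℂ :=
  -(y ^ 2) / (4 * y ^ 2 - 1) *
    (pochC (1/2) m * pochC 1 m * pochC (1/2 - x) m * pochC (1/2 + x) m *
      pochC (1 - y) m * pochC (1 + y) m) /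
    (pochC (3/2) m * pochC (1 - x) m * pochC (1 + x) m *
      pochC (3/2 - y) m * pochC (3/2 + y) m) *
    (1 / (Nat.factorial m : ℂ))

section Helpers
open Filter Topology Finset


noncomputable def XX (x : ℂ) (m : ℕ) : ℂ :=
  ∏ j ∈ range m, ((((j:ℂ)+1/2)^2-x^2)/(((j:ℂ)+1)^2-x^2))
noncomputable def YY (y : ℂ) (m : ℕ) : ℂ :=
  ∏ j ∈ range m, (((j:ℂ)^2-y^2)/(((j:ℂ)+1/2)^2-y^2))
noncomputable def TT (x y : ℂ) (m : ℕ) : ℂ :=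
  -(1/(8*((m:ℂ)+1))) * (XX x (m+1) * YY y (m+1)) - (1/(4*(2*(m:ℂ)+1))) * (XX x m * YY y (m+1))

lemma XX_succ (x : ℂ) (m : ℕ) : XX x (m+1) = XX x m * ((((m:ℂ)+1/2)^2-x^2)/(((m:ℂ)+1)^2-x^2)) :=
  prod_range_succ _ _
lemma YY_succ (y : ℂ) (m : ℕ) : YY y (m+1) = YY y m * (((m:ℂ)^2-y^2)/(((m:ℂ)+1/2)^2-y^2)) :=
  prod_range_succ _ _

lemma int_ne {x : ℂ} (hx : ∀ n : ℤ, x ≠ (n : ℂ)) (n : ℕ) : (n:ℂ) - x ≠ 0 ∧ (n:ℂ) + x ≠ 0 := by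
  constructor
  · intro h; exact hx n (by push_cast; linear_combination -h)
  · intro h; exact hx (-n) (by push_cast; linear_combination h)

lemma half_ne {y : ℂ} (hy : ∀ n : ℤ, 2 * y ≠ 2 * (n : ℂ) + 1) (n : ℕ) :
    (n:ℂ) + 1/2 - y ≠ 0 ∧ (n:ℂ) + 1/2 + y ≠ 0 := by
  constructor
  · intro h; exact hy n (by push_cast; linear_combination -2*h)
  · intro h; exact hy (-n-1) (by push_cast; linear_combination 2*h)

lemma sq_ne {x : ℂ} (hx : ∀ n : ℤ, x ≠ (n : ℂ)) (n : ℕ) : ((n:ℂ)+1)^2 - x^2 ≠ 0 := by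
  have h := int_ne hx (n+1)
  push_cast at h
  rw [sq_sub_sq]; exact mul_ne_zero h.2 h.1

lemma hsq_ne {y : ℂ} (hy : ∀ n : ℤ, 2 * y ≠ 2 * (n : ℂ) + 1) (n : ℕ) : ((n:ℂ)+1/2)^2 - y^2 ≠ 0 := by
  have h := half_ne hy n
  rw [sq_sub_sq]; exact mul_ne_zero h.2 h.1

lemma int_shift {x : ℂ} (hx : ∀ n : ℤ, x ≠ (n : ℂ)) (n : ℤ) : x + 1 ≠ (n : ℂ) := by
  intro h; exact hx (n-1) (by push_cast; linear_combination h)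

lemma XX_shift {x : ℂ} (hx : ∀ n : ℤ, x ≠ (n : ℂ)) (m : ℕ) :
    XX (x+1) (m+1) = XX x m *
      ((m+1/2+x)*(m+3/2+x)*(1+x)/(x*(m+1+x)*(m+2+x))) := by
  have hx0 : x ≠ 0 := by simpa using hx 0
  induction m with
  | zero =>
    have h1 := int_ne hx 1
    have h2 := int_ne hx 2
    push_cast at h1 h2
    have h3 := sq_ne (int_shift hx) 0
    simp only [XX, prod_range_succ, prod_range_zero]
    push_cast at h3 ⊢
    have e : (0+1:ℂ)^2-(x+1)^2 = -x*(2+x) := by ring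
    rw [e]
    have h21 := h1.2
    have h22 := h2.2
    simp only [zero_add]
    field_simp
    ring
  | succ m ih =>
    have h1 := int_ne hx (m+1)
    have h2 := int_ne hx (m+2)
    have h3 := int_ne hx (m+3)
    push_cast at h1 h2 h3
    obtain ⟨h1, h1'⟩ := h1
    obtain ⟨h2, h2'⟩ := h2
    obtain ⟨h3, h3'⟩ := h3
    rw [XX_succ, ih, XX_succ]
    push_cast
    have e : ((m:ℂ)+1+1)^2-(x+1)^2 = (m+1-x)*(m+3+x) := by ring
    have e' : ((m:ℂ)+1)^2-x^2 = (m+1-x)*(m+1+x) := by ring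
    have e2 : (m:ℂ)+1+1+x = m+2+x := by ring
    have e3 : (m:ℂ)+1+2+x = m+3+x := by ring
    rw [e, e', e2, e3]
    field_simp
    ring

noncomputable def AA (x y : ℂ) : ℂ := (x+1/2)^2 - y^2 + 1/4
noncomputable def QQ (x y k : ℂ) : ℂ := AA x y * (k^2-k/2) + (AA x y)^2 - (x+1/2)^2/2 - (x+1/2)^2 * AA x y
noncomputable def LL (x y : ℂ) : ℂ := -((x-y)*(x+y+1)*(x+y)*(x+1-y))

lemma QQ_id (x y k : ℂ) : (k^2-(x+1/2)^2)*(k^2-y^2)*QQ x y (k+1)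
   - ((k+1/2)^2-(x+1/2)^2)*((k+1/2)^2-y^2)*QQ x y k
   = LL x y/2 * ((k+1/2)*((k+1/2)^2-y^2)+k*(k^2-y^2)) := by
  unfold QQ LL AA; ring

/-- The WZ certificate. -/
noncomputable def KK (x y : ℂ) (n : ℕ) : ℂ :=
  -(1/(8*x)) * (XX x n * YY y (n+1)) * ((n+1/2+x)/((n+1)^2-x^2)) *
    ((n+1-x)*2*QQ x y (n+1)/LL x y + (n+3/2)/(n+2+x))

noncomputable def GG0 (x y : ℂ) : ℂ :=
  1/8*(1/x+1/(x+1)) - 1/16*(1/(x+y+1)+1/(x+y)+1/(x+1-y)+1/(x-y))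

lemma KK_zero {x y : ℂ} (hx : ∀ n : ℤ, x ≠ (n : ℂ)) (hy : ∀ n : ℤ, 2 * y ≠ 2 * (n : ℂ) + 1)
   (h1 : x - y ≠ 0) (h2 : x+y+1 ≠ 0) (h3 : x + y ≠ 0) (h4 : x+1-y ≠ 0) :
   TT (x+1) y 0 - TT x y 0 = KK x y 0 - GG0 x y := by
  have hx0 : x ≠ 0 := by simpa using hx 0
  have h5 := half_ne hy 0
  have h6 := (int_ne hx 2).2
  have h7 := (int_ne hx 1).2
  have h8 := (int_ne hx 1).1
  obtain ⟨h5, h5'⟩ := h5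
  unfold TT KK GG0
  rw [XX_shift hx 0]
  simp only [XX, YY, prod_range_succ, prod_range_zero, LL, QQ, AA]
  push_cast at *
  simp only [zero_add] at *
  have h10 : 1-2*y ≠ 0 := by contrapose! h5; linear_combination h5/2
  have h10' : 1+2*y ≠ 0 := by contrapose! h5'; linear_combination h5'/2
  have e1 : (1/2:ℂ)^2-y^2 = (1-2*y)*(1+2*y)/4 := by ring
  have e2 : (1:ℂ)^2-x^2 = (1-x)*(1+x) := by ring
  rw [e1, e2]
  have h9 : x + 1 ≠ 0 := by rwa [add_comm]
  rw [show (1:ℂ)+x = x+1 by ring] at *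
  field_simp
  ring

lemma KK_succ {x y : ℂ} (hx : ∀ n : ℤ, x ≠ (n : ℂ)) (hy : ∀ n : ℤ, 2 * y ≠ 2 * (n : ℂ) + 1)
   (h1 : x - y ≠ 0) (h2 : x+y+1 ≠ 0) (h3 : x + y ≠ 0) (h4 : x+1-y ≠ 0) (n : ℕ) :
   TT (x+1) y (n+1) - TT x y (n+1) = KK x y (n+1) - KK x y n := by
  have hx0 : x ≠ 0 := by simpa using hx 0
  have hL : LL x y ≠ 0 := by
    unfold LL; exact neg_ne_zero.mpr (mul_ne_zero (mul_ne_zero (mul_ne_zero h1 h2) h3) h4)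
  have key := QQ_id x y (n+1)
  obtain ⟨a1, a1'⟩ := int_ne hx (n+1)
  obtain ⟨a2, a2'⟩ := int_ne hx (n+2)
  obtain ⟨a3, a3'⟩ := int_ne hx (n+3)
  obtain ⟨b1, b1'⟩ := half_ne hy (n+1)
  unfold TT KK
  rw [XX_shift hx (n+1), XX_shift hx n, XX_succ x (n+1), XX_succ x n, YY_succ y (n+1)]
  generalize XX x n = P
  generalize YY y (n+1) = Q
  have c1 : (2*(n:ℂ)+3) ≠ 0 := by exact_mod_cast (by omega : 2*n+3 ≠ 0)
  have c2 : ((n:ℂ)+2) ≠ 0 := by exact_mod_cast (by omega : n+2 ≠ 0)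
  push_cast at *
  generalize (n:ℂ) = k at *
  have e1 : (k+1)^2-x^2 = (k+1-x)*(k+1+x) := by ring
  have e2 : (k+2)^2-x^2 = (k+2-x)*(k+2+x) := by ring
  have e3 : (k+1+1/2)^2-y^2 = (k+1+1/2-y)*(k+1+1/2+y) := by ring
  have e4 : 2*(k+1)+1 = 2*k+3 := by ring
  have e5 : k+1+1 = k+2 := by ring
  have e6 : k+1+2 = k+3 := by ring
  rw [e3] at key
  simp only [e1, e5, e2, e3, e4, e6] at *
  generalize hu : k+1+1/2-y = u at *
  generalize hv : k+1+1/2+y = v at *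
  generalize hq2 : QQ x y (k+2) = q2 at *
  generalize hq1 : QQ x y (k+1) = q1 at *
  generalize hl : LL x y = l at *
  -- three pieces
  have S1 : -(1/(8*(k+2)))*(P*((k+1/2)^2-x^2)/((k+1-x)*(k+1+x))*((k+1+1/2+x)*(k+1+3/2+x)*(1+x)/(x*(k+2+x)*(k+3+x)))) + (1/(8*(k+2)))*(P*((k+1/2)^2-x^2)/((k+1-x)*(k+1+x))*(((k+1+1/2)^2-x^2)/((k+2-x)*(k+2+x))))
     = -(1/(8*x)) * (P*((k+1/2)^2-x^2)/((k+1-x)*(k+1+x))) * ((k+1+1/2+x)/((k+2-x)*(k+2+x)))*((k+1+3/2)/(k+3+x)) := by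
    field_simp
    ring
  have S2 : -(1/(4*(2*k+3)))*(P*((k+1/2+x)*(k+3/2+x)*(1+x)/(x*(k+1+x)*(k+2+x)))) + (1/(4*(2*k+3)))*(P*(((k+1/2)^2-x^2)/((k+1-x)*(k+1+x))))
     = -(1/(8*x)) * P*((k+1/2+x)/((k+1-x)*(k+1+x)))*((k+1)/(k+2+x)) := by
    field_simp
    ring
  have S3 : (k+1/2-x)/((k+1-x)*(k+1+x))*((k+1+1/2+x)/((k+2-x)*(k+2+x)))*((k+2-x)*2*q2/l) * (((k+1)^2-y^2)/(u*v)) - (1/((k+1-x)*(k+1+x)))*((k+1-x)*2*q1/l)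
     = (1/((k+1-x)*(k+1+x)))*(((k+1)/(k+2+x))*(((k+1)^2-y^2)/(u*v)) + (k+3/2)/(k+2+x)) := by
    field_simp
    linear_combination (4:ℂ)*key
  linear_combination (Q*(((k+1)^2-y^2)/(u*v))) * (S1+S2) + (k+1/2+x)*(1/(8*x)) * P*Q*S3


lemma pochC_succ (a : ℂ) (m : ℕ) : pochC a (m+1) = pochC a m * (a + m) := by
  unfold pochC; rw [ascPochhammer_succ_eval]
lemma pochC_zero (a : ℂ) : pochC a 0 = 1 := by simp [pochC]

lemma Feven_succ (x y : ℂ) (m : ℕ) : Feven x y (m+1) = Feven x y m *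
   (((1+m)^2*(3/2-x+m)*(3/2+x+m)*(1-y+m)*(1+y+m))/((2+m)*(2-x+m)*(2+x+m)*(3/2-y+m)*(3/2+y+m)*(m+1))) := by
  simp only [Feven, pochC_succ, Nat.factorial_succ]
  push_cast
  simp only [div_eq_mul_inv, mul_inv]
  ring

lemma Fodd_succ (x y : ℂ) (m : ℕ) : Fodd x y (m+1) = Fodd x y m *
   (((1/2+m)*(1+m)*(1/2-x+m)*(1/2+x+m)*(1-y+m)*(1+y+m))/((3/2+m)*(1-x+m)*(1+x+m)*(3/2-y+m)*(3/2+y+m)*(m+1))) := by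
  simp only [Fodd, pochC_succ, Nat.factorial_succ]
  push_cast
  simp only [div_eq_mul_inv, mul_inv]
  ring

lemma Feven_eq {x y : ℂ} (hx : ∀ n : ℤ, x ≠ (n : ℂ)) (hy : ∀ n : ℤ, 2 * y ≠ 2 * (n : ℂ) + 1) (m : ℕ) :
    Feven x y m = -(1/(8*((m:ℂ)+1))) * (XX x (m+1) * YY y (m+1)) := by
  induction m with
  | zero =>
    have h5 := half_ne hy 0
    have h7 := int_ne hx 1
    simp only [Feven, pochC_zero, XX, YY, prod_range_succ, prod_range_zero]
    push_cast at *
    simp only [zero_add] at *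
    obtain ⟨h5, h5'⟩ := h5
    obtain ⟨h7, h7'⟩ := h7
    have h10 : 1-2*y ≠ 0 := by contrapose! h5; linear_combination h5/2
    have h10' : 1+2*y ≠ 0 := by contrapose! h5'; linear_combination h5'/2
    have e1 : (1/2:ℂ)^2-y^2 = (1-2*y)*(1+2*y)/4 := by ring
    have e2 : (1:ℂ)^2-x^2 = (1-x)*(1+x) := by ring
    have e3 : x^2-1 = -((1-x)*(1+x)) := by ring
    have e4 : 4*y^2-1 = -((1-2*y)*(1+2*y)) := by ring
    rw [e1, e2, e3, e4]
    simp only [Nat.factorial_zero, Nat.cast_one]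
    field_simp
    ring
  | succ m ih =>
    rw [Feven_succ, ih, XX_succ x (m+1), YY_succ y (m+1)]
    generalize XX x (m+1) = P
    generalize YY y (m+1) = Q
    obtain ⟨a2, a2'⟩ := int_ne hx (m+2)
    obtain ⟨b1, b1'⟩ := half_ne hy (m+1)
    have c1 : ((m:ℂ)+1) ≠ 0 := by exact_mod_cast (by omega : m+1 ≠ 0)
    have c2 : ((m:ℂ)+2) ≠ 0 := by exact_mod_cast (by omega : m+2 ≠ 0)
    push_cast at *
    generalize (m:ℂ) = k at *
    have e2 : (k+1+1)^2-x^2 = (k+2-x)*(k+2+x) := by ring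
    have e3 : (k+1+1/2)^2-y^2 = (k+1+1/2-y)*(k+1+1/2+y) := by ring
    have e4 : k + 1 + 1 = k+2 := by ring
    have e5 : 2 + k = k+2 := by ring
    have e6 : 2 - x + k = k+2-x := by ring
    have e7 : 2 + x + k = k+2+x := by ring
    have e8 : 3/2 - y + k = k+1+1/2-y := by ring
    have e9 : 3/2 + y + k = k+1+1/2+y := by ring
    rw [e2, e3, e4, e5, e6, e7, e8, e9]
    generalize k+1+1/2-y = u at *
    generalize k+1+1/2+y = v at *
    field_simp
    ring

lemma Fodd_eq {x y : ℂ} (hx : ∀ n : ℤ, x ≠ (n : ℂ)) (hy : ∀ n : ℤ, 2 * y ≠ 2 * (n : ℂ) + 1) (m : ℕ) :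
    Fodd x y m = - (1/(4*(2*(m:ℂ)+1))) * (XX x m * YY y (m+1)) := by
  induction m with
  | zero =>
    have h5 := half_ne hy 0
    simp only [Fodd, pochC_zero, XX, YY, prod_range_succ, prod_range_zero]
    push_cast at *
    simp only [zero_add] at *
    obtain ⟨h5, h5'⟩ := h5
    have h10 : 1-2*y ≠ 0 := by contrapose! h5; linear_combination h5/2
    have h10' : 1+2*y ≠ 0 := by contrapose! h5'; linear_combination h5'/2
    have e1 : (1/2:ℂ)^2-y^2 = (1-2*y)*(1+2*y)/4 := by ring
    have e4 : 4*y^2-1 = -((1-2*y)*(1+2*y)) := by ring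
    rw [e1, e4]
    simp only [Nat.factorial_zero, Nat.cast_one]
    field_simp
    ring
  | succ m ih =>
    rw [Fodd_succ, ih, XX_succ x m, YY_succ y (m+1)]
    generalize XX x m = P
    generalize YY y (m+1) = Q
    obtain ⟨a2, a2'⟩ := int_ne hx (m+1)
    obtain ⟨b1, b1'⟩ := half_ne hy (m+1)
    have c1 : ((m:ℂ)+1) ≠ 0 := by exact_mod_cast (by omega : m+1 ≠ 0)
    have c2 : (2*(m:ℂ)+1) ≠ 0 := by exact_mod_cast (by omega : 2*m+1 ≠ 0)
    have c3 : (2*(m:ℂ)+3) ≠ 0 := by exact_mod_cast (by omega : 2*m+3 ≠ 0)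
    push_cast at *
    generalize (m:ℂ) = k at *
    have e2 : (k+1)^2-x^2 = (k+1-x)*(k+1+x) := by ring
    have e3 : (k+1+1/2)^2-y^2 = (k+1+1/2-y)*(k+1+1/2+y) := by ring
    have e4 : 2*(k + 1) + 1 = 2*k+3 := by ring
    have e5 : 3/2 + k = (2*k+3)/2 := by ring
    have e6 : 1 - x + k = k+1-x := by ring
    have e7 : 1 + x + k = k+1+x := by ring
    have e8 : 3/2 - y + k = k+1+1/2-y := by ring
    have e9 : 3/2 + y + k = k+1+1/2+y := by ring
    rw [e2, e3, e4, e5, e6, e7, e8, e9]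
    generalize k+1+1/2-y = u at *
    generalize k+1+1/2+y = v at *
    field_simp
    ring

lemma F_eq_TT {x y : ℂ} (hx : ∀ n : ℤ, x ≠ (n : ℂ)) (hy : ∀ n : ℤ, 2 * y ≠ 2 * (n : ℂ) + 1) (m : ℕ) :
    Feven x y m + Fodd x y m = TT x y m := by
  rw [Feven_eq hx hy, Fodd_eq hx hy, TT]; ring

/-- Half-integer product. -/
lemma half_prod (z : ℂ) (n : ℕ) :
    (∏ j ∈ range n, ((((j:ℂ)+1/2)^2-z^2)/((j:ℂ)+1)^2)) * (n+1/2+z) =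
    (1/2+z) * ∏ j ∈ range n, (1-(1/2+z)^2/((j:ℂ)+1)^2) := by
  induction n with
  | zero => simp
  | succ n ih =>
    rw [prod_range_succ, prod_range_succ, ← mul_assoc (1/2+z), ← ih]
    generalize (∏ j ∈ range n, ((((j:ℂ)+1/2)^2-z^2)/((j:ℂ)+1)^2)) = p
    have c1 : ((n:ℂ)+1) ≠ 0 := by exact_mod_cast (by omega : n+1 ≠ 0)
    push_cast
    field_simp
    ring

lemma tendsto_nat_div (a : ℂ) : Tendsto (fun n : ℕ => (n:ℂ)/(n+a)) atTop (𝓝 1) := by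
  simpa using tendsto_natCast_div_add_atTop (𝕜 := ℂ) a

lemma eventually_add_ne (a : ℂ) : ∀ᶠ n : ℕ in atTop, (n:ℂ)+a ≠ 0 := by
  have := (tendsto_nat_div a).eventually_ne one_ne_zero
  filter_upwards [this] with n hn h
  rw [h] at hn; simp at hn

lemma tendsto_half_prod (z : ℂ) : Tendsto (fun n : ℕ =>
    (n:ℂ) * ∏ j ∈ range n, ((((j:ℂ)+1/2)^2-z^2)/((j:ℂ)+1)^2)) atTop
    (𝓝 (Complex.cos (Real.pi * z) / Real.pi)) := by
  have h := Complex.tendsto_euler_sin_prod (1/2+z)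
  have hpi : (Real.pi:ℂ) ≠ 0 := by exact_mod_cast Real.pi_ne_zero
  have h2 := ((tendsto_nat_div (1/2+z)).mul h).div_const (Real.pi:ℂ)
  have e : Complex.sin (Real.pi * (1/2+z)) = Complex.cos (Real.pi * z) := by
    rw [← Complex.sin_add_pi_div_two]; congr 1; ring
  rw [e, one_mul] at h2
  refine h2.congr' ?_
  filter_upwards [eventually_add_ne (1/2+z)] with n hn
  have := half_prod z n
  have hn' : (n:ℂ)+1/2+z ≠ 0 := by rwa [add_assoc]
  rw [mul_assoc (Real.pi:ℂ), ← this]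
  rw [← add_assoc]
  generalize (∏ j ∈ range n, ((((j:ℂ)+1/2)^2-z^2)/((j:ℂ)+1)^2)) = p
  generalize (n:ℂ)+1/2+z = u at *
  field_simp

lemma tendsto_XX {x : ℂ} (hx : ∀ n : ℤ, x ≠ (n : ℂ)) :
    Tendsto (fun n : ℕ => (n:ℂ) * XX x n) atTop (𝓝 (x * Complex.cot (Real.pi * x))) := by
  have h1 := tendsto_half_prod x
  have h2 := Complex.tendsto_euler_sin_prod x
  have hpi : (Real.pi:ℂ) ≠ 0 := by exact_mod_cast Real.pi_ne_zero
  have hx0 : x ≠ 0 := by simpa using hx 0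
  have hs : Complex.sin (Real.pi * x) ≠ 0 := by
    rw [Complex.sin_ne_zero_iff]
    intro k hk
    apply hx k
    have : (Real.pi:ℂ) * (x - k) = 0 := by linear_combination hk
    rcases mul_eq_zero.mp this with h | h
    · exact absurd h hpi
    · linear_combination h
  have h3 := (h1.div h2 hs).const_mul (Real.pi * x)
  have e : (Real.pi * x) * (Complex.cos (Real.pi * x) / Real.pi / Complex.sin (Real.pi * x)) = x * Complex.cot (Real.pi * x) := by
    rw [Complex.cot_eq_cos_div_sin]; field_simp
  rw [e] at h3
  refine h3.congr fun n => ?_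
  have e2 : XX x n = (∏ j ∈ range n, ((((j:ℂ)+1/2)^2-x^2)/((j:ℂ)+1)^2)) / ∏ j ∈ range n, (1-x^2/((j:ℂ)+1)^2) := by
    rw [← prod_div_distrib]
    refine prod_congr rfl fun j _ => ?_
    have c1 : ((j:ℂ)+1) ≠ 0 := by exact_mod_cast (by omega : j+1 ≠ 0)
    have c2 := sq_ne hx j
    rw [one_sub_div (pow_ne_zero 2 c1), div_div_div_cancel_right₀ (pow_ne_zero 2 c1)]
  rw [e2]
  simp only [Pi.div_apply]
  generalize (∏ j ∈ range n, ((((j:ℂ)+1/2)^2-x^2)/((j:ℂ)+1)^2)) = p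
  generalize (∏ j ∈ range n, (1-x^2/((j:ℂ)+1)^2)) = q
  field_simp

lemma YY_eq {y : ℂ} (hy : ∀ n : ℤ, 2 * y ≠ 2 * (n : ℂ) + 1) (n : ℕ) :
   YY y (n+1) = -y^2 * (∏ j ∈ range n, (1-y^2/((j:ℂ)+1)^2)) /
     ((∏ j ∈ range n, ((((j:ℂ)+1/2)^2-y^2)/((j:ℂ)+1)^2)) * ((n+1/2)^2-y^2)) := by
  induction n with
  | zero => simp [YY]
  | succ n ih =>
    rw [YY_succ, ih, prod_range_succ, prod_range_succ]
    have c1 : ((n:ℂ)+1) ≠ 0 := by exact_mod_cast (by omega : n+1 ≠ 0)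
    have c2 := hsq_ne hy n
    have c3 := hsq_ne hy (n+1)
    have c4 : (∏ j ∈ range n, ((((j:ℂ)+1/2)^2-y^2)/((j:ℂ)+1)^2)) ≠ 0 := by
      refine prod_ne_zero_iff.mpr fun j _ => div_ne_zero (hsq_ne hy j) (pow_ne_zero 2 ?_)
      exact_mod_cast (by omega : j+1 ≠ 0)
    generalize (∏ j ∈ range n, ((((j:ℂ)+1/2)^2-y^2)/((j:ℂ)+1)^2)) = p at *
    generalize (∏ j ∈ range n, (1-y^2/((j:ℂ)+1)^2)) = q at *
    push_cast at *
    generalize h : ((n:ℂ)+1/2)^2-y^2 = u at *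
    generalize h : ((n:ℂ)+1+1/2)^2-y^2 = v at *
    field_simp

lemma tendsto_YY {y : ℂ} (hy : ∀ n : ℤ, 2 * y ≠ 2 * (n : ℂ) + 1) :
    Tendsto (fun n : ℕ => (n:ℂ) * YY y (n+1)) atTop (𝓝 (-y * Complex.tan (Real.pi * y))) := by
  have h1 := tendsto_half_prod y
  have h2 := Complex.tendsto_euler_sin_prod y
  have hpi : (Real.pi:ℂ) ≠ 0 := by exact_mod_cast Real.pi_ne_zero
  have hc : Complex.cos (Real.pi * y) ≠ 0 := by
    rw [Complex.cos_ne_zero_iff]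
    intro k hk
    apply hy k
    have : (Real.pi:ℂ) * (2*y - (2*k+1)) = 0 := by linear_combination 2*hk
    rcases mul_eq_zero.mp this with h | h
    · exact absurd h hpi
    · linear_combination h
  have h3 := ((h2.div h1 (div_ne_zero hc hpi)).mul
    ((tendsto_nat_div (1/2-y)).mul (tendsto_nat_div (1/2+y)))).const_mul (-y/Real.pi)
  have e : (-y/Real.pi) * (Complex.sin (Real.pi * y) / (Complex.cos (Real.pi * y) / Real.pi) * (1*1)) = -y * Complex.tan (Real.pi * y) := by
    rw [Complex.tan]; field_simp
  rw [e] at h3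
  refine h3.congr' ?_
  filter_upwards [eventually_gt_atTop 0] with n hn
  rw [YY_eq hy]
  have c0 : (n:ℂ) ≠ 0 := by exact_mod_cast hn.ne'
  have c4 : (∏ j ∈ range n, ((((j:ℂ)+1/2)^2-y^2)/((j:ℂ)+1)^2)) ≠ 0 := by
    refine prod_ne_zero_iff.mpr fun j _ => div_ne_zero (hsq_ne hy j) (pow_ne_zero 2 ?_)
    exact_mod_cast (by omega : j+1 ≠ 0)
  simp only [Pi.div_apply]
  generalize (∏ j ∈ range n, ((((j:ℂ)+1/2)^2-y^2)/((j:ℂ)+1)^2)) = p at *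
  generalize (∏ j ∈ range n, (1-y^2/((j:ℂ)+1)^2)) = q at *
  obtain ⟨b1, b1'⟩ := half_ne hy n
  have e3 : ((n:ℂ)+1/2)^2-y^2 = (n+1/2-y)*(n+1/2+y) := by ring
  rw [e3, ← add_sub_assoc, ← add_assoc]
  generalize (n:ℂ)+1/2-y = u at *
  generalize (n:ℂ)+1/2+y = v at *
  field_simp


lemma tendsto_rr (a : ℂ) : Tendsto (fun n : ℕ => ((n:ℂ)+a)/n) atTop (𝓝 1) := by
  have := (tendsto_nat_div a).inv₀ one_ne_zero
  simpa using this

lemma tendsto_inv_nat : Tendsto (fun n : ℕ => 1/(n:ℂ)) atTop (𝓝 0) :=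
  tendsto_one_div_atTop_nhds_zero_nat (𝕜 := ℂ)

lemma YY_bound {y : ℂ} (hy : ∀ n : ℤ, 2 * y ≠ 2 * (n : ℂ) + 1) :
    ∃ C : ℝ, 0 ≤ C ∧ ∀ n : ℕ, ‖YY y (n+1)‖ ≤ C / (n+1) := by
  have h := (tendsto_YY hy).mul (tendsto_rr 1)
  have h2 : Tendsto (fun n : ℕ => ((n:ℂ)+1) * YY y (n+1)) atTop (𝓝 (-y * Complex.tan (Real.pi * y) * 1)) := by
    refine h.congr' ?_
    filter_upwards [eventually_gt_atTop 0] with n hn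
    have c0 : (n:ℂ) ≠ 0 := by exact_mod_cast hn.ne'
    field_simp
  obtain ⟨C, hC⟩ := h2.norm.bddAbove_range
  refine ⟨C, (norm_nonneg _).trans (hC ⟨0, rfl⟩), fun n => ?_⟩
  have := hC ⟨n, rfl⟩
  simp only [norm_mul] at this
  rw [le_div_iff₀ (by positivity), mul_comm]
  have e : ‖(n:ℂ)+1‖ = (n:ℝ)+1 := by rw [← Nat.cast_add_one, Complex.norm_natCast]; simp
  rw [e] at this
  exact this

lemma XX_bound {x : ℂ} (hx : ∀ n : ℤ, x ≠ (n : ℂ)) :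
    ∃ C : ℝ, ∀ n : ℕ, ‖XX x n‖ ≤ C := by
  have h := (tendsto_XX hx).mul tendsto_inv_nat
  have h2 : Tendsto (fun n : ℕ => XX x n) atTop (𝓝 (x * Complex.cot (Real.pi * x) * 0)) := by
    refine h.congr' ?_
    filter_upwards [eventually_gt_atTop 0] with n hn
    have c0 : (n:ℂ) ≠ 0 := by exact_mod_cast hn.ne'
    field_simp
  obtain ⟨C, hC⟩ := h2.norm.bddAbove_range
  exact ⟨C, fun n => hC ⟨n, rfl⟩⟩

/-- generic term with arbitrary weights -/
lemma term_bound {y : ℂ} {C D : ℝ} (hC : 0 ≤ C) (hD : 0 ≤ D)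
    (hY : ∀ n : ℕ, ‖YY y (n+1)‖ ≤ C / (n+1)) (x : ℂ)
    (hX : ∀ n : ℕ, ‖XX x n‖ ≤ D * √(n+1)) (n : ℕ) :
    ‖TT x y n‖ ≤ (C * D) * (1 / ((n+1 : ℕ):ℝ) ^ (3/2 : ℝ)) := by
  have hs : (0:ℝ) < n + 1 := by positivity
  have hq : 0 < √((n:ℝ)+1) := Real.sqrt_pos.mpr hs
  have e1 : 1 / ((n+1 : ℕ):ℝ) ^ (3/2 : ℝ) = √((n:ℝ)+1) / ((n+1)*(n+1)) := by
    push_cast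
    have : ((n:ℝ)+1)^(3/2:ℝ) = (n+1) * √((n:ℝ)+1) := by
      rw [Real.sqrt_eq_rpow, show (3/2:ℝ) = 1 + 1/2 by norm_num, Real.rpow_add hs, Real.rpow_one]
    rw [this]
    have := Real.mul_self_sqrt hs.le
    field_simp
    nlinarith
  have h1 : ‖XX x (n+1)‖ ≤ D * (2*√(n+1)) := by
    refine (hX (n+1)).trans (mul_le_mul_of_nonneg_left ?_ hD)
    rw [Real.sqrt_le_left (by positivity), mul_pow, Real.sq_sqrt hs.le]
    push_cast; linarith
  have h2 := hX n
  have h3 := hY n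
  have n1 : ‖-(1/(8*((n:ℂ)+1)))‖ = 1/(8*(n+1)) := by
    rw [norm_neg, norm_div, norm_mul, ← Nat.cast_add_one, Complex.norm_natCast]; simp
  have n2 : ‖(1/(4*(2*(n:ℂ)+1)))‖ = 1/(4*(2*n+1)) := by
    rw [norm_div, norm_mul, show 2*(n:ℂ)+1 = ((2*n+1:ℕ):ℂ) by push_cast; rfl, Complex.norm_natCast]; simp
  have n3 : 1/(4*(2*(n:ℝ)+1)) ≤ 1/(4*(n+1)) := by
    apply one_div_le_one_div_of_le (by positivity); linarith [(Nat.cast_nonneg n : (0:ℝ) ≤ n)]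
  unfold TT
  refine (norm_sub_le _ _).trans ?_
  rw [norm_mul, norm_mul, norm_mul, norm_mul, n1, n2, e1]
  calc _ ≤ 1/(8*((n:ℝ)+1)) * (D * (2*√(n+1)) * (C/(n+1))) + 1/(4*((n:ℝ)+1)) * (D*√(n+1) * (C/(n+1))) := by
        gcongr
    _ = (C * D)/2 * (√((n:ℝ)+1) / ((n+1)*(n+1))) := by field_simp; ring
    _ ≤ _ := by
        apply mul_le_mul_of_nonneg_right _ (by positivity)
        have := mul_nonneg hC hD
        linarith

lemma summable_bd : Summable (fun n : ℕ => (1 / ((n+1 : ℕ):ℝ) ^ (3/2 : ℝ))) :=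
  (summable_nat_add_iff (f := fun n : ℕ => 1 / ((n : ℕ):ℝ) ^ (3/2 : ℝ)) 1).mpr
    (Real.summable_one_div_nat_rpow.mpr (by norm_num))

lemma summable_TT {x y : ℂ} (hx : ∀ n : ℤ, x ≠ (n : ℂ)) (hy : ∀ n : ℤ, 2 * y ≠ 2 * (n : ℂ) + 1) :
    Summable (TT x y) := by
  obtain ⟨C, hC, hY⟩ := YY_bound hy
  obtain ⟨D, hD⟩ := XX_bound hx
  have hD0 : 0 ≤ D := (norm_nonneg _).trans (hD 0)
  refine Summable.of_norm_bounded (summable_bd.mul_left (C*D)) (term_bound hC hD0 hY x fun n => ?_)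
  refine (hD n).trans (le_mul_of_one_le_right hD0 ?_)
  rw [Real.one_le_sqrt]; linarith [(Nat.cast_nonneg n : (0:ℝ) ≤ n)]

lemma tendsto_KK {x y : ℂ} (hx : ∀ n : ℤ, x ≠ (n : ℂ)) (hy : ∀ n : ℤ, 2 * y ≠ 2 * (n : ℂ) + 1)
   (hL : LL x y ≠ 0) :
   Tendsto (KK x y) atTop (𝓝 (y * AA x y * (Complex.cot (Real.pi * x) * Complex.tan (Real.pi * y)) / (4 * LL x y))) := by
  have hx0 : x ≠ 0 := by simpa using hx 0
  have hX := tendsto_XX hx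
  have hY := tendsto_YY hy
  have i := tendsto_inv_nat
  have t1 := (tendsto_rr (1/2+x)).div (tendsto_rr (1+x)) one_ne_zero
  have t2 := (((tendsto_rr 1).mul (tendsto_rr (1/2))).const_mul (AA x y)).add
    ((i.mul i).const_mul ((AA x y)^2 - (x+1/2)^2/2 - (x+1/2)^2 * AA x y))
  have t3 := ((tendsto_rr (1/2+x)).mul (tendsto_rr (3/2))).div
    (((tendsto_rr (1-x)).mul (tendsto_rr (1+x))).mul (tendsto_rr (2+x))) (by simp)
  have t4 := ((hX.mul hY).const_mul (-(1/(8*x)))).mul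
    (((t1.mul t2).const_mul (2/LL x y)).add ((i.mul (i.mul i)).mul t3))
  have e : y * AA x y * (Complex.cot (Real.pi * x) * Complex.tan (Real.pi * y)) / (4 * LL x y) =
     (-(1/(8*x))) * (x * Complex.cot (Real.pi * x) * (-y * Complex.tan (Real.pi * y))) *
      (2/LL x y * (1/1*(AA x y * (1*1) + ((AA x y)^2 - (x+1/2)^2/2 - (x+1/2)^2 * AA x y)*(0*0))) + 0*(0*0)*(1*1/(1*1*1))) := by
    field_simp
    ring
  rw [e]
  refine t4.congr' ?_
  filter_upwards [eventually_gt_atTop 0] with n hn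
  have c0 : (n:ℂ) ≠ 0 := by exact_mod_cast hn.ne'
  unfold KK QQ
  obtain ⟨a1, a1'⟩ := int_ne hx (n+1)
  obtain ⟨a2, a2'⟩ := int_ne hx (n+2)
  push_cast at *
  have e2 : ((n:ℂ)+1)^2-x^2 = (n+1-x)*(n+1+x) := by ring
  simp only [Pi.div_apply, e2, ← add_assoc, ← add_sub_assoc]
  generalize XX x n = P
  generalize YY y (n+1) = Q
  generalize LL x y = l at *
  generalize AA x y = A
  generalize (n:ℂ) = k at *
  field_simp
  ring

lemma tsum_step {x y : ℂ} (hx : ∀ n : ℤ, x ≠ (n : ℂ)) (hy : ∀ n : ℤ, 2 * y ≠ 2 * (n : ℂ) + 1)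
   (h1 : x - y ≠ 0) (h2 : x+y+1 ≠ 0) (h3 : x + y ≠ 0) (h4 : x+1-y ≠ 0) :
   ∑' m, TT (x+1) y m - ∑' m, TT x y m =
    y * AA x y * (Complex.cot (Real.pi * x) * Complex.tan (Real.pi * y)) / (4 * LL x y) - GG0 x y := by
  have hL : LL x y ≠ 0 := by
    unfold LL; exact neg_ne_zero.mpr (mul_ne_zero (mul_ne_zero (mul_ne_zero h1 h2) h3) h4)
  have s1 := summable_TT (int_shift hx) hy
  have s2 := summable_TT hx hy
  rw [← s1.tsum_sub s2]
  have p : ∀ n : ℕ, ∑ m ∈ range (n+1), (TT (x+1) y m - TT x y m) = KK x y n - GG0 x y := by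
    intro n
    induction n with
    | zero => simp only [zero_add, sum_range_one]; exact KK_zero hx hy h1 h2 h3 h4
    | succ n ih => rw [sum_range_succ, ih, KK_succ hx hy h1 h2 h3 h4]; ring
  have t := ((s1.sub s2).hasSum.tendsto_sum_nat).comp (tendsto_add_atTop_nat 1)
  refine tendsto_nhds_unique t ?_
  refine ((tendsto_KK hx hy hL).sub_const (GG0 x y)).congr fun n => ?_
  simp only [Function.comp]
  rw [← p n]

lemma digammaC_succ {z : ℂ} (hz : ∀ n : ℕ, z ≠ -(n:ℂ)) : digammaC (z+1) = digammaC z + z⁻¹ :=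
  Complex.digamma_apply_add_one z hz

noncomputable def RR (x y : ℂ) : ℂ :=
      (1/8) * digammaC (1 + x + y) + (1/8) * digammaC (1 + x - y)
        - (1/4) * digammaC (1 + x) + (1/4) * digammaC (1 + y)
        - (1/2) * digammaC (1 + 2 * y) + 1 / (8 * x)
        - (Real.eulerMascheroniConstant : ℂ) / 4
        + ((Real.pi : ℂ) / 8) * Complex.tan (Real.pi * y)
        + (Complex.cot (Real.pi * x) * Complex.tan (Real.pi * y) - 1) / (16 * (x - y))
        - (Complex.cot (Real.pi * x) * Complex.tan (Real.pi * y) + 1) / (16 * (x + y))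
        + (1/8) * Complex.cot (Real.pi * x) * Complex.tan (Real.pi * y) *
            (digammaC (1 + x + y) - digammaC (1 + x - y))

lemma cot_shift (x : ℂ) : Complex.cot (Real.pi * (x+1)) = Complex.cot (Real.pi * x) := by
  rw [Complex.cot_eq_cos_div_sin, Complex.cot_eq_cos_div_sin, mul_add, mul_one, Complex.cos_add_pi,
    Complex.sin_add_pi, neg_div_neg_eq]

/-- admissible points -/
def Adm (x y : ℂ) : Prop := (∀ n : ℤ, x ≠ (n : ℂ)) ∧ (∀ n : ℕ, x + y ≠ -(n:ℂ)) ∧ (∀ n : ℕ, x - y ≠ -(n:ℂ))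

lemma Adm.succ {x y : ℂ} (h : Adm x y) : Adm (x+1) y := by
  refine ⟨int_shift h.1, fun n hn => h.2.1 (n+1) ?_, fun n hn => h.2.2 (n+1) ?_⟩ <;>
  push_cast <;> linear_combination hn

lemma RR_step {x y : ℂ} (h : Adm x y) :
   RR (x+1) y - RR x y =
    y * AA x y * (Complex.cot (Real.pi * x) * Complex.tan (Real.pi * y)) / (4 * LL x y) - GG0 x y := by
  obtain ⟨hx, hp, hm⟩ := h
  have d1 := digammaC_succ (z := 1 + x + y) (fun n hn => hp (n+1) (by push_cast; linear_combination hn))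
  have d2 := digammaC_succ (z := 1 + x - y) (fun n hn => hm (n+1) (by push_cast; linear_combination hn))
  have d3 := digammaC_succ (z := 1 + x) (fun n hn => hx (-n-1) (by push_cast; linear_combination hn))
  have hx0 : x ≠ 0 := by simpa using hx 0
  have hx1 : x + 1 ≠ 0 := fun h => hx (-1) (by push_cast; linear_combination h)
  have p0 : x + y ≠ 0 := by simpa using hp 0
  have m0 : x - y ≠ 0 := by simpa using hm 0
  have p1 : x + y + 1 ≠ 0 := fun h => hp 1 (by push_cast; linear_combination h)
  have m1 : x + 1 - y ≠ 0 := fun h => hm 1 (by push_cast; linear_combination h)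
  unfold RR
  rw [cot_shift, show 1+(x+1)+y = 1+x+y+1 by ring, show 1+(x+1)-y = 1+x-y+1 by ring,
    show 1+(x+1) = 1+x+1 by ring, d1, d2, d3]
  generalize Complex.cot (Real.pi * x) = c1
  generalize Complex.tan (Real.pi * y) = c2
  rw [show 1+x+y = x+y+1 by ring, show 1+x-y = x+1-y by ring, show 1+x = x+1 by ring,
   show x+1+y = x+y+1 by ring]
  generalize digammaC (x+y+1) = f1
  generalize digammaC (x+1-y) = f2
  generalize digammaC (x+1) = f3
  obtain ⟨c, hc⟩ : ∃ c, c = c1 * c2 := ⟨_, rfl⟩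
  have key : (1/8) * (x+y+1)⁻¹ + (1/8)*(x+1-y)⁻¹ - (1/4)*(x+1)⁻¹ + 1/(8*(x+1)) - 1/(8*x)
    + (c-1)/(16*(x+1-y)) - (c-1)/(16*(x-y)) - (c+1)/(16*(x+y+1)) + (c+1)/(16*(x+y))
    + (1/8)*c*((x+y+1)⁻¹-(x+1-y)⁻¹) = y * AA x y * c / (4 * LL x y) - GG0 x y := by
    unfold AA LL GG0
    field_simp
    ring
  rw [← hc, ← key, mul_assoc (1/8) c1 c2, ← hc]
  ring


lemma re_norm_lb {s : ℂ} (hs : -(1/2) < s.re) (n : ℕ) : ((n:ℝ)+1)/2 ≤ ‖s + (n+1)‖ := by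
  have h := Complex.re_le_norm (s + (n+1))
  simp at h
  have : (0:ℝ) ≤ n := Nat.cast_nonneg n
  linarith

lemma gder {s : ℂ} (hs : -(1/2) < s.re) (n : ℕ) :
    HasDerivAt (fun s : ℂ => s/((n:ℂ)+1) - Complex.log (1 + s/((n:ℂ)+1)))
      (1/((n:ℂ)+1) - 1/(s+(n+1))) s := by
  have c0 : ((n:ℂ)+1) ≠ 0 := Nat.cast_add_one_ne_zero n
  have c1 : s+((n:ℂ)+1) ≠ 0 := by
    rw [← norm_pos_iff]
    have := re_norm_lb hs n
    have : (0:ℝ) ≤ n := Nat.cast_nonneg n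
    linarith
  have hd : HasDerivAt (fun s : ℂ => s/((n:ℂ)+1)) (1/((n:ℂ)+1)) s := (hasDerivAt_id s).div_const _
  have hm : 1 + s/((n:ℂ)+1) ∈ Complex.slitPlane := by
    left
    have e : (1 + s/((n:ℂ)+1)).re = 1 + s.re/((n:ℝ)+1) := by
      rw [← Nat.cast_add_one, Complex.add_re, Complex.div_natCast_re]; simp
    rw [e]
    have : (0:ℝ) ≤ n := Nat.cast_nonneg n
    have : -(1/2) < s.re/((n:ℝ)+1) := by
      rw [lt_div_iff₀ (by positivity)]; nlinarith
    linarith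
  have h2 := (hd.const_add 1).clog hm
  refine (hd.sub h2).congr_deriv ?_
  have : 1 + s/((n:ℂ)+1) = (s+(n+1))/(n+1) := by field_simp; ring
  rw [this]
  field_simp

lemma gder_bd {s : ℂ} (hs : -(1/2) < s.re) (n : ℕ) {R : ℝ} (hR : ‖s‖ < R) :
    ‖1/((n:ℂ)+1) - 1/(s+(n+1))‖ ≤ 2*R*(1/((n+1:ℕ):ℝ)^2) := by
  have c0 : ((n:ℂ)+1) ≠ 0 := Nat.cast_add_one_ne_zero n
  have hb := re_norm_lb hs n
  have hn : (0:ℝ) ≤ n := Nat.cast_nonneg n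
  have c1 : s+((n:ℂ)+1) ≠ 0 := by
    rw [← norm_pos_iff]
    linarith
  have : 1/((n:ℂ)+1) - 1/(s+(n+1)) = s/((n+1)*(s+(n+1))) := by field_simp; ring
  have e : ‖(n:ℂ)+1‖ = (n:ℝ)+1 := by rw [← Nat.cast_add_one, Complex.norm_natCast]; simp
  rw [this, norm_div, norm_mul, e]
  calc ‖s‖/(((n:ℝ)+1)*‖s + (n+1)‖) ≤ R/((n+1)*(((n:ℝ)+1)/2)) := by
        have := norm_nonneg s
        gcongr
        linarith
    _ = _ := by push_cast; field_simp

lemma harmonic_cast (n : ℕ) : ((∑ j ∈ range n, 1/((j:ℂ)+1))) = (((harmonic n : ℚ) : ℝ) : ℂ) := by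
  unfold harmonic
  push_cast
  simp

lemma exp_g {s : ℂ} (hs : -(1/2) < s.re) :
    Tendsto (fun n : ℕ => Complex.exp (∑ j ∈ range n, (s/((j:ℂ)+1) - Complex.log (1 + s/((j:ℂ)+1)))))
      atTop (𝓝 (Complex.exp (s * Real.eulerMascheroniConstant) * Complex.Gamma (s+1))) := by
  have hn0 : ∀ n : ℕ, s + (n+1) ≠ 0 := fun n => by
    rw [← norm_pos_iff]
    have := re_norm_lb hs n
    have : (0:ℝ) ≤ n := Nat.cast_nonneg n
    linarith
  have e1 : Tendsto (fun n : ℕ => Complex.exp (s * (((harmonic n : ℝ) - Real.log n : ℝ):ℂ))) atTop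
      (𝓝 (Complex.exp (s * Real.eulerMascheroniConstant))) := by
    refine (Complex.continuous_exp.tendsto _).comp (Tendsto.const_mul s ?_)
    exact (Complex.continuous_ofReal.tendsto _).comp Real.tendsto_harmonic_sub_log
  have e2 := (Complex.GammaSeq_tendsto_Gamma (s+1)).div (tendsto_nat_div (s+1)) one_ne_zero
  rw [div_one] at e2
  refine (e1.mul e2).congr' ?_
  filter_upwards [eventually_gt_atTop 0] with n hn
  have c0 : (n:ℂ) ≠ 0 := by exact_mod_cast hn.ne'
  have p : Complex.exp (∑ j ∈ range n, (s/((j:ℂ)+1) - Complex.log (1 + s/((j:ℂ)+1)))) =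
      Complex.exp (s * (((harmonic n : ℚ) : ℝ) : ℂ)) * (n.factorial / ∏ j ∈ range n, (s+1+j)) := by
    rw [← harmonic_cast, sum_sub_distrib, Complex.exp_sub, mul_sum]
    simp only [mul_one_div]
    rw [Complex.exp_sum (range n) (fun j => Complex.log (1 + s/((j:ℂ)+1))), div_eq_mul_inv]
    congr 1
    rw [← prod_range_add_one_eq_factorial]
    push_cast
    rw [← prod_div_distrib, ← prod_inv_distrib]
    refine prod_congr rfl fun j _ => ?_
    have cj : ((j:ℂ)+1) ≠ 0 := Nat.cast_add_one_ne_zero j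
    have e : 1 + s/((j:ℂ)+1) = (s+(j+1))/(j+1) := by field_simp; ring
    rw [Complex.exp_log, e, inv_div]
    · congr 1; ring
    · rw [e]; exact div_ne_zero (hn0 j) cj
  rw [p]
  simp only [Pi.div_apply]
  unfold Complex.GammaSeq
  rw [prod_range_succ, Complex.cpow_add _ _ c0, Complex.cpow_one, Complex.cpow_def_of_ne_zero c0,
    Complex.ofReal_sub, mul_sub, Complex.exp_sub, Complex.ofReal_log (Nat.cast_nonneg n), Complex.ofReal_natCast,
    mul_comm s (Complex.log n)]
  have q : ∏ j ∈ range n, (s+1+j) ≠ 0 := prod_ne_zero_iff.mpr fun j _ => by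
    have := hn0 j
    rwa [← add_assoc, add_right_comm] at this
  have q2 : s + 1 + n ≠ 0 := by
    have := hn0 n
    rwa [← add_assoc, add_right_comm] at this
  have q4 : (n:ℂ) + (s+1) ≠ 0 := by rwa [add_comm]
  have q3 := Complex.exp_ne_zero (Complex.log n * s)
  field_simp
  ring

set_option maxHeartbeats 1000000 in
lemma psi_sum {s : ℂ} (hs : -(1/2) < s.re) :
    HasSum (fun n : ℕ => 1/((n:ℂ)+1) - 1/(s+(n+1)))
      (digammaC (s+1) + Real.eulerMascheroniConstant) := by
  set R := ‖s‖ + 1 with hR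
  set t : Set ℂ := {z | -(1/2) < z.re} ∩ Metric.ball 0 R with ht
  have hto : IsOpen t := (isOpen_lt continuous_const Complex.continuous_re).inter Metric.isOpen_ball
  have tc : IsPreconnected t :=
    ((convex_halfSpace_re_gt (-(1/2))).inter (convex_ball 0 R)).isPreconnected
  have st : s ∈ t := ⟨hs, by simp [hR]⟩
  have zt : (0:ℂ) ∈ t := ⟨by simp, by simp [hR]; positivity⟩
  have su : Summable (fun n : ℕ => 2*R*(1/((n+1:ℕ):ℝ)^2)) :=
    ((summable_nat_add_iff (f := fun n : ℕ => 1 / ((n : ℕ):ℝ) ^ 2) 1).mpr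
      (Real.summable_one_div_nat_pow.mpr (by norm_num))).mul_left _
  have hg : ∀ (n : ℕ), ∀ z ∈ t, HasDerivAt
      ((fun (n:ℕ) (s : ℂ) => s/((n:ℂ)+1) - Complex.log (1 + s/((n:ℂ)+1))) n)
      ((fun (n:ℕ) (s:ℂ) => 1/((n:ℂ)+1) - 1/(s+(n+1))) n z) z := fun n z hz => gder hz.1 n
  have hb : ∀ (n : ℕ), ∀ z ∈ t, ‖(fun (n:ℕ) (s:ℂ) => 1/((n:ℂ)+1) - 1/(s+(n+1))) n z‖ ≤ 2*R*(1/((n+1:ℕ):ℝ)^2) :=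
    fun n z hz => gder_bd hz.1 n (by simpa using hz.2)
  have s0 : Summable (fun n : ℕ => (fun (n:ℕ) (s : ℂ) => s/((n:ℂ)+1) - Complex.log (1 + s/((n:ℂ)+1))) n 0) := by
    simp
  have D := hasDerivAt_tsum_of_isPreconnected su hto tc hg hb zt s0 st
  have S : ∀ z ∈ t, Summable (fun n : ℕ => z/((n:ℂ)+1) - Complex.log (1 + z/((n:ℂ)+1))) := fun z hz =>
    summable_of_summable_hasDerivAt_of_isPreconnected su hto tc hg hb zt s0 hz
  have G : ∀ z ∈ t, Complex.Gamma (z+1) = Complex.exp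
      (∑' n : ℕ, (z/((n:ℂ)+1) - Complex.log (1 + z/((n:ℂ)+1))) - z * Real.eulerMascheroniConstant) := by
    intro z hz
    have l1 := (Complex.continuous_exp.tendsto _).comp (S z hz).hasSum.tendsto_sum_nat
    have l2 := tendsto_nhds_unique l1 (exp_g hz.1)
    rw [Complex.exp_sub, l2]
    field_simp [Complex.exp_ne_zero]
  have D2 := (D.sub ((hasDerivAt_id s).mul_const (Real.eulerMascheroniConstant:ℂ))).cexp
  have D3 : HasDerivAt (fun z => Complex.Gamma (z+1)) _ s := D2.congr_of_eventuallyEq (by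
    filter_upwards [hto.mem_nhds st] with z hz
    exact G z hz)
  have D4 : deriv Complex.Gamma (s+1) = _ := (deriv_comp_add_const Complex.Gamma 1 s).symm.trans D3.deriv
  have Sm : Summable (fun n : ℕ => 1/((n:ℂ)+1) - 1/(s+(n+1))) :=
    Summable.of_norm_bounded su fun n => hb n s st
  convert Sm.hasSum using 1
  unfold digammaC
  rw [D4, G s st]
  simp only [id, Pi.sub_apply, one_mul]
  field_simp [Complex.exp_ne_zero]
  ring

lemma psi_asymp {s : ℂ} (hs : -(1/2) < s.re) :
    Tendsto (fun N : ℕ => digammaC (s+1+N) - ∑ j ∈ range N, 1/((j:ℂ)+1)) atTop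
      (𝓝 (-(Real.eulerMascheroniConstant:ℂ))) := by
  have hn0 : ∀ n : ℕ, s + (n+1) ≠ 0 := fun n => by
    rw [← norm_pos_iff]
    have := re_norm_lb hs n
    have : (0:ℝ) ≤ n := Nat.cast_nonneg n
    linarith
  have h := ((psi_sum hs).tendsto_sum_nat).const_sub (digammaC (s+1))
  rw [sub_add_cancel_left] at h
  refine h.congr fun N => ?_
  have : digammaC (s+1+N) = digammaC (s+1) + ∑ j ∈ range N, 1/(s+(j+1)) := by
    induction N with
    | zero => simp
    | succ N ih =>
      rw [Nat.cast_add_one, ← add_assoc, digammaC_succ, ih, sum_range_succ, one_div (s+((N:ℂ)+1)), add_assoc]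
      · congr 3; ring
      · intro n hn
        apply hn0 (N+n)
        push_cast
        linear_combination hn
  rw [this, sum_sub_distrib]
  ring


/-- comparison product -/
noncomputable def BB (k : ℕ) : ℝ := ∏ i ∈ range k, (1 + 1/(2*((i:ℝ)+1)))

lemma BB_pos (k : ℕ) : 0 < BB k := prod_pos fun i _ => by positivity

lemma BB_mono : Monotone BB := monotone_nat_of_le_succ fun n => by
  unfold BB
  rw [prod_range_succ]
  exact le_mul_of_one_le_right (BB_pos n).le (by simp; positivity)

lemma BB_sq (k : ℕ) : (BB k)^2 ≤ (4*k+3)/3 := by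
  induction k with
  | zero => simp [BB]
  | succ k ih =>
    unfold BB at *
    rw [prod_range_succ, mul_pow]
    calc _ ≤ (4*(k:ℝ)+3)/3 * (1 + 1/(2*((k:ℝ)+1)))^2 := by gcongr
      _ ≤ _ := by
        push_cast
        rw [show (1 + 1/(2*((k:ℝ)+1))) = (2*k+3)/(2*(k+1)) by field_simp; ring, div_pow, div_mul_div_comm,
          div_le_div_iff₀ (by positivity) (by positivity)]
        have : (0:ℝ) ≤ k := Nat.cast_nonneg k
        nlinarith

lemma BB_le (k : ℕ) : BB k ≤ 2 * √(k+1) := by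
  have h := BB_sq k
  have hk : (0:ℝ) ≤ k := Nat.cast_nonneg k
  refine abs_le_of_sq_le_sq' ?_ (by positivity) |>.2
  rw [mul_pow, Real.sq_sqrt (by positivity)]
  linarith

/-- single factor -/
noncomputable def ph (u : ℂ) : ℝ := ‖u + 1/2‖ / ‖u‖

lemma ph_nonneg (u : ℂ) : 0 ≤ ph u := div_nonneg (norm_nonneg _) (norm_nonneg _)

lemma ph_le (u : ℂ) (i : ℕ) (h : (i:ℝ)+1 ≤ u.re) : ph u ≤ 1 + 1/(2*((i:ℝ)+1)) := by
  have hu := (h.trans (Complex.re_le_norm u))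
  have hu0 : 0 < ‖u‖ := lt_of_lt_of_le (by positivity) hu
  unfold ph
  rw [div_le_iff₀ hu0]
  have h1 := norm_add_le u (1/2)
  have h2 : ‖(1/2:ℂ)‖ = 1/2 := by simp
  have h3 : 1/2 ≤ 1/(2*((i:ℝ)+1)) * ‖u‖ := by
    calc (1/2:ℝ) = 1/(2*((i:ℝ)+1)) * ((i:ℝ)+1) := by field_simp
      _ ≤ _ := by gcongr
  linarith

lemma ph_le_one (u : ℂ) (h : u.re ≤ -(1/4)) : ph u ≤ 1 := by
  unfold ph
  refine div_le_one_of_le₀ ?_ (norm_nonneg _)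
  rw [← sq_le_sq₀ (norm_nonneg _) (norm_nonneg _), Complex.sq_norm, Complex.sq_norm, Complex.normSq_apply, Complex.normSq_apply]
  simp
  nlinarith

lemma Phi_low {x : ℂ} (hx : 1 ≤ x.re) {N k : ℕ} (h : k ≤ N) :
    ∏ j ∈ range k, ph (x + N - 1 - j) ≤ BB k := by
  rw [← prod_range_reflect]
  refine prod_le_prod (fun i _ => ph_nonneg _) fun i hi => ph_le _ _ ?_
  have hi := mem_range.mp hi
  rw [show k - 1 - i = k - (1+i) by omega, Nat.cast_sub (by omega)]
  have : (k:ℝ) ≤ N := by exact_mod_cast h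
  simp
  linarith

lemma Phi_zero (x : ℂ) : ∃ E : ℝ, 0 ≤ E ∧ ∀ l : ℕ, ∏ j ∈ range l, ph (x - 1 - j) ≤ E := by
  obtain ⟨M, hM⟩ := exists_nat_ge x.re
  have anti : ∀ l, M ≤ l → ∏ j ∈ range l, ph (x - 1 - j) ≤ ∏ j ∈ range M, ph (x - 1 - j) := by
    intro l hl
    induction l, hl using Nat.le_induction with
    | base => exact le_rfl
    | succ l hl ih =>
      rw [prod_range_succ]
      refine (mul_le_of_le_one_right (prod_nonneg fun i _ => ph_nonneg _) (ph_le_one _ ?_)).trans ih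
      have : (M:ℝ) ≤ l := by exact_mod_cast hl
      simp
      linarith
  refine ⟨∑ l ∈ range (M+1), ∏ j ∈ range l, ph (x - 1 - j),
    sum_nonneg fun l _ => prod_nonneg fun i _ => ph_nonneg _, fun l => ?_⟩
  have key : ∀ l ≤ M, ∏ j ∈ range l, ph (x - 1 - j) ≤ ∑ l ∈ range (M+1), ∏ j ∈ range l, ph (x - 1 - j) :=
    fun l hl => single_le_sum (f := fun l => ∏ j ∈ range l, ph (x - 1 - j))
      (fun l _ => prod_nonneg fun i _ => ph_nonneg _) (mem_range.mpr (by omega))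
  rcases le_total l M with h | h
  · exact key l h
  · exact (anti l h).trans (key M le_rfl)

lemma XX_dom {x : ℂ} (hx : 1 ≤ x.re) :
    ∃ D : ℝ, 0 ≤ D ∧ ∀ N n : ℕ, ‖XX (x+N) n‖ ≤ D * √(n+1) := by
  obtain ⟨E, hE, hl⟩ := Phi_zero x
  have key : ∀ N n : ℕ, ∏ j ∈ range n, ph (x + N - 1 - j) ≤ (E+1) * BB n := by
    intro N n
    rcases le_total n N with h | h
    · exact (Phi_low hx h).trans (le_mul_of_one_le_left (BB_pos n).le (by linarith))
    · obtain ⟨l, rfl⟩ := Nat.exists_eq_add_of_le h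
      rw [prod_range_add]
      have e : ∏ j ∈ range l, ph (x + N - 1 - ((N + j : ℕ):ℂ)) = ∏ j ∈ range l, ph (x - 1 - j) := by
        refine prod_congr rfl fun j _ => ?_
        congr 1; push_cast; ring
      rw [e, mul_comm]
      have a1 := hl l
      have a2 := (Phi_low hx (le_refl N)).trans (BB_mono h)
      refine mul_le_mul (by linarith) a2 (prod_nonneg fun i _ => ph_nonneg _) (by linarith)
  refine ⟨(E+1)*2, by linarith, fun N n => ?_⟩
  have b : ‖XX (x+N) n‖ ≤ ∏ j ∈ range n, ph (x + N - 1 - j) := by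
    unfold XX
    rw [norm_prod]
    refine prod_le_prod (fun _ _ => norm_nonneg _) fun j _ => ?_
    rw [show ((j:ℂ)+1/2)^2-(x+N)^2 = -((x+N-1-j+1/2)*(x+N+j+1/2)) by ring,
      show ((j:ℂ)+1)^2-(x+N)^2 = -((x+N-1-j)*(x+N+j+1)) by ring, neg_div_neg_eq, norm_div, norm_mul, norm_mul,
      mul_div_mul_comm]
    refine mul_le_of_le_one_right (ph_nonneg _) (div_le_one_of_le₀ ?_ (norm_nonneg _))
    rw [← sq_le_sq₀ (norm_nonneg _) (norm_nonneg _), Complex.sq_norm, Complex.sq_norm, Complex.normSq_apply, Complex.normSq_apply]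
    have : (0:ℝ) ≤ j := Nat.cast_nonneg j
    have : (0:ℝ) ≤ N := Nat.cast_nonneg N
    simp
    nlinarith
  calc _ ≤ _ := b
    _ ≤ _ := key N n
    _ ≤ (E+1) * (2 * √(n+1)) := mul_le_mul_of_nonneg_left (BB_le n) (by linarith)
    _ = _ := by ring

lemma tendsto_addN (a : ℂ) : Tendsto (fun N : ℕ => (a + N)⁻¹) atTop (𝓝 0) := by
  have h := (tendsto_inv_nat.mul (tendsto_nat_div a))
  rw [zero_mul] at h
  refine h.congr' ?_
  filter_upwards [eventually_gt_atTop 0] with n hn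
  have c0 : (n:ℂ) ≠ 0 := by exact_mod_cast hn.ne'
  rw [one_div_mul_eq_div, div_div, mul_comm, ← div_div, div_self c0, add_comm, one_div]

lemma tendsto_XX_shift (x : ℂ) (k : ℕ) : Tendsto (fun N : ℕ => XX (x+N) k) atTop (𝓝 1) := by
  have : Tendsto (fun N : ℕ => XX (x+N) k) atTop (𝓝 (∏ j ∈ range k, (1/1*(1/1)))) := by
    unfold XX
    refine tendsto_finsetProd _ fun j _ => ?_
    have t : ∀ a : ℂ, Tendsto (fun N : ℕ => (a + N)/N) atTop (𝓝 1) := fun a => by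
      simpa only [add_comm] using tendsto_rr a
    have h := ((t (x - j - 1/2)).div (t (x-1-j)) one_ne_zero).mul ((t (x+j+1/2)).div (t (x+j+1)) one_ne_zero)
    refine h.congr' ?_
    filter_upwards [eventually_gt_atTop 0] with n hn
    have c0 : (n:ℂ) ≠ 0 := by exact_mod_cast hn.ne'
    simp only [Pi.div_apply]
    rw [div_div_div_cancel_right₀ c0, div_div_div_cancel_right₀ c0, div_mul_div_comm, ← neg_div_neg_eq]
    congr 1 <;> ring
  simpa using this

noncomputable def SS (y : ℂ) : ℂ :=
  ∑' m : ℕ, (-(1/(8*((m:ℂ)+1)))*(1*YY y (m+1)) - (1/(4*(2*(m:ℂ)+1)))*(1*YY y (m+1)))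

lemma tendsto_sum {x y : ℂ} (hx : 1 ≤ x.re) (hy : ∀ n : ℤ, 2 * y ≠ 2 * (n : ℂ) + 1) :
    Tendsto (fun N : ℕ => ∑' m, TT (x+N) y m) atTop (𝓝 (SS y)) := by
  obtain ⟨C, hC, hY⟩ := YY_bound hy
  obtain ⟨D, hD, hX⟩ := XX_dom hx
  refine tendsto_tsum_of_dominated_convergence (summable_bd.mul_left (C*D)) (fun k => ?_)
    (Eventually.of_forall fun N k => term_bound hC hD hY _ (hX N) k)
  unfold TT
  exact (((tendsto_XX_shift x (k+1)).mul_const _).const_mul _).sub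
    (((tendsto_XX_shift x k).mul_const _).const_mul _)


lemma cot_shiftN (x : ℂ) (N : ℕ) : Complex.cot (Real.pi * (x+N)) = Complex.cot (Real.pi * x) := by
  induction N with
  | zero => simp
  | succ N ih => rw [Nat.cast_add_one, ← add_assoc, cot_shift, ih]

noncomputable def RI (y : ℂ) : ℂ := (1/4) * digammaC (1 + y)
        - (1/2) * digammaC (1 + 2 * y) - (Real.eulerMascheroniConstant : ℂ) / 4
        + ((Real.pi : ℂ) / 8) * Complex.tan (Real.pi * y)

lemma tendsto_RR {x y : ℂ} (h0 : -(1/2) < x.re) (h1 : -(1/2) < (x+y).re) (h2 : -(1/2) < (x-y).re) :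
    Tendsto (fun N : ℕ => RR (x+N) y) atTop (𝓝 (RI y)) := by
  have a0 := psi_asymp h0
  have a1 := psi_asymp h1
  have a2 := psi_asymp h2
  have i0 := tendsto_addN x
  have i1 := tendsto_addN (x+y)
  have i2 := tendsto_addN (x-y)
  have T := (((((((a1.const_mul (1/8)).add (a2.const_mul (1/8))).sub (a0.const_mul (1/4))).add
    (i0.const_mul (1/8))).add (i2.const_mul ((Complex.cot (Real.pi * x) * Complex.tan (Real.pi * y) - 1)/16))).sub
    (i1.const_mul ((Complex.cot (Real.pi * x) * Complex.tan (Real.pi * y) + 1)/16))).add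
    ((a1.sub a2).const_mul ((1/8) * Complex.cot (Real.pi * x) * Complex.tan (Real.pi * y)))).add_const (RI y)
  have T2 := T.congr (f₂ := fun N : ℕ => RR (x+N) y) (fun N => by
    unfold RR RI
    rw [cot_shiftN, show 1 + (x+N) + y = x+y+1+N by ring, show 1 + (x+N) - y = x-y+1+N by ring,
      show 1 + (x+N) = x+1+N by ring, show x + N - y = x - y + N by ring, show x+N+y = x+y+N by ring]
    rw [one_div (8 * (x+(N:ℂ))), div_eq_mul_inv _ (16 * (x-y+(N:ℂ))), div_eq_mul_inv _ (16 * (x+y+(N:ℂ))),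
      mul_inv, mul_inv, mul_inv]
    ring)
  convert T2 using 2
  ring

/-- the periodic difference -/
noncomputable def DD (x y : ℂ) : ℂ := ∑' m, TT x y m - RR x y

lemma DD_step {x y : ℂ} (h : Adm x y) (hy : ∀ n : ℤ, 2 * y ≠ 2 * (n : ℂ) + 1) : DD (x+1) y = DD x y := by
  have p0 : x + y ≠ 0 := by simpa using h.2.1 0
  have m0 : x - y ≠ 0 := by simpa using h.2.2 0
  have p1 : x + y + 1 ≠ 0 := fun h' => h.2.1 1 (by push_cast; linear_combination h')
  have m1 : x + 1 - y ≠ 0 := fun h' => h.2.2 1 (by push_cast; linear_combination h')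
  unfold DD
  linear_combination tsum_step h.1 hy m0 p1 p0 m1 - RR_step h

lemma DD_stepN {x y : ℂ} (h : Adm x y) (hy : ∀ n : ℤ, 2 * y ≠ 2 * (n : ℂ) + 1) (N : ℕ) :
    Adm (x+N) y ∧ DD (x+N) y = DD x y := by
  induction N with
  | zero => simpa using h
  | succ N ih =>
    rw [Nat.cast_add_one, ← add_assoc]
    exact ⟨ih.1.succ, (DD_step ih.1 hy).trans ih.2⟩

lemma DD_eq {x y : ℂ} (h : Adm x y) (hy : ∀ n : ℤ, 2 * y ≠ 2 * (n : ℂ) + 1) : DD x y = SS y - RI y := by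
  obtain ⟨M, hM⟩ := exists_nat_ge (1 + |x.re| + |y.re|)
  obtain ⟨hA, hD⟩ := DD_stepN h hy M
  have b1 := abs_le.mp (le_refl |x.re|)
  have b2 := abs_le.mp (le_refl |y.re|)
  have t := (tendsto_sum (x := x + M) (y := y) (by simp; linarith) hy).sub
    (tendsto_RR (x := x + M) (y := y) (by simp; linarith) (by simp; linarith) (by simp; linarith))
  have t2 : Tendsto (fun N : ℕ => DD (x+M+N) y) atTop (𝓝 (SS y - RI y)) := t
  rw [← hD]
  refine tendsto_nhds_unique (tendsto_const_nhds.congr fun N => ?_) t2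
  exact ((DD_stepN hA hy N).2).symm

lemma gamma_ne {z : ℂ} (hz : ∀ n : ℕ, z ≠ -(n:ℂ)) : HasDerivAt Complex.Gamma (digammaC z * Complex.Gamma z) z := by
  have h := (Complex.differentiableAt_Gamma z hz).hasDerivAt
  have h0 := Complex.Gamma_ne_zero hz
  refine h.congr_deriv ?_
  unfold digammaC
  field_simp

lemma psi_refl {z : ℂ} (hz : ∀ n : ℕ, z ≠ -(n:ℂ)) (hz' : ∀ n : ℕ, 1 - z ≠ -(n:ℂ))
    (hs : Complex.sin (Real.pi * z) ≠ 0) :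
    (digammaC z - digammaC (1-z)) * Complex.sin (Real.pi * z) + Real.pi * Complex.cos (Real.pi * z) = 0 := by
  have g1 := gamma_ne hz
  have g2 : HasDerivAt (fun w => Complex.Gamma (1-w)) (-(digammaC (1-z) * Complex.Gamma (1-z))) z := by
    have := (gamma_ne hz').comp z ((hasDerivAt_id z).const_sub 1)
    refine this.congr_deriv ?_
    ring
  have g3 : HasDerivAt (fun w : ℂ => Complex.sin (Real.pi * w)) (Complex.cos (Real.pi * z) * (Real.pi * 1)) z :=
    ((hasDerivAt_id z).const_mul (Real.pi:ℂ)).csin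
  have g := (g1.mul g2).mul g3
  have c : HasDerivAt (fun w : ℂ => Complex.Gamma w * Complex.Gamma (1-w) * Complex.sin (Real.pi * w)) 0 z := by
    refine (hasDerivAt_const z (Real.pi:ℂ)).congr_of_eventuallyEq ?_
    filter_upwards [g3.continuousAt.eventually_ne hs] with w hw
    rw [Complex.Gamma_mul_Gamma_one_sub, div_mul_cancel₀ _ hw]
  have e := g.unique c
  simp only [Pi.mul_apply] at e
  have n1 := Complex.Gamma_ne_zero hz
  have n2 := Complex.Gamma_ne_zero hz'
  refine (mul_eq_zero.mp (?_ : (Complex.Gamma z * Complex.Gamma (1-z)) * _ = 0)).resolve_left (mul_ne_zero n1 n2)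
  linear_combination e

lemma psi_dup {s : ℂ} (h1 : ∀ n : ℕ, s ≠ -(n:ℂ)) (h2 : ∀ n : ℕ, s + 1/2 ≠ -(n:ℂ)) (h3 : ∀ n : ℕ, 2*s ≠ -(n:ℂ)) :
    digammaC s + digammaC (s+1/2) = 2 * digammaC (2*s) - 2 * Complex.log 2 := by
  have g1 := gamma_ne h1
  have g2 : HasDerivAt (fun w => Complex.Gamma (w+1/2)) (digammaC (s+1/2) * Complex.Gamma (s+1/2)) s := by
    have := (gamma_ne h2).comp s ((hasDerivAt_id s).add_const (1/2))
    exact this.congr_deriv (by ring)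
  have g3 : HasDerivAt (fun w => Complex.Gamma (2*w)) (2 * (digammaC (2*s) * Complex.Gamma (2*s))) s := by
    have := (gamma_ne h3).comp s ((hasDerivAt_id s).const_mul 2)
    exact this.congr_deriv (by ring)
  have g4 : HasDerivAt (fun w : ℂ => (2:ℂ)^(1-2*w)) ((2:ℂ)^(1-2*s) * Complex.log 2 * (-(2*1))) s :=
    (((hasDerivAt_id s).const_mul 2).const_sub 1).const_cpow (Or.inl two_ne_zero)
  have g := g1.mul g2
  have c := (g3.mul g4).mul_const ((√Real.pi : ℝ):ℂ)
  have c2 : HasDerivAt (fun w => Complex.Gamma w * Complex.Gamma (w+1/2)) _ s :=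
    c.congr_of_eventuallyEq (Eventually.of_forall fun w => Complex.Gamma_mul_Gamma_add_half w)
  have e := g.unique c2
  have d := Complex.Gamma_mul_Gamma_add_half s
  have n1 := Complex.Gamma_ne_zero h1
  have n2 := Complex.Gamma_ne_zero h2
  rw [← sub_eq_zero]
  refine (mul_eq_zero.mp (?_ : (Complex.Gamma s * Complex.Gamma (s+1/2)) * _ = 0)).resolve_left (mul_ne_zero n1 n2)
  linear_combination e - (2 * digammaC (2*s) - 2 * Complex.log 2) * d

lemma XX_half (m : ℕ) : XX (1/2) (m+1) = 0 := by
  unfold XX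
  refine prod_eq_zero (mem_range.mpr (Nat.succ_pos m)) ?_
  simp

lemma half_Adm {y : ℂ} (hy : ∀ n : ℤ, 2 * y ≠ 2 * (n : ℂ) + 1) : Adm (1/2) y := by
  refine ⟨fun n hn => ?_, fun n hn => hy (-n-1) ?_, fun n hn => hy n ?_⟩
  · have : (1:ℂ) = ((2*n : ℤ):ℂ) := by push_cast; linear_combination 2*hn
    have : (1:ℤ) = 2*n := by exact_mod_cast this
    omega
  · push_cast; linear_combination 2*hn
  · push_cast; linear_combination -2*hn

lemma tsum_half {y : ℂ} : ∑' m, TT (1/2) y m = -(1/4) * ((0-y^2)/((1/2)^2-y^2)) := by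
  rw [tsum_eq_single 0]
  · unfold TT
    rw [XX_half]
    simp [XX, YY]
  · intro m hm
    obtain ⟨k, rfl⟩ := Nat.exists_eq_succ_of_ne_zero hm
    unfold TT
    rw [Nat.succ_eq_add_one, XX_half, XX_half]
    simp

lemma DD_half {y : ℂ} (hy : ∀ n : ℤ, 2 * y ≠ 2 * (n : ℂ) + 1)
    (h4 : ∀ n : ℕ, 1 + y ≠ -(n : ℂ)) (h5 : ∀ n : ℕ, 1 + 2 * y ≠ -(n : ℂ)) : DD (1/2) y = 0 := by
  obtain ⟨ha, hp, hm⟩ := half_Adm hy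
  have p0 : 1/2 + y ≠ 0 := by simpa using hp 0
  have m0 : 1/2 - y ≠ 0 := by simpa using hm 0
  have d1 := digammaC_succ hp
  have d2 := digammaC_succ hm
  have d3 := digammaC_succ (z := 1/2) (fun n hn => ha (-n) (by push_cast; exact hn))
  have d4 : digammaC (1/2) = -2 * Complex.log 2 - Real.eulerMascheroniConstant := Complex.digamma_one_half
  have hc : Complex.cos (Real.pi * y) ≠ 0 := by
    intro h
    rw [Complex.cos_eq_zero_iff] at h
    obtain ⟨k, hk⟩ := h
    apply hy k
    have hpi : (Real.pi:ℂ) ≠ 0 := by exact_mod_cast Real.pi_ne_zero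
    refine mul_left_cancel₀ hpi ?_
    linear_combination 2*hk
  have es : Complex.sin (Real.pi * (1/2+y)) = Complex.cos (Real.pi * y) := by
    rw [show (Real.pi:ℂ) * (1/2+y) = Real.pi * y + Real.pi/2 by ring, Complex.sin_add_pi_div_two]
  have ec : Complex.cos (Real.pi * (1/2+y)) = -Complex.sin (Real.pi * y) := by
    rw [show (Real.pi:ℂ) * (1/2+y) = Real.pi * y + Real.pi/2 by ring, Complex.cos_add_pi_div_two]
  have e1 : 1 - (1/2+y) = 1/2 - y := by ring
  have r := psi_refl hp (by rw [e1]; exact hm) (by rw [es]; exact hc)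
  rw [es, ec, e1] at r
  have r2 : digammaC (1/2+y) - digammaC (1/2-y) = Real.pi * Complex.tan (Real.pi * y) := by
    rw [Complex.tan_eq_sin_div_cos, ← mul_div_assoc, eq_div_iff hc]
    linear_combination r
  have e2 : 1/2 + y + 1/2 = 1 + y := by ring
  have e3 : 2 * (1/2 + y) = 1 + 2*y := by ring
  have du := psi_dup hp (by rw [e2]; exact h4) (by rw [e3]; exact h5)
  rw [e2, e3] at du
  have cot0 : Complex.cot (Real.pi * (1/2)) = 0 := by
    rw [Complex.cot_eq_cos_div_sin, mul_one_div, Complex.cos_pi_div_two, zero_div]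
  unfold DD RR
  rw [tsum_half, cot0, show 1 + 1/2 + y = 1/2 + y + 1 by ring, show 1 + 1/2 - y = 1/2 - y + 1 by ring,
    show (1:ℂ) + 1/2 = 1/2 + 1 by ring, d1, d2, d3, d4]
  have alg : -(1/4) * ((0-y^2)/((1/2)^2-y^2)) = -(1/4) + (1/16) * (1/2+y)⁻¹ + (1/16)*(1/2-y)⁻¹ := by
    have gen : ∀ a b : ℂ, a ≠ 0 → b ≠ 0 → a + b = 1 → a * b = 1/4 - y^2 →
        -(1/4) * ((0-y^2)/(a*b)) = -(1/4) + (1/16) * a⁻¹ + (1/16)*b⁻¹ := by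
      intro a b h1 h2 h3 h4
      have : y^2 = 1/4 - a*b := by linear_combination h4
      rw [this]
      field_simp
      linear_combination -16 * h3
    rw [show ((1/2)^2-y^2) = (1/2+y)*(1/2-y) by ring]
    exact gen _ _ p0 m0 (by ring) (by ring)
  rw [alg, div_eq_mul_inv _ (16 * (1/2-y)), div_eq_mul_inv _ (16 * (1/2+y)), mul_inv, mul_inv]
  linear_combination (1/8) * r2 + (-1/4) * du

lemma main_id {x y : ℂ} (h : Adm x y) (hy : ∀ n : ℤ, 2 * y ≠ 2 * (n : ℂ) + 1)
    (h4 : ∀ n : ℕ, 1 + y ≠ -(n : ℂ)) (h5 : ∀ n : ℕ, 1 + 2 * y ≠ -(n : ℂ)) :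
    ∑' m, TT x y m = RR x y := by
  have a := DD_eq h hy
  have b := DD_eq (half_Adm hy) hy
  rw [DD_half hy h4 h5] at b
  rw [← b] at a
  exact sub_eq_zero.mp a

end Helpers

/-- The ₆F₅ evaluation (Theorem `6F5identity`):
`∑_{m≥0} (F_even(x,y,m) + F_odd(x,y,m))` equals the explicit digamma/trigonometric
expression, for all `x, y ∈ ℂ` at which both sides are defined. -/
theorem sixF5_identity (x y : ℂ)
    (hx : ∀ n : ℤ, x ≠ (n : ℂ))
    (hy : ∀ n : ℤ, 2 * y ≠ 2 * (n : ℂ) + 1)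
    (hxy : x ≠ y) (hxy' : x ≠ -y)
    (h1 : ∀ n : ℕ, 1 + x + y ≠ -(n : ℂ))
    (h2 : ∀ n : ℕ, 1 + x - y ≠ -(n : ℂ))
    (h3 : ∀ n : ℕ, 1 + x ≠ -(n : ℂ))
    (h4 : ∀ n : ℕ, 1 + y ≠ -(n : ℂ))
    (h5 : ∀ n : ℕ, 1 + 2 * y ≠ -(n : ℂ))
    (hden : ∀ m : ℕ, pochC (2 - x) m ≠ 0 ∧ pochC (2 + x) m ≠ 0 ∧
      pochC (1 - x) m ≠ 0 ∧ pochC (1 + x) m ≠ 0 ∧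
      pochC (3/2 - y) m ≠ 0 ∧ pochC (3/2 + y) m ≠ 0) :
    ∑' m : ℕ, (Feven x y m + Fodd x y m) =
      (1/8) * digammaC (1 + x + y) + (1/8) * digammaC (1 + x - y)
        - (1/4) * digammaC (1 + x) + (1/4) * digammaC (1 + y)
        - (1/2) * digammaC (1 + 2 * y) + 1 / (8 * x)
        - (Real.eulerMascheroniConstant : ℂ) / 4
        + ((Real.pi : ℂ) / 8) * Complex.tan (Real.pi * y)
        + (Complex.cot (Real.pi * x) * Complex.tan (Real.pi * y) - 1) / (16 * (x - y))
        - (Complex.cot (Real.pi * x) * Complex.tan (Real.pi * y) + 1) / (16 * (x + y))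
        + (1/8) * Complex.cot (Real.pi * x) * Complex.tan (Real.pi * y) *
            (digammaC (1 + x + y) - digammaC (1 + x - y)) := by
  rw [tsum_congr (F_eq_TT hx hy)]
  refine main_id ⟨hx, fun n hn => ?_, fun n hn => ?_⟩ hy h4 h5
  · cases n with
    | zero => exact hxy' (by push_cast at hn; linear_combination hn)
    | succ n => exact h1 n (by push_cast at hn; linear_combination hn)
  · cases n with
    | zero => exact hxy (by push_cast at hn; linear_combination hn)
    | succ n => exact h2 n (by push_cast at hn; linear_combination hn)
end

section
/- For every integer n ≥ 0, ζ^{1/2}(3, {2̄}^n) = −(i^n · δ_{n even}/2^{2n+1})·ζ(2n+3) + (1/(6ζ(2))) · ∑_{a+b+c = n+1, a,b,c ≥ 0} (−1)^a(1 − 2^{2a})·8^{−n}·ζ(2a)ζ(2b)ζ(2c+3)·( 2·δ_{c even} + (2i)^{c+1}·δ_{c odd} − 8·4^c ), where the right-hand side is computed in ℂ (with i the imaginary unit) and equals the real left-hand side. -/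
/-- The monotone index sequence `n_0 ≤ n_1 ≤ ⋯` of positive integers parametrized by the
gap function `g`: `n i = 1 + g 0 + g 1 + ⋯ + g i`.  Every weakly increasing tuple
`1 ≤ n_0 ≤ ⋯ ≤ n_{d−1}` arises from exactly one `g : Fin d → ℕ`, and `n i = n (i+1)`
holds iff `g (i+1) = 0`. -/
def idxSeq {d : ℕ} (g : Fin d → ℕ) (i : Fin d) : ℕ :=
  1 + ∑ j ∈ Finset.univ.filter (· ≤ i), g j

/-- The number of equalities `n i = n (i+1)` among consecutive entries of the index
sequence, i.e. the number of indices `i ≠ 0` with `g i = 0`. -/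
def repCount {d : ℕ} (g : Fin d → ℕ) : ℕ :=
  (Finset.univ.filter (fun i : Fin d => (i : ℕ) ≠ 0 ∧ g i = 0)).card

/-- The interpolated alternating multiple zeta value
`ζ^r(s₁,…,s_d; σ₁,…,σ_d) = ∑_{1 ≤ n₁ ≤ ⋯ ≤ n_d} r^{#{i : n_i = n_{i+1}}} ∏ σᵢ^{nᵢ}/nᵢ^{sᵢ}`. -/
noncomputable def zetaInterp (r : ℝ) {d : ℕ} (s : Fin d → ℕ) (σ : Fin d → ℝ) : ℝ :=
  ∑' g : Fin d → ℕ,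
    r ^ repCount g * ∏ i, σ i ^ idxSeq g i / (idxSeq g i : ℝ) ^ s i



namespace ZH
open Finset Filter Topology

/-- `(1±a)_l/(1/2±a)_l` -/
noncomputable def cc (a : ℂ) (l : ℕ) : ℂ :=
  ∏ j ∈ range l, (((j:ℂ)+1)^2 - a^2)/(((j:ℂ)+1/2)^2 - a^2)

/-- `(1/2±b)_l/(1±b)_l` -/
noncomputable def DD (b : ℂ) (l : ℕ) : ℂ :=
  ∏ j ∈ range l, (((j:ℂ)+1/2)^2 - b^2)/(((j:ℂ)+1)^2 - b^2)

noncomputable def al (a : ℂ) : ℕ → ℂ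
  | 0 => 1/4/(1/4 - a^2)
  | (l+1) => cc a l / (((l:ℂ)+1/2)^2 - a^2) / 4 *
      ((((l:ℂ)+1)^2 - a^2)/((((l:ℂ)+3/2)^2 - a^2)*(2*l+3)) + 1/(2*l+2))

noncomputable def n2 (a b : ℂ) : ℂ :=
  -(a^2/b)*(2*(b^2+b-a^2)+1)/((b^2-a^2)*((b+1)^2-a^2))
noncomputable def n3 (a b : ℂ) : ℂ :=
  (a^2/b)/((b^2-a^2)*((b+1)^2-a^2))*((b^2+b-a^2)/2+a^2+a^2*(2*(b^2+b-a^2)+1))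
noncomputable def NN (a b l : ℂ) : ℂ := n2 a b * (l^2 - l/2) + n3 a b
noncomputable def VV (a b : ℂ) (i : ℕ) : ℂ :=
  cc a i * DD b i * ((i:ℂ)+1/2+b) * NN a b ((i:ℂ)+1) / ((((i:ℂ)+1/2)^2 - a^2)*((i:ℂ)+1+b))

lemma cc_succ (a : ℂ) (l : ℕ) :
    cc a (l+1) = cc a l * ((((l:ℂ)+1)^2 - a^2)/(((l:ℂ)+1/2)^2 - a^2)) := by
  rw [cc, prod_range_succ, ← cc]
lemma DD_succ (b : ℂ) (l : ℕ) :
    DD b (l+1) = DD b l * ((((l:ℂ)+1/2)^2 - b^2)/(((l:ℂ)+1)^2 - b^2)) := by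
  rw [DD, prod_range_succ, ← DD]

/-- not an integer -/
def NI (b : ℂ) : Prop := ∀ n : ℤ, b + n ≠ 0

lemma NI.sq {b : ℂ} (h : NI b) (j : ℕ) : ((j:ℂ)+1)^2 - b^2 ≠ 0 := by
  have h1 := h (j+1)
  have h2 := h (-(j+1))
  push_cast at h1 h2
  intro h3
  have : (b + (j+1)) * (b + -(j+1)) = 0 := by linear_combination -h3
  rcases mul_eq_zero.1 this with h | h
  · exact h1 h
  · exact h2 h

lemma NI.add {b : ℂ} (h : NI b) : NI (b+1) := by
  intro n
  have := h (n+1)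
  push_cast at this
  intro h3; apply this; rw [← h3]; ring

lemma NI.addn {b : ℂ} (h : NI b) (k : ℕ) : NI (b+k) := by
  intro n
  have := h (k+n)
  push_cast at this
  intro h3; apply this; rw [← h3]; ring

lemma NI.neg {b : ℂ} (h : NI b) : NI (-b) := by
  intro n
  have := h (-n)
  push_cast at this
  intro h3; apply this; linear_combination -h3

lemma NI.ne {b : ℂ} (h : NI b) (j : ℕ) : (j:ℂ) + b ≠ 0 := by
  have := h j; push_cast at this; rwa [add_comm]

lemma DD_shift {b : ℂ} (h : NI b) (i : ℕ) :
    DD (b+1) (i+1) = DD b i * (((i:ℂ)+1/2+b)*((i:ℂ)+3/2+b)*(1+b)/(((i:ℂ)+1+b)*((i:ℂ)+2+b)*b)) := by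
  have hb : b ≠ 0 := by have := h.ne 0; simpa using this
  induction i with
  | zero =>
    have e := h.add.sq 0
    have h1 := h.ne 1
    have h2 := h.ne 2
    push_cast at h1 h2
    simp only [DD, prod_range_succ, prod_range_zero]
    simp only [CharP.cast_eq_zero, zero_add, one_mul] at e ⊢
    rw [div_eq_div_iff e (by simp only [ne_eq, mul_eq_zero, not_or]; tauto)]
    ring
  | succ i ih =>
    rw [DD_succ (b+1), ih, DD_succ b]
    have e := h.add.sq (i+1)
    have e2 := h.sq i
    have h1 := h.ne (i+1)
    have h2 := h.ne (i+2)
    have h3 := h.ne (i+3)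
    push_cast at h1 h2 h3 e ⊢
    rw [mul_assoc (DD b i), mul_assoc (DD b i)]
    congr 1
    have h2' : (i:ℂ)+1+1+b ≠ 0 := by convert h2 using 1; ring
    have h3' : (i:ℂ)+1+2+b ≠ 0 := by convert h3 using 1; ring
    rw [div_mul_div_comm, div_mul_div_comm, div_eq_div_iff
      (by simp only [ne_eq, mul_eq_zero, not_or]; tauto) (by simp only [ne_eq, mul_eq_zero, not_or]; tauto)]
    ring

lemma cert {a b : ℂ} (l : ℂ) (hb : b ≠ 0) (h1 : b^2-a^2 ≠ 0) (h2 : (b+1)^2-a^2 ≠ 0) :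
    (l+1/2+b)*(l-1/2-b)*(l^2-a^2)*NN a b (l+1) - (l-b)*(l+1+b)*((l+1/2)^2-a^2)*NN a b l
      = (a^2/b)*(l*(l^2-a^2)+(l+1/2)*((l+1/2)^2-a^2)) := by
  unfold NN n2 n3
  have : ((b^2-a^2)*((b+1)^2-a^2)) ≠ 0 := mul_ne_zero h1 h2
  generalize hE : ((b^2-a^2)*((b+1)^2-a^2)) = E at *
  field_simp
  rw [← hE]
  ring

lemma rat {a b l : ℂ} (hb : b ≠ 0) (h1 : b^2-a^2 ≠ 0) (h2 : (b+1)^2-a^2 ≠ 0)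
    (hA : (l-1/2)^2-a^2 ≠ 0) (hA1 : (l+1/2)^2-a^2 ≠ 0) (hl : l ≠ 0) (hl2 : 2*l+1 ≠ 0)
    (k1 : l + b ≠ 0) (k2 : l - b ≠ 0) (k3 : l+1+b ≠ 0) :
    8*a^2*(1/((l-1/2)^2-a^2)/4*((l^2-a^2)/(((l+1/2)^2-a^2)*(2*l+1)) + 1/(2*l)))
     * ((l-1/2+b)*(l+1/2+b)*(1+b)/((l+b)*(l+1+b)*b) - ((l-1/2)^2-b^2)/(l^2-b^2))
    = (l^2-a^2)/((l-1/2)^2-a^2) * (((l-1/2)^2-b^2)/(l^2-b^2)) * (l+1/2+b) * NN a b (l+1)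
        /(((l+1/2)^2-a^2)*(l+1+b))
      - (l-1/2+b) * NN a b l/(((l-1/2)^2-a^2)*(l+b)) := by
  have c := cert l hb h1 h2
  have k4 : l^2-b^2 ≠ 0 := by
    have := mul_ne_zero k1 k2
    intro h; apply this; linear_combination h
  have E1 : (l-1/2+b)*(l+1/2+b)*(1+b)/((l+b)*(l+1+b)*b) - ((l-1/2)^2-b^2)/(l^2-b^2)
     = (l-1/2+b)*l*(l+1/2)/(b*(l+b)*(l+1+b)*(l-b)) := by
    have : l^2-b^2 = (l+b)*(l-b) := by ring
    rw [this]
    field_simp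
    ring
  have E2 : (l^2-a^2)/(((l+1/2)^2-a^2)*(2*l+1)) + 1/(2*l)
     = 2*(l*(l^2-a^2)+(l+1/2)*((l+1/2)^2-a^2))/(((l+1/2)^2-a^2)*(2*l)*(2*l+1)) := by
    generalize hE : ((l+1/2)^2-a^2) = E at *
    have hl2' : l*2+1 ≠ 0 := by rwa [mul_comm]
    rw [div_add_div _ _ (mul_ne_zero hA1 hl2) (mul_ne_zero two_ne_zero hl), div_eq_div_iff
      (mul_ne_zero (mul_ne_zero hA1 hl2) (mul_ne_zero two_ne_zero hl))
      (mul_ne_zero (mul_ne_zero hA1 (mul_ne_zero two_ne_zero hl)) hl2)]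
    ring
  have E3 : 8*a^2*(1/((l-1/2)^2-a^2)/4*((l^2-a^2)/(((l+1/2)^2-a^2)*(2*l+1)) + 1/(2*l)))
     * ((l-1/2+b)*(l+1/2+b)*(1+b)/((l+b)*(l+1+b)*b) - ((l-1/2)^2-b^2)/(l^2-b^2))
     = (a^2/b)*(l*(l^2-a^2)+(l+1/2)*((l+1/2)^2-a^2)) * (l-1/2+b)
        /(((l-1/2)^2-a^2)*((l+1/2)^2-a^2)*(l+b)*(l+1+b)*(l-b)) := by
    rw [E1, E2]
    generalize (l*(l^2-a^2)+(l+1/2)*((l+1/2)^2-a^2)) = W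
    generalize ((l+1/2)^2-a^2) = E at *
    generalize ((l-1/2)^2-a^2) = E' at *
    have : l + 1/2 = (2*l+1)/2 := by ring
    rw [this]
    field_simp
    ring
  rw [E3, ← c]
  have : l^2-b^2 = (l+b)*(l-b) := by ring
  rw [this]
  have : (l-1/2)^2-b^2 = (l-1/2+b)*(l-1/2-b) := by ring
  rw [this]
  generalize NN a b (l+1) = N1
  generalize NN a b l = N0
  generalize ((l+1/2)^2-a^2) = E at *
  generalize ((l-1/2)^2-a^2) = E' at *
  generalize l-1/2+b = X
  generalize l-1/2-b = X'
  generalize l+1/2+b = X''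
  generalize l^2-a^2 = Y
  field_simp

lemma step {a b : ℂ} (h : NI b) (h1 : b^2-a^2 ≠ 0) (h2 : (b+1)^2-a^2 ≠ 0)
    (hA : ∀ j : ℕ, ((j:ℂ)+1/2)^2-a^2 ≠ 0) (i : ℕ) :
    8*a^2*al a (i+1) * (DD (b+1) (i+1) - DD b (i+1)) = VV a b (i+1) - VV a b i := by
  have hb : b ≠ 0 := by have := h.ne 0; simpa using this
  have hA0 := hA i
  have hA1 := hA (i+1)
  have k1 := h.ne (i+1)
  have k2 := h.neg.ne (i+1)
  have k3 := h.ne (i+2)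
  push_cast at *
  have := rat (l := (i:ℂ)+1) hb h1 h2 (by convert hA0 using 1; ring) hA1
    (by exact_mod_cast Nat.succ_ne_zero i) (by norm_cast) k1 (by rw [sub_eq_add_neg]; exact k2)
    (by convert k3 using 1; ring)
  rw [DD_shift h, DD_succ, VV, VV, cc_succ, DD_succ, al]
  push_cast
  have e1 : ((i:ℂ)+1-1/2) = (i:ℂ)+1/2 := by ring
  have e2 : ((i:ℂ)+1+1/2) = (i:ℂ)+3/2 := by ring
  have e3 : 2*((i:ℂ)+1)+1 = 2*i+3 := by ring
  have e4 : 2*((i:ℂ)+1) = 2*i+2 := by ring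
  have e5 : ((i:ℂ)+1+1) = (i:ℂ)+2 := by ring
  rw [e3, e4] at this
  simp only [e1, e2, e5] at this ⊢
  linear_combination (cc a i * DD b i) * this

lemma VV_zero {a b : ℂ} (h : NI b) (h1 : b^2-a^2 ≠ 0) (h2 : (b+1)^2-a^2 ≠ 0)
    (hA : ∀ j : ℕ, ((j:ℂ)+1/2)^2-a^2 ≠ 0) :
    VV a b 0 = -(a^2/(b*(b^2-a^2)) + a^2/((b+1)*((b+1)^2-a^2))) := by
  have hb : b ≠ 0 := by have := h.ne 0; simpa using this
  have k1 := h.ne 1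
  have hA0 := hA 0
  simp only [VV, cc, DD, NN, n2, n3, prod_range_zero]
  push_cast at *
  simp only [zero_add, one_mul] at *
  have k1' : b + 1 ≠ 0 := by rwa [add_comm]
  rw [add_comm 1 b]
  have hA0' : 1 - 4*a^2 ≠ 0 := by
    intro h; apply hA0; linear_combination h/4
  have : (1/2:ℂ)^2-a^2 = (1-4*a^2)/4 := by ring
  rw [this]
  have e : (b^2-a^2)*((b+1)^2-a^2) ≠ 0 := mul_ne_zero h1 h2
  generalize hE : (1-4*a^2) = E at *
  field_simp
  rw [← hE]
  ring

end ZH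

namespace ZH
open Finset Filter Topology

lemma norm_of_pos {x : ℝ} (h : 0 < x) {z : ℂ} (e : (x:ℂ) = z) : ‖z‖ = x := by
  rw [← e, Complex.norm_real, Real.norm_of_nonneg h.le]

lemma hA_real {t : ℝ} (ht : 0 < t) (ht' : t < 1/10) (j : ℕ) :
    ((j:ℂ)+1/2)^2 - (t:ℂ)^2 ≠ 0 := by
  have : ((j:ℝ)+1/2)^2 - t^2 ≠ 0 := by
    have : (0:ℝ) ≤ j := by positivity
    nlinarith
  have := Complex.ofReal_ne_zero.2 this
  push_cast at this; exact this

lemma cc_bound {t : ℝ} (ht : 0 < t) (ht' : t < 1/10) (l : ℕ) : ‖cc (t:ℂ) l‖ ≤ 4*l+1 := by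
  induction l with
  | zero => simp [cc]
  | succ l ih =>
    rw [cc_succ, norm_mul]
    have hl : (0:ℝ) ≤ l := by positivity
    have h1 : (0:ℝ) < ((l:ℝ)+1/2)^2 - t^2 := by nlinarith
    have h2 : (0:ℝ) < ((l:ℝ)+1)^2 - t^2 := by nlinarith
    have e : ‖(((l:ℂ)+1)^2 - (t:ℂ)^2)/(((l:ℂ)+1/2)^2 - (t:ℂ)^2)‖
        = (((l:ℝ)+1)^2 - t^2)/(((l:ℝ)+1/2)^2 - t^2) := by
      exact norm_of_pos (div_pos h2 h1) (by push_cast; rfl)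
    rw [e]
    have : (((l:ℝ)+1)^2 - t^2)/(((l:ℝ)+1/2)^2 - t^2) ≤ (4*l+5)/(4*l+1) := by
      rw [div_le_div_iff₀ h1 (by positivity)]
      nlinarith [mul_nonneg hl ht.le]
    calc _ ≤ (4*(l:ℝ)+1) * ((4*l+5)/(4*l+1)) := by gcongr; 
      _ = _ := by push_cast; field_simp; ring

lemma al_bound {t : ℝ} (ht : 0 < t) (ht' : t < 1/10) (l : ℕ) :
    ‖al (t:ℂ) (l+1)‖ ≤ 8/((l:ℝ)+1)^2 := by
  rw [al]
  have hl : (0:ℝ) ≤ l := by positivity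
  have h1 : (0:ℝ) < ((l:ℝ)+1/2)^2 - t^2 := by nlinarith
  have h2 : (0:ℝ) < ((l:ℝ)+1)^2 - t^2 := by nlinarith
  have h3 : (0:ℝ) < ((l:ℝ)+3/2)^2 - t^2 := by nlinarith
  have e1 : ‖((l:ℂ)+1/2)^2 - (t:ℂ)^2‖ = ((l:ℝ)+1/2)^2 - t^2 := by
    exact norm_of_pos h1 (by push_cast; rfl)
  have e2 : ‖(((l:ℂ)+1)^2 - (t:ℂ)^2)/((((l:ℂ)+3/2)^2 - (t:ℂ)^2)*(2*l+3)) + 1/(2*l+2)‖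
    = (((l:ℝ)+1)^2 - t^2)/((((l:ℝ)+3/2)^2 - t^2)*(2*l+3)) + 1/(2*l+2) := by
    have : 0 < (((l:ℝ)+1)^2 - t^2)/((((l:ℝ)+3/2)^2 - t^2)*(2*l+3)) + 1/(2*l+2) := by positivity
    exact norm_of_pos this (by push_cast; rfl)
  rw [norm_mul, e2, norm_div, norm_div, e1]
  have e3 : (((l:ℝ)+1)^2 - t^2)/((((l:ℝ)+3/2)^2 - t^2)*(2*l+3)) + 1/(2*l+2) ≤ 1/((l:ℝ)+1) := by
    have : (((l:ℝ)+1)^2 - t^2)/((((l:ℝ)+3/2)^2 - t^2)*(2*l+3)) ≤ 1/(2*l+2) := by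
      rw [div_le_div_iff₀ (by positivity) (by positivity)]
      have : ((l:ℝ)+1)^2 - t^2 ≤ ((l:ℝ)+3/2)^2 - t^2 := by nlinarith
      nlinarith
    calc _ ≤ 1/(2*(l:ℝ)+2) + 1/(2*l+2) := by gcongr
      _ = _ := by field_simp; ring
  have e4 : ‖(4:ℂ)‖ = 4 := by norm_num
  rw [e4]
  calc _ ≤ (4*((l:ℝ)+1)) / (((l:ℝ)+1)^2/8) / 4 * (1/((l:ℝ)+1)) := by
        gcongr
        · exact (cc_bound ht ht' l).trans (by linarith)
        · nlinarith
    _ = _ := by field_simp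

/-- one linear factor ratio -/
lemma ratio_le_one {x : ℂ} (h : 0 ≤ x.re) : ‖x‖ ≤ ‖x + 1/2‖ := by
  rw [Complex.norm_def, Complex.norm_def]
  apply Real.sqrt_le_sqrt
  simp only [Complex.normSq_apply, Complex.add_re, Complex.add_im]
  norm_num
  nlinarith

structure Ok (β : ℂ) : Prop where
  ni : NI β
  re0 : 0 ≤ β.re
  re1 : β.re ≤ 1/2

lemma Ok.ne {β : ℂ} (h : Ok β) : β ≠ 0 := by have := h.ni.ne 0; simpa using this

lemma fac_le {β : ℂ} (h : Ok β) (k j : ℕ) :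
    ‖(((j:ℂ)+1/2)^2 - (β+k)^2)/(((j:ℂ)+1)^2 - (β+k)^2)‖ ≤ ‖((j:ℂ)+1/2-(β+k))/((j:ℂ)+1-(β+k))‖ := by
  have e : (((j:ℂ)+1/2)^2 - (β+k)^2)/(((j:ℂ)+1)^2 - (β+k)^2)
    = ((j:ℂ)+1/2-(β+k))/((j:ℂ)+1-(β+k)) * (((j:ℂ)+1/2+(β+k))/((j:ℂ)+1+(β+k))) := by
    rw [div_mul_div_comm]; congr 1 <;> ring
  rw [e, norm_mul]
  apply mul_le_of_le_one_right (norm_nonneg _)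
  rw [norm_div]
  apply div_le_one_of_le₀ _ (norm_nonneg _)
  have := ratio_le_one (x := (j:ℂ)+1/2+(β+k)) (by
    simp; have := h.re0; positivity)
  have e2 : (j:ℂ)+1+(β+k) = (j:ℂ)+1/2+(β+k) + 1/2 := by ring
  rw [e2]; exact this

lemma fac_le_one {β : ℂ} (h : Ok β) (k j : ℕ) (hkj : k ≤ j) :
    ‖(((j:ℂ)+1/2)^2 - (β+k)^2)/(((j:ℂ)+1)^2 - (β+k)^2)‖ ≤ 1 := by
  refine (fac_le h k j).trans ?_
  rw [norm_div]
  apply div_le_one_of_le₀ _ (norm_nonneg _)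
  have := ratio_le_one (x := (j:ℂ)+1/2-(β+k)) (by
    have h1 := h.re1
    have : (k:ℝ) ≤ j := by exact_mod_cast hkj
    simp; norm_num; linarith)
  have e2 : (j:ℂ)+1-(β+k) = (j:ℂ)+1/2-(β+k) + 1/2 := by ring
  rw [e2]; exact this

lemma fac_le_h {β : ℂ} (h : Ok β) (j i : ℕ) :
    ‖(((j:ℂ)+1/2)^2 - (β+(j+1+i:ℕ))^2)/(((j:ℂ)+1)^2 - (β+(j+1+i:ℕ))^2)‖ ≤ 1 + 1/(2*‖β+i‖) := by
  refine (fac_le h _ j).trans ?_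
  have hne : β + i ≠ 0 := by rw [add_comm]; exact h.ni.ne i
  have e : ((j:ℂ)+1/2-(β+(j+1+i:ℕ)))/((j:ℂ)+1-(β+(j+1+i:ℕ))) = 1 + 1/(2*(β+i)) := by
    push_cast
    have : (j:ℂ)+1-(β+(j+1+i)) = -(β+i) := by ring
    rw [this]
    field_simp
    ring
  rw [e]
  refine (norm_add_le _ _).trans ?_
  simp

noncomputable def KK (β : ℂ) : ℝ := 1 + 1/(2*‖β‖)

lemma KK_ge (β : ℂ) : 1 ≤ KK β := by
  unfold KK
  have : 0 ≤ 1/(2*‖β‖) := by positivity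
  linarith

lemma DD_b1 {β : ℂ} (h : Ok β) (k l : ℕ) (hl : l < k) :
    ‖DD (β+k) l‖^2 ≤ (2*k-1)/(2*((k:ℝ)-l)-1) := by
  induction l with
  | zero =>
    have : (1:ℝ) ≤ k := by exact_mod_cast hl
    simp only [DD, prod_range_zero]
    simp
    rw [div_self]; linarith
  | succ l ih =>
    rw [DD_succ, norm_mul, mul_pow]
    obtain ⟨i, rfl⟩ : ∃ i, k = l+1+(i+1) := ⟨k-l-2, by omega⟩
    have h1 := ih (by omega)
    have h2 := fac_le_h h l (i+1)
    have h3 : 1 + 1/(2*‖β+(i+1:ℕ)‖) ≤ 1 + 1/(2*((i:ℝ)+1)) := by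
      gcongr
      have := Complex.re_le_norm (β+(i+1:ℕ))
      simp at this
      have := h.re0
      push_cast
      linarith
    have h4 : (1 + 1/(2*((i:ℝ)+1)))^2 ≤ (2*i+3)/(2*i+1) := by
      have : 1 + 1/(2*((i:ℝ)+1)) = (2*i+3)/(2*i+2) := by field_simp; ring
      rw [this, div_pow, div_le_div_iff₀ (by positivity) (by positivity)]
      have : (0:ℝ) ≤ i := by positivity
      nlinarith
    calc _ ≤ (2*((l+1+(i+1):ℕ):ℝ)-1)/(2*(((l+1+(i+1):ℕ):ℝ)-l)-1) * ((2*i+3)/(2*i+1)) := by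
          gcongr
          · exact (sq_nonneg _).trans h1
          · exact (pow_le_pow_left₀ (norm_nonneg _) (h2.trans h3) 2).trans h4
      _ = _ := by
          push_cast
          have e1 : 2*((l:ℝ)+1+(i+1)-l)-1 = 2*i+3 := by ring
          have e2 : 2*((l:ℝ)+1+(i+1)-(l+1))-1 = 2*i+1 := by ring
          rw [e1, e2]
          field_simp

lemma DD_b2 {β : ℂ} (h : Ok β) (k l : ℕ) (hl : k ≤ l) :
    ‖DD (β+k) l‖^2 ≤ KK β^2*(2*k+1) := by
  induction l, hl using Nat.le_induction with
  | base =>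
    rcases k with _ | k
    · simp only [DD, prod_range_zero]
      have := KK_ge β
      have : (1:ℝ) ≤ KK β ^2 := by nlinarith
      norm_num
      rw [abs_of_nonneg] <;> linarith
    · rw [DD_succ, norm_mul, mul_pow]
      have h1 := DD_b1 h (k+1) k (by omega)
      have h2 := fac_le_h h k 0
      have e : (1:ℝ) + 1/(2*‖β+(0:ℕ)‖) = KK β := by simp [KK]
      rw [e] at h2
      have h3 : (2*((k+1:ℕ):ℝ)-1)/(2*(((k+1:ℕ):ℝ)-k)-1) = 2*k+1 := by
        push_cast
        have : 2*((k:ℝ)+1-k)-1 = 1 := by ring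
        rw [this]; ring
      rw [h3] at h1
      calc _ ≤ (2*(k:ℝ)+1) * KK β^2 := by
            gcongr
        _ ≤ _ := by push_cast; nlinarith [KK_ge β]
  | succ l hl ih =>
    rw [DD_succ, norm_mul]
    refine (pow_le_pow_left₀ (by positivity) ?_ 2).trans ih
    exact mul_le_of_le_one_right (norm_nonneg _) (fac_le_one h k l hl)

lemma DD_bound {β : ℂ} (h : Ok β) (k l : ℕ) :
    ‖DD (β+k) l‖ ≤ KK β * Real.sqrt (2*l+1) := by
  have hK := KK_ge β
  apply le_of_sq_le_sq _ (by positivity)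
  rw [mul_pow, Real.sq_sqrt (by positivity)]
  rcases le_or_gt k l with hl | hl
  · refine (DD_b2 h k l hl).trans ?_
    gcongr
  · refine (DD_b1 h k l hl).trans ?_
    have h1 : (l:ℝ) + 1 ≤ k := by exact_mod_cast hl
    have h0 : (0:ℝ) ≤ l := by positivity
    rw [div_le_iff₀ (by linarith)]
    have : (1:ℝ) ≤ KK β ^2 := by nlinarith
    have h2 : (2*(k:ℝ)-1) ≤ (2*l+1)*(2*((k:ℝ)-l)-1) := by nlinarith
    have h3 : 0 ≤ (2*(l:ℝ)+1)*(2*((k:ℝ)-l)-1) := by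
      apply mul_nonneg <;> linarith
    nlinarith

noncomputable def bd (β : ℂ) (l : ℕ) : ℝ := 16 * KK β * (1 / ((l:ℝ)+1)^(3/2:ℝ))

lemma bd_summable (β : ℂ) : Summable (bd β) := by
  apply Summable.mul_left
  have := (summable_nat_add_iff 1).2 (Real.summable_one_div_nat_rpow (p := 3/2).2 (by norm_num))
  refine this.congr (fun l => ?_)
  push_cast; rfl

lemma term_bound {t : ℝ} (ht : 0 < t) (ht' : t < 1/10) {β : ℂ} (h : Ok β) (k l : ℕ) :
    ‖al (t:ℂ) (l+1) * DD (β+k) (l+1)‖ ≤ bd β l := by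
  rw [norm_mul]
  have h1 := al_bound ht ht' l
  have h2 := DD_bound h k (l+1)
  have hK := KK_ge β
  have h3 : Real.sqrt (2*((l+1:ℕ):ℝ)+1) ≤ 2 * Real.sqrt ((l:ℝ)+1) := by
    have : 2 * Real.sqrt ((l:ℝ)+1) = Real.sqrt (4*((l:ℝ)+1)) := by
      rw [Real.sqrt_mul (by norm_num)]
      congr 1
      rw [show (4:ℝ) = 2^2 by norm_num, Real.sqrt_sq (by norm_num)]
    rw [this]
    apply Real.sqrt_le_sqrt
    push_cast; have : (0:ℝ) ≤ l := by positivity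
    linarith
  have hp : (0:ℝ) < (l:ℝ)+1 := by positivity
  have e : ((l:ℝ)+1)^2 = ((l:ℝ)+1)^(3/2:ℝ) * Real.sqrt ((l:ℝ)+1) := by
    rw [Real.sqrt_eq_rpow, ← Real.rpow_add hp, ← Real.rpow_natCast]; norm_num
  calc _ ≤ 8/((l:ℝ)+1)^2 * (KK β * (2 * Real.sqrt ((l:ℝ)+1))) := by
        gcongr
        exact h2.trans (by gcongr)
    _ = bd β l := by
        rw [e, bd]
        have : Real.sqrt ((l:ℝ)+1) ≠ 0 := by positivity
        field_simp
        ring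

noncomputable def MM (a b : ℂ) : ℂ := ∑' l, al a l * DD b l

lemma MM_summable {t : ℝ} (ht : 0 < t) (ht' : t < 1/10) {β : ℂ} (h : Ok β) (k : ℕ) :
    Summable (fun l => al (t:ℂ) l * DD (β+k) l) := by
  rw [← summable_nat_add_iff 1]
  exact Summable.of_norm_bounded (bd_summable β) (term_bound ht ht' h k)

lemma DD_tendsto (β : ℂ) (l : ℕ) : Tendsto (fun k : ℕ => DD (β+k) l) atTop (𝓝 1) := by
  unfold DD
  suffices H : ∀ j ∈ range l, Tendsto (fun k : ℕ =>
      (((j:ℂ)+1/2)^2 - (β+k)^2)/(((j:ℂ)+1)^2 - (β+k)^2)) atTop (𝓝 1) by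
    have := tendsto_finsetProd _ H
    simpa using this
  intro j _
  have hk : Tendsto (fun k : ℕ => β + (k:ℂ)) atTop (Bornology.cobounded ℂ) := by
    have : Tendsto (fun k : ℕ => (k:ℂ)) atTop (Bornology.cobounded ℂ) := by
      rw [← tendsto_norm_atTop_iff_cobounded]
      simpa using tendsto_natCast_atTop_atTop (R := ℝ)
    exact tendsto_const_add_cobounded β |>.comp this
  have hinv : Tendsto (fun k : ℕ => (β + (k:ℂ))⁻¹) atTop (𝓝 0) :=
    tendsto_inv₀_cobounded.comp hk
  have h0 : ∀ᶠ k : ℕ in atTop, β + (k:ℂ) ≠ 0 := hk.eventually_ne_cobounded 0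
  have hc : ∀ c : ℂ, Tendsto (fun k : ℕ => c * (β + (k:ℂ))⁻¹^2 - 1) atTop (𝓝 (-1)) := by
    intro c
    have := ((hinv.pow 2).const_mul c).sub_const 1
    simpa using this
  have := (hc (((j:ℂ)+1/2)^2)).div (hc (((j:ℂ)+1)^2)) (by norm_num)
  rw [div_self (by norm_num)] at this
  refine this.congr' ?_
  filter_upwards [h0] with k hk
  have : ∀ c : ℂ, c * (β + (k:ℂ))⁻¹^2 - 1 = (c - (β+k)^2) * ((β + (k:ℂ))⁻¹^2) := by
    intro c; field_simp
  simp only [Pi.div_apply]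
  rw [this, this, mul_div_mul_right _ _ (pow_ne_zero 2 (inv_ne_zero hk))]

lemma MM_tendsto {t : ℝ} (ht : 0 < t) (ht' : t < 1/10) {β : ℂ} (h : Ok β) :
    Tendsto (fun k : ℕ => MM (t:ℂ) (β+k)) atTop (𝓝 (∑' l, al (t:ℂ) l)) := by
  set B : ℕ → ℝ := fun l => Nat.casesOn l (‖al (t:ℂ) 0‖) (bd β) with hB
  have hs : Summable B := by
    rw [← summable_nat_add_iff 1]
    exact bd_summable β
  refine tendsto_tsum_of_dominated_convergence hs ?_ ?_
  · intro l
    have := (DD_tendsto β l).const_mul (al (t:ℂ) l)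
    simpa using this
  · refine Eventually.of_forall (fun k l => ?_)
    rcases l with _ | l
    · simp [hB, DD]
    · exact term_bound ht ht' h k l

end ZH

namespace ZH
open Finset Filter Topology

lemma lin_ratio (c d : ℂ) : Tendsto (fun i : ℕ => ((i:ℂ)+c)/((i:ℂ)+d)) atTop (𝓝 1) := by
  have hk : Tendsto (fun k : ℕ => (k:ℂ)) atTop (Bornology.cobounded ℂ) := by
    rw [← tendsto_norm_atTop_iff_cobounded]
    simpa using tendsto_natCast_atTop_atTop (R := ℝ)
  have hinv : Tendsto (fun k : ℕ => ((k:ℂ))⁻¹) atTop (𝓝 0) := tendsto_inv₀_cobounded.comp hk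
  have hc : ∀ c : ℂ, Tendsto (fun k : ℕ => 1 + c * ((k:ℂ))⁻¹) atTop (𝓝 1) := by
    intro c
    have := (hinv.const_mul c).const_add 1
    simpa using this
  have := (hc c).div (hc d) (by norm_num)
  rw [div_self (by norm_num)] at this
  refine this.congr' ?_
  filter_upwards [eventually_ne_atTop 0] with k hk
  have hk' : (k:ℂ) ≠ 0 := by exact_mod_cast hk
  have : ∀ c : ℂ, 1 + c * ((k:ℂ))⁻¹ = (k + c) * ((k:ℂ))⁻¹ := by
    intro c; field_simp
  simp only [Pi.div_apply]
  rw [this, this, mul_div_mul_right _ _ (inv_ne_zero hk')]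

lemma sq_ratio (c d a : ℂ) :
    Tendsto (fun i : ℕ => ((i:ℂ)+c)*((i:ℂ)+d)/(((i:ℂ)+1/2)^2-a^2)) atTop (𝓝 1) := by
  have := (lin_ratio c (1/2-a)).mul (lin_ratio d (1/2+a))
  rw [mul_one] at this
  refine this.congr (fun i => ?_)
  rw [div_mul_div_comm]; congr 1; ring

lemma inv_sq_tendsto (a : ℂ) :
    Tendsto (fun i : ℕ => 1/(((i:ℂ)+1/2)^2-a^2)) atTop (𝓝 0) := by
  have hk : Tendsto (fun k : ℕ => (k:ℂ)) atTop (Bornology.cobounded ℂ) := by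
    rw [← tendsto_norm_atTop_iff_cobounded]
    simpa using tendsto_natCast_atTop_atTop (R := ℝ)
  have hinv : Tendsto (fun k : ℕ => ((k:ℂ))⁻¹) atTop (𝓝 0) := tendsto_inv₀_cobounded.comp hk
  have h2 := (hinv.mul hinv).mul (sq_ratio 0 0 a)
  simp only [add_zero, zero_mul] at h2
  refine h2.congr' ?_
  filter_upwards [eventually_ne_atTop 0] with k hk
  have hk' : (k:ℂ) ≠ 0 := by exact_mod_cast hk
  field_simp

lemma VV_lim {a b κ : ℂ} (hκ : Tendsto (fun l => cc a l * DD b l) atTop (𝓝 κ)) :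
    Tendsto (VV a b) atTop (𝓝 (κ * n2 a b)) := by
  have h1 := hκ.mul (lin_ratio (1/2+b) (1+b))
  have h2 := ((sq_ratio (1/2) 1 a).const_mul (n2 a b)).add ((inv_sq_tendsto a).const_mul (n3 a b))
  have := h1.mul h2
  simp only [mul_one, mul_zero, add_zero] at this
  refine this.congr (fun i => ?_)
  rw [VV, NN]
  have e : ((i:ℂ)+1)^2 - ((i:ℂ)+1)/2 = ((i:ℂ)+1/2)*((i:ℂ)+1) := by ring
  rw [e, ← add_assoc, ← add_assoc]
  generalize ((i:ℂ)+1/2)^2-a^2 = E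
  simp only [div_eq_mul_inv, mul_inv]
  ring

lemma kap_shift {a b κ : ℂ} (h : NI b) (hκ : Tendsto (fun l => cc a l * DD b l) atTop (𝓝 κ)) :
    Tendsto (fun l => cc a l * DD (b+1) l) atTop (𝓝 (κ * ((b+1)/b))) := by
  rw [← tendsto_add_atTop_iff_nat 1]
  have h1 := ((hκ.mul (sq_ratio (1-a) (1+a) a)).mul
    ((lin_ratio (1/2+b) (1+b)).mul (lin_ratio (3/2+b) (2+b)))).mul_const ((b+1)/b)
  simp only [mul_one] at h1
  refine h1.congr (fun i => ?_)
  rw [cc_succ, DD_shift h]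
  have e : ((i:ℂ)+1)^2 - a^2 = ((i:ℂ)+(1-a))*((i:ℂ)+(1+a)) := by ring
  rw [e]
  generalize ((i:ℂ)+1/2)^2-a^2 = E
  simp only [div_eq_mul_inv, mul_inv, ← add_assoc]
  ring

lemma kap_shiftn {a b κ : ℂ} (h : NI b) (hκ : Tendsto (fun l => cc a l * DD b l) atTop (𝓝 κ))
    (k : ℕ) :
    Tendsto (fun l => cc a l * DD (b+k) l) atTop (𝓝 (κ * ((b+k)/b))) := by
  have hb : b ≠ 0 := by have := h.ne 0; simpa using this
  induction k with
  | zero => simpa [hb] using hκ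
  | succ k ih =>
    have := kap_shift (h.addn k) ih
    have hk := h.ne k
    rw [add_comm] at hk
    have e : κ * ((b+k)/b) * ((b+k+1)/(b+k)) = κ * ((b+(k+1:ℕ))/b) := by
      push_cast; field_simp; ring
    rw [e] at this
    push_cast at this ⊢
    simp only [← add_assoc] at this ⊢; exact this

noncomputable def EE (a b : ℂ) : ℂ := a^2/(b*(b^2-a^2))
noncomputable def GG (a b T : ℂ) : ℂ := EE a b - T * (a^2/(b^2-a^2))

lemma Mstep {a b κ T : ℂ} (h : NI b) (h1 : b^2-a^2 ≠ 0) (h2 : (b+1)^2-a^2 ≠ 0)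
    (hA : ∀ j : ℕ, ((j:ℂ)+1/2)^2-a^2 ≠ 0)
    (hκ : Tendsto (fun l => cc a l * DD b l) atTop (𝓝 κ)) (hT : κ = T * b)
    (s1 : Summable (fun l => al a l * DD b l)) (s2 : Summable (fun l => al a l * DD (b+1) l)) :
    8*a^2*MM a (b+1) - 8*a^2*MM a b = GG a b T + GG a (b+1) T := by
  have hb : b ≠ 0 := by have := h.ne 0; simpa using this
  have hs := (s2.hasSum.mul_left (8*a^2)).sub (s1.hasSum.mul_left (8*a^2))
  have ht := hs.tendsto_sum_nat
  rw [← tendsto_add_atTop_iff_nat 1] at ht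
  have key : ∀ n, ∑ l ∈ range (n+1), (8*a^2*(al a l * DD (b+1) l) - 8*a^2*(al a l * DD b l))
      = VV a b n - VV a b 0 := by
    intro n
    rw [Finset.sum_range_succ']
    have e0 : 8*a^2*(al a 0 * DD (b+1) 0) - 8*a^2*(al a 0 * DD b 0) = 0 := by simp [DD]
    rw [e0, add_zero, ← Finset.sum_range_sub]
    apply Finset.sum_congr rfl
    intro i _
    rw [← step h h1 h2 hA]; ring
  simp only [key] at ht
  have := tendsto_nhds_unique ht ((VV_lim hκ).sub_const _)
  rw [VV_zero h h1 h2 hA] at this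
  rw [MM, MM, this, hT, n2, GG, GG, EE, EE]
  have k1 := h.ne 1
  push_cast at k1
  have k1' : b + 1 ≠ 0 := by rwa [add_comm]
  generalize hE1 : b^2-a^2 = E1 at *
  generalize hE2 : (b+1)^2-a^2 = E2 at *
  field_simp
  rw [← hE1, ← hE2]
  ring

/-- summing -/
lemma Msum {t : ℝ} (ht : 0 < t) (ht' : t < 1/10) {β κ T : ℂ} (h : Ok β)
    (h1 : ∀ k : ℕ, (β+k)^2-(t:ℂ)^2 ≠ 0)
    (hκ : Tendsto (fun l => cc t l * DD β l) atTop (𝓝 κ)) (hT : κ = T * β) (n : ℕ) :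
    8*(t:ℂ)^2*MM t (β+n) - 8*(t:ℂ)^2*MM t β = ∑ k ∈ range n, (GG t (β+k) T + GG t (β+(k+1:ℕ)) T) := by
  induction n with
  | zero => simp
  | succ n ih =>
    rw [Finset.sum_range_succ, ← ih]
    have s1 := MM_summable ht ht' h n
    have s2 := MM_summable ht ht' h (n+1)
    have h2 := h1 (n+1)
    have hb := h.ne
    push_cast at *
    rw [← add_assoc] at *
    have := Mstep (h.ni.addn n) (h1 n) h2 (hA_real ht ht') (kap_shiftn h.ni hκ n)
      (T := T) (by rw [hT]; field_simp) s1 s2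
    linear_combination this

lemma inv_lin (c : ℂ) : Tendsto (fun i : ℕ => 1/(c+(i:ℂ))) atTop (𝓝 0) := by
  have hk : Tendsto (fun k : ℕ => c + (k:ℂ)) atTop (Bornology.cobounded ℂ) := by
    have : Tendsto (fun k : ℕ => (k:ℂ)) atTop (Bornology.cobounded ℂ) := by
      rw [← tendsto_norm_atTop_iff_cobounded]
      simpa using tendsto_natCast_atTop_atTop (R := ℝ)
    exact tendsto_const_add_cobounded c |>.comp this
  simp only [one_div]
  exact tendsto_inv₀_cobounded.comp hk

lemma GG_tendsto (a β T : ℂ) : Tendsto (fun n : ℕ => GG a (β+n) T) atTop (𝓝 0) := by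
  have h1 := (inv_lin (β-a)).mul (inv_lin (β+a))
  have h2 := ((inv_lin β).mul h1).const_mul (a^2)
  have h3 := h2.sub (h1.const_mul (T*a^2))
  simp only [mul_zero, sub_zero] at h3
  refine h3.congr (fun n => ?_)
  rw [GG, EE]
  have : (β+n)^2-a^2 = (β-a+n)*(β+a+n) := by ring
  rw [this]
  simp only [div_eq_mul_inv, mul_inv]
  ring

lemma sum_trap (f : ℕ → ℂ) (n : ℕ) :
    ∑ k ∈ range n, (f k + f (k+1)) = 2 * ∑ k ∈ range n, f k + f n - f 0 := by
  induction n with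
  | zero => simp
  | succ n ih => rw [sum_range_succ, sum_range_succ, ih]; ring

lemma sum_trap' (f : ℕ → ℂ) (n : ℕ) :
    ∑ k ∈ range n, (f k + f (k+1)) = f 0 + 2 * ∑ k ∈ range n, f (k+1) - f n := by
  induction n with
  | zero => simp
  | succ n ih => rw [sum_range_succ, sum_range_succ, ih]; ring

lemma NI_of_im {b : ℂ} (h : b.im ≠ 0) : NI b := by
  intro n hn
  apply h
  have := congrArg Complex.im hn
  simpa using this

lemma ok_half : Ok (1/2) := by
  refine ⟨?_, by norm_num, by norm_num⟩
  intro n hn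
  have h2 : ((1 + 2*n : ℤ):ℂ) = 0 := by push_cast; linear_combination 2*hn
  have : (1 + 2*n : ℤ) = 0 := by exact_mod_cast h2
  omega

lemma Mhalf {t : ℝ} (ht : 0 < t) (ht' : t < 1/10) :
    Tendsto (fun n => ∑ k ∈ range n, 2 * EE t (1/2+k)) atTop (𝓝 (8*(t:ℂ)^2*∑' l, al (t:ℂ) l)) := by
  have hD : ∀ l, DD (1/2) (l+1) = 0 := by
    intro l
    rw [DD, Finset.prod_eq_zero (i := 0) (by simp)]
    simp
  have hκ : Tendsto (fun l => cc t l * DD (1/2) l) atTop (𝓝 0) := by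
    rw [← tendsto_add_atTop_iff_nat 1]
    simp only [hD, mul_zero]; exact tendsto_const_nhds
  have hA := hA_real ht ht'
  have hM0 : MM t (1/2) = al t 0 := by
    rw [MM, tsum_eq_single 0]
    · simp [DD]
    · intro l hl
      obtain ⟨m, rfl⟩ := Nat.exists_eq_succ_of_ne_zero hl
      rw [Nat.succ_eq_add_one, hD, mul_zero]
  have hs := fun n => Msum ht ht' ok_half (fun k => by rw [add_comm]; exact hA k) hκ (T := 0)
    (by simp) n
  have hE : 8*(t:ℂ)^2*al t 0 = EE t (1/2) := by
    rw [al, EE]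
    have := hA 0
    simp only [CharP.cast_eq_zero, zero_add] at this
    have e : (1/4:ℂ) - t^2 = (1/2)^2-t^2 := by ring
    rw [e]
    generalize ((1/2:ℂ))^2-(t:ℂ)^2 = E at *
    field_simp; ring
  have hG : ∀ b, GG t b 0 = EE t b := by intro b; simp [GG]
  simp only [hG] at hs
  have := ((MM_tendsto ht ht' ok_half).const_mul (8*(t:ℂ)^2)).sub (GG_tendsto t (1/2) 0)
  rw [sub_zero] at this
  refine this.congr (fun n => ?_)
  have h1 := hs n
  rw [sum_trap (fun k => EE t (1/2+k))] at h1
  rw [hG, ← mul_sum]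
  rw [hM0, hE] at h1
  simp only [CharP.cast_eq_zero, add_zero] at h1
  linear_combination h1

lemma DD_neg (b : ℂ) (l : ℕ) : DD (-b) l = DD b l := by simp [DD]

lemma Mi {t : ℝ} (ht : 0 < t) (ht' : t < 1/10) {κ : ℂ}
    (hκ : Tendsto (fun l => cc t l * DD (t * Complex.I) l) atTop (𝓝 κ)) :
    Tendsto (fun n => ∑ k ∈ range n, (GG t (t*Complex.I+(k+1:ℕ)) (κ/(t*Complex.I))
        + GG t (-(t*Complex.I)+(k+1:ℕ)) (-(κ/(t*Complex.I))))) atTop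
      (𝓝 (8*(t:ℂ)^2*∑' l, al (t:ℂ) l - 8*(t:ℂ)^2*MM t (t*Complex.I))) := by
  set β : ℂ := t*Complex.I with hβ
  have him : β.im = t := by simp [hβ]
  have hre : β.re = 0 := by simp [hβ]
  have o1 : Ok β := ⟨NI_of_im (by rw [him]; exact ht.ne'), by rw [hre], by rw [hre]; norm_num⟩
  have o2 : Ok (-β) := ⟨o1.ni.neg, by simp [hre], by simp [hre]⟩
  have ne : ∀ b : ℂ, b.im ≠ 0 → b^2-(t:ℂ)^2 ≠ 0 := by
    intro b hb h
    have : (b-t)*(b+t) = 0 := by linear_combination h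
    rcases mul_eq_zero.1 this with h | h <;>
    · have := congrArg Complex.im h
      simp at this
      exact hb this
  have hκ2 : Tendsto (fun l => cc t l * DD (-β) l) atTop (𝓝 κ) := by
    simpa only [DD_neg] using hκ
  have hMe : MM t (-β) = MM t β := by simp only [MM, DD_neg]
  have hb := o1.ne
  have s1 := fun n => Msum ht ht' o1 (fun k => ne _ (by simp [him, ht.ne'])) hκ (T := κ/β)
    (by field_simp) n
  have s2 := fun n => Msum ht ht' o2 (fun k => ne _ (by simp [him, ht.ne'])) hκ2 (T := -(κ/β))
    (by field_simp) n
  have l1 := (MM_tendsto ht ht' o1).const_mul (8*(t:ℂ)^2)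
  have l2 := (MM_tendsto ht ht' o2).const_mul (8*(t:ℂ)^2)
  have g1 := GG_tendsto t β (κ/β)
  have g2 := GG_tendsto t (-β) (-(κ/β))
  have L := (((l1.add l2).add (g1.add g2)).sub_const (16*(t:ℂ)^2*MM t β)).const_mul (1/2)
  have e : 1/2*(8*(t:ℂ)^2*∑' l, al (t:ℂ) l + 8*(t:ℂ)^2*∑' l, al (t:ℂ) l + (0+0) - 16*(t:ℂ)^2*MM t β)
     = 8*(t:ℂ)^2*∑' l, al (t:ℂ) l - 8*(t:ℂ)^2*MM t β := by ring
  rw [e] at L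
  refine L.congr (fun n => ?_)
  have h1 := s1 n
  have h2 := s2 n
  rw [sum_trap' (fun k => GG t (β+k) (κ/β))] at h1
  rw [sum_trap' (fun k => GG t (-β+k) (-(κ/β)))] at h2
  rw [sum_add_distrib]
  rw [hMe] at h2
  simp only [CharP.cast_eq_zero, add_zero] at h1 h2
  have e0 : GG t β (κ/β) + GG t (-β) (-(κ/β)) = 0 := by
    simp only [GG, EE, neg_sq, neg_mul, div_neg]
    ring
  linear_combination (h1+h2+e0)/2

/-- the final explicit formula for the key sum -/
lemma GGpair {t : ℝ} (ht : 0 < t) (κ : ℂ) (k : ℕ) :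
    GG t (t*Complex.I+(k+1:ℕ)) (κ/(t*Complex.I))
        + GG t (-(t*Complex.I)+(k+1:ℕ)) (-(κ/(t*Complex.I)))
    = 2*(t:ℂ)^2/(((k:ℂ)+1)*(((k:ℂ)+1)^2+t^2)) - 8*(t:ℂ)^4/(((k:ℂ)+1)*(((k:ℂ)+1)^4+4*t^4))
      + 4*(t:ℂ)^2*κ*((k:ℂ)+1)/(((k:ℂ)+1)^4+4*t^4) := by
  have hl : ((k:ℂ)+1) ≠ 0 := by exact_mod_cast Nat.succ_ne_zero k
  have hlr : (0:ℝ) < (k:ℝ)+1 := by positivity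
  have ht0 : (t:ℂ) ≠ 0 := by exact_mod_cast ht.ne'
  push_cast
  have q1 : ((k:ℂ)+1)^2+(t:ℂ)^2 ≠ 0 := by
    have : ((k:ℝ)+1)^2+t^2 ≠ 0 := by positivity
    have := Complex.ofReal_ne_zero.2 this
    push_cast at this; exact this
  have q2 : ((k:ℂ)+1)^4+4*(t:ℂ)^4 ≠ 0 := by
    have : ((k:ℝ)+1)^4+4*t^4 ≠ 0 := by positivity
    have := Complex.ofReal_ne_zero.2 this
    push_cast at this; exact this
  generalize ((k:ℂ)+1) = l at *
  generalize (t:ℂ) = a at *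
  have hI : Complex.I^2 = -1 := Complex.I_sq
  generalize Complex.I = J at *
  have hI0 : J ≠ 0 := by rintro rfl; norm_num at hI
  have f1 : l^2+a^2 = (a*J+l)*(-(a*J)+l) := by linear_combination (a^2)*hI
  have f2 : l^4+4*a^4 = ((a*J+l)^2-a^2)*((-(a*J)+l)^2-a^2) := by
    linear_combination (2*a^2*l^2 - a^4*(J^2-3))*hI
  rw [f1] at q1
  rw [f2] at q2
  have n1 := (mul_ne_zero_iff.1 q1)
  have n2 := (mul_ne_zero_iff.1 q2)
  rw [f1, f2]
  obtain ⟨m1, m2⟩ := n1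
  obtain ⟨m3, m4⟩ := n2
  simp only [GG, EE]
  generalize hP : (a*J+l)^2-a^2 = P at *
  generalize hQ : (-(a*J)+l)^2-a^2 = Q at *
  generalize hp : (a*J+l) = p at *
  generalize hq : (-(a*J)+l) = q at *
  have hQ' : Q = q^2 - a^2 := hQ.symm
  have r1 : κ/(a*J)*(a^2/P) - κ/(a*J)*(a^2/Q) = -4*a^2*κ*l/(P*Q) := by
    field_simp
    rw [← hP, ← hQ, ← hp, ← hq]
    ring
  have r2 : a^2/(p*P)+a^2/(q*Q) = 2*a^2/(l*(p*q)) - 8*a^4/(l*(P*Q)) := by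
    field_simp
    rw [← hP, ← hQ, ← hp, ← hq]
    linear_combination (10*a^2*l^2-2*a^4*(1+J^2)) * hI
  linear_combination r2 - r1

end ZH

namespace ZH
open Finset Filter Topology

noncomputable def sp (a : ℂ) (n : ℕ) : ℂ := ∏ j ∈ range n, (1 - a^2/((j:ℂ)+1)^2)
noncomputable def ccw (l : ℕ) : ℂ := ∏ j ∈ range l, (((j:ℂ)+1)/((j:ℂ)+1/2))^2

lemma half_ne (j : ℕ) : (j:ℂ)+1/2 ≠ 0 := by
  have : (j:ℝ)+1/2 ≠ 0 := by positivity
  have := Complex.ofReal_ne_zero.2 this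
  push_cast at this; exact this
lemma one_ne (j : ℕ) : (j:ℂ)+1 ≠ 0 := by exact_mod_cast Nat.succ_ne_zero j

lemma ccw_ne (l : ℕ) : ccw l ≠ 0 := by
  apply prod_ne_zero_iff.2
  intro j _
  exact pow_ne_zero _ (div_ne_zero (one_ne j) (half_ne j))

lemma cc_sp {a : ℂ} (hA : ∀ j : ℕ, ((j:ℂ)+1/2)^2-a^2 ≠ 0) (l : ℕ) :
    cc a l * sp (2*a) (2*l) = ccw l * (sp a l)^2 := by
  induction l with
  | zero => simp [cc, sp, ccw]
  | succ l ih =>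
    have e : 2*(l+1) = 2*l+1+1 := by ring
    rw [cc_succ, e]
    have s1 : sp (2*a) (2*l+1+1) = sp (2*a) (2*l) * ((1-(2*a)^2/((2*l:ℕ)+1)^2) * (1-(2*a)^2/((2*l+1:ℕ)+1)^2)) := by
      rw [sp, prod_range_succ, prod_range_succ, ← sp]; ring
    have s2 : sp a (l+1) = sp a l * (1-a^2/((l:ℂ)+1)^2) := by rw [sp, prod_range_succ, ← sp]
    have s3 : ccw (l+1) = ccw l * (((l:ℂ)+1)/((l:ℂ)+1/2))^2 := by rw [ccw, prod_range_succ, ← ccw]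
    rw [s1, s2, s3]
    have h1 := hA l
    have h2 := half_ne l
    have h3 := one_ne l
    have e2 : 1-(2*a)^2/(((2*l:ℕ):ℂ)+1)^2 = (((l:ℂ)+1/2)^2-a^2)/((l:ℂ)+1/2)^2 := by
      push_cast
      have : 2*(l:ℂ)+1 = 2*((l:ℂ)+1/2) := by ring
      rw [this]
      generalize (l:ℂ)+1/2 = x at *
      field_simp
      try ring
    have e3 : 1-(2*a)^2/(((2*l+1:ℕ):ℂ)+1)^2 = (1-a^2/((l:ℂ)+1)^2) := by
      push_cast
      have : 2*(l:ℂ)+1+1 = 2*((l:ℂ)+1) := by ring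
      rw [this]
      generalize (l:ℂ)+1 = x at *
      field_simp
      try ring
    have key : (((l:ℂ)+1)^2-a^2)/(((l:ℂ)+1/2)^2-a^2) * ((((l:ℂ)+1/2)^2-a^2)/((l:ℂ)+1/2)^2 * (1-a^2/((l:ℂ)+1)^2))
       = (((l:ℂ)+1)/((l:ℂ)+1/2))^2 * (1-a^2/((l:ℂ)+1)^2)^2 := by
      generalize ((l:ℂ)+1/2)^2-a^2 = E at *
      generalize (l:ℂ)+1/2 = x at *
      generalize (l:ℂ)+1 = y at *
      field_simp
      try ring
    rw [e2, e3]
    linear_combination ((((l:ℂ)+1)^2-a^2)/(((l:ℂ)+1/2)^2-a^2) * ((((l:ℂ)+1/2)^2-a^2)/((l:ℂ)+1/2)^2 * (1-a^2/((l:ℂ)+1)^2))) * ih + (ccw l * (sp a l)^2) * key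

lemma sp_tendsto {a : ℂ} (ha : a ≠ 0) :
    Tendsto (sp a) atTop (𝓝 (Complex.sin (Real.pi*a)/(Real.pi*a))) := by
  have hp : (Real.pi:ℂ)*a ≠ 0 := mul_ne_zero (by exact_mod_cast Real.pi_ne_zero) ha
  have := (Complex.tendsto_euler_sin_prod a).div_const (Real.pi*a)
  refine this.congr (fun n => ?_)
  rw [mul_div_cancel_left₀ _ hp, sp]

lemma ccn_tendsto {a : ℂ} (ha : a ≠ 0) (hA : ∀ j : ℕ, ((j:ℂ)+1/2)^2-a^2 ≠ 0)
    (hs : Complex.sin (Real.pi*a) ≠ 0) (hc : Complex.cos (Real.pi*a) ≠ 0) :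
    Tendsto (fun l => cc a l / ccw l) atTop
      (𝓝 (Complex.sin (Real.pi*a)/(Real.pi*a*Complex.cos (Real.pi*a)))) := by
  have hp : (Real.pi:ℂ) ≠ 0 := by exact_mod_cast Real.pi_ne_zero
  have h1 := (sp_tendsto ha).pow 2
  have h2 : Tendsto (fun l : ℕ => sp (2*a) (2*l)) atTop _ :=
    (sp_tendsto (a := 2*a) (by simpa using ha)).comp
      (tendsto_id.const_mul_atTop' (by norm_num : 0 < 2))
  have es : Complex.sin (Real.pi*(2*a)) = 2 * Complex.sin (Real.pi*a) * Complex.cos (Real.pi*a) := by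
    rw [← Complex.sin_two_mul]; ring_nf
  have hne : Complex.sin (Real.pi*(2*a))/(Real.pi*(2*a)) ≠ 0 := by
    rw [es]
    exact div_ne_zero (by simp [hs, hc]) (by simp [hp, ha])
  have h3 := h1.div h2 hne
  have e : (Complex.sin (Real.pi*a)/(Real.pi*a))^2 / (Complex.sin (Real.pi*(2*a))/(Real.pi*(2*a)))
     = Complex.sin (Real.pi*a)/(Real.pi*a*Complex.cos (Real.pi*a)) := by
    rw [es]; field_simp
  rw [e] at h3
  refine h3.congr' ?_
  filter_upwards [h2.eventually_ne hne] with l hl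
  simp only [Pi.div_apply]
  rw [div_eq_div_iff hl (ccw_ne l), cc_sp hA]; ring

noncomputable def kap (t : ℂ) : ℂ :=
  Complex.I * Complex.sin (Real.pi*t) * Complex.cos (Real.pi*(t*Complex.I)) /
    (Complex.cos (Real.pi*t) * Complex.sin (Real.pi*(t*Complex.I)))

lemma trig_ne {t : ℝ} (ht : 0 < t) (ht' : t < 1/10) :
    Complex.sin (Real.pi*t) ≠ 0 ∧ Complex.cos (Real.pi*t) ≠ 0 ∧
    Complex.sin (Real.pi*(t*Complex.I)) ≠ 0 ∧ Complex.cos (Real.pi*(t*Complex.I)) ≠ 0 := by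
  have hp := Real.pi_pos
  refine ⟨?_, ?_, ?_, ?_⟩
  · have : Real.sin (Real.pi*t) ≠ 0 := (Real.sin_pos_of_pos_of_lt_pi (by positivity) (by nlinarith)).ne'
    have := Complex.ofReal_ne_zero.2 this
    push_cast at this; exact this
  · have : Real.cos (Real.pi*t) ≠ 0 := (Real.cos_pos_of_mem_Ioo ⟨by nlinarith, by nlinarith⟩).ne'
    have := Complex.ofReal_ne_zero.2 this
    push_cast at this; exact this
  · rw [← mul_assoc, Complex.sin_mul_I]
    have : Real.sinh (Real.pi*t) ≠ 0 := (Real.sinh_pos_iff.2 (by positivity)).ne'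
    have := Complex.ofReal_ne_zero.2 this
    push_cast at this
    exact mul_ne_zero this Complex.I_ne_zero
  · rw [← mul_assoc, Complex.cos_mul_I]
    have : Real.cosh (Real.pi*t) ≠ 0 := (Real.cosh_pos _).ne'
    have := Complex.ofReal_ne_zero.2 this
    push_cast at this; exact this

lemma kap_ne {t : ℝ} (ht : 0 < t) (ht' : t < 1/10) : kap t ≠ 0 := by
  obtain ⟨h1, h2, h3, h4⟩ := trig_ne ht ht'
  exact div_ne_zero (mul_ne_zero (mul_ne_zero Complex.I_ne_zero h1) h4) (mul_ne_zero h2 h3)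

lemma hA_im {t : ℝ} (j : ℕ) : ((j:ℂ)+1/2)^2-(t*Complex.I)^2 ≠ 0 := by
  rw [mul_pow, Complex.I_sq]
  have : ((j:ℝ)+1/2)^2 + t^2 ≠ 0 := by positivity
  have := Complex.ofReal_ne_zero.2 this
  push_cast at this
  intro h; apply this; rw [← h]; ring

lemma kap_tendsto {t : ℝ} (ht : 0 < t) (ht' : t < 1/10) :
    Tendsto (fun l => cc t l * DD (t * Complex.I) l) atTop (𝓝 (kap t)) := by
  obtain ⟨h1, h2, h3, h4⟩ := trig_ne ht ht'
  have t0 : (t:ℂ) ≠ 0 := by exact_mod_cast ht.ne'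
  have hp : (Real.pi:ℂ) ≠ 0 := by exact_mod_cast Real.pi_ne_zero
  have l1 := ccn_tendsto t0 (hA_real ht ht') h1 h2
  have l2 := ccn_tendsto (a := t*Complex.I) (mul_ne_zero t0 Complex.I_ne_zero) hA_im h3 h4
  have l3 := l1.div l2 (div_ne_zero h3 (mul_ne_zero (mul_ne_zero hp (mul_ne_zero t0 Complex.I_ne_zero)) h4))
  have e : Complex.sin (Real.pi*t)/(Real.pi*t*Complex.cos (Real.pi*t)) /
     (Complex.sin (Real.pi*(t*Complex.I))/(Real.pi*(t*Complex.I)*Complex.cos (Real.pi*(t*Complex.I))))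
     = kap t := by
    rw [kap]
    generalize Complex.sin (Real.pi*(t*Complex.I)) = S at *
    generalize Complex.cos (Real.pi*(t*Complex.I)) = C at *
    field_simp
  rw [e] at l3
  refine l3.congr (fun l => ?_)
  have : DD (t*Complex.I) l = (cc (t*Complex.I) l)⁻¹ := by
    rw [DD, cc, ← prod_inv_distrib]; simp
  simp only [Pi.div_apply]
  rw [this, div_div_div_cancel_right₀ (ccw_ne l), div_eq_mul_inv]

noncomputable def Z3 (q : ℂ) : ℂ := ∑' m : ℕ, 1/(((m:ℂ)+1)*(((m:ℂ)+1)^2-q))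

lemma den_bound {q : ℂ} (hq : ‖q‖ < 1) (m : ℕ) :
    ((m:ℝ)+1)^2*(1-‖q‖) ≤ ‖((m:ℂ)+1)^2-q‖ := by
  have h1 := norm_sub_norm_le (((m:ℂ)+1)^2) q
  have h2 : ‖((m:ℂ)+1)^2‖ = ((m:ℝ)+1)^2 := norm_of_pos (by positivity) (by push_cast; rfl)
  rw [h2] at h1
  have : (1:ℝ) ≤ ((m:ℝ)+1)^2 := by
    have : (0:ℝ) ≤ m := by positivity
    nlinarith
  nlinarith [norm_nonneg q]

lemma den_ne {q : ℂ} (hq : ‖q‖ < 1) (m : ℕ) : ((m:ℂ)+1)^2-q ≠ 0 := by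
  have := den_bound hq m
  have h : 0 < ((m:ℝ)+1)^2*(1-‖q‖) := mul_pos (by positivity) (by linarith)
  intro h0; rw [h0, norm_zero] at this; linarith

lemma sum_cube : Summable (fun m : ℕ => 1/((m:ℝ)+1)^3) := by
  have := (summable_nat_add_iff 1).2 (Real.summable_one_div_nat_pow (p := 3).2 (by norm_num))
  refine this.congr (fun l => ?_)
  push_cast; rfl

lemma Z3_summable {q : ℂ} (hq : ‖q‖ < 1) :
    Summable (fun m : ℕ => 1/(((m:ℂ)+1)*(((m:ℂ)+1)^2-q))) := by
  refine Summable.of_norm_bounded (sum_cube.mul_left (1/(1-‖q‖))) (fun m => ?_)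
  have hq' : 0 < 1 - ‖q‖ := by linarith
  have h1 : ‖(m:ℂ)+1‖ = (m:ℝ)+1 := norm_of_pos (by positivity) (by push_cast; rfl)
  rw [norm_div, norm_mul, norm_one, h1, div_mul_div_comm, one_mul]
  have := den_bound hq m
  have h0 : (0:ℝ) < (m:ℝ)+1 := by positivity
  apply div_le_div₀ (by norm_num) le_rfl (by positivity)
  calc (1-‖q‖)*((m:ℝ)+1)^3 = ((m:ℝ)+1)*(((m:ℝ)+1)^2*(1-‖q‖)) := by ring
    _ ≤ _ := by gcongr

lemma Z3_hasSum {q : ℂ} (hq : ‖q‖ < 1) :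
    HasSum (fun m : ℕ => 1/(((m:ℂ)+1)*(((m:ℂ)+1)^2-q))) (Z3 q) := (Z3_summable hq).hasSum

noncomputable def zt (q : ℂ) (m : ℕ) : ℂ := 1/(((m:ℂ)+1)*(((m:ℂ)+1)^2-q))

/-- even/odd splitting -/
lemma EE_sum {t : ℝ} (ht : 0 < t) (ht' : t < 1/10) :
    HasSum (fun k : ℕ => 2 * EE t (1/2+k)) (16*(t:ℂ)^2*Z3 (4*t^2) - 2*(t:ℂ)^2*Z3 (t^2)) := by
  have q1 : ‖(4*(t:ℂ)^2)‖ < 1 := by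
    rw [norm_of_pos (x := 4*t^2) (by positivity) (by push_cast; rfl)]; nlinarith
  have q2 : ‖((t:ℂ)^2)‖ < 1 := by
    rw [norm_of_pos (x := t^2) (by positivity) (by push_cast; rfl)]; nlinarith
  have s1 : HasSum (zt (4*t^2)) (Z3 (4*t^2)) := Z3_hasSum q1
  have s2 : HasSum (zt (t^2)) (Z3 (t^2)) := Z3_hasSum q2
  have e2 : ∀ k : ℕ, zt (4*t^2) (2*k+1) = 1/8 * zt (t^2) k := by
    intro k
    have h1 := one_ne k
    have h2 := den_ne q2 k
    rw [zt, zt]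
    push_cast
    have e : (2*(k:ℂ)+1+1)^2-4*(t:ℂ)^2 = 4*(((k:ℂ)+1)^2-t^2) := by ring
    have e' : (2*(k:ℂ)+1+1) = 2*((k:ℂ)+1) := by ring
    rw [e, e']
    generalize ((k:ℂ)+1)^2-(t:ℂ)^2 = E at *
    field_simp
    norm_num
  have e1 : ∀ k : ℕ, 2 * EE t (1/2+k) = 16*(t:ℂ)^2 * zt (4*t^2) (2*k) := by
    intro k
    have h1 := half_ne k
    have h2 := hA_real ht ht' k
    rw [zt, EE]
    push_cast
    have e : (2*(k:ℂ)+1)^2-4*(t:ℂ)^2 = 4*(((k:ℂ)+1/2)^2-t^2) := by ring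
    have e' : (2*(k:ℂ)+1) = 2*((k:ℂ)+1/2) := by ring
    rw [e, e', add_comm (1/2:ℂ)]
    generalize ((k:ℂ)+1/2)^2-(t:ℂ)^2 = E at *
    generalize ((k:ℂ)+1/2) = x at *
    field_simp
    ring
  have he : HasSum (fun k => zt (4*t^2) (2*k+1)) (1/8*Z3 (t^2)) := by
    simp only [e2]
    exact s2.mul_left _
  have so : HasSum (fun k => zt (4*t^2) (2*k)) (∑' k, zt (4*t^2) (2*k)) :=
    (s1.summable.comp_injective (i := fun k : ℕ => 2*k) (fun a b h => by simpa using h)).hasSum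
  have hu := (so.even_add_odd he).unique s1
  simp only [e1]
  have e : 16*(t:ℂ)^2*Z3 (4*t^2) - 2*(t:ℂ)^2*Z3 (t^2) = 16*(t:ℂ)^2 * ∑' k : ℕ, zt (4*t^2) (2*k) := by
    rw [← hu]; ring
  rw [e]
  exact so.mul_left _

lemma S_sum {t : ℝ} (ht : 0 < t) (ht' : t < 1/10) (κ : ℂ) :
    HasSum (fun k : ℕ => 2*(t:ℂ)^2/(((k:ℂ)+1)*(((k:ℂ)+1)^2+t^2)) - 8*(t:ℂ)^4/(((k:ℂ)+1)*(((k:ℂ)+1)^4+4*t^4))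
      + 4*(t:ℂ)^2*κ*((k:ℂ)+1)/(((k:ℂ)+1)^4+4*t^4))
     (2*(t:ℂ)^2*Z3 (-t^2) + 2*Complex.I*(t:ℂ)^2*(Z3 (2*Complex.I*t^2) - Z3 (-(2*Complex.I*t^2)))
       + 2*(t:ℂ)^2*κ*(Z3 (2*Complex.I*t^2) + Z3 (-(2*Complex.I*t^2)))) := by
  have q1 : ‖(2*Complex.I*(t:ℂ)^2)‖ < 1 := by
    rw [norm_mul, norm_mul, Complex.norm_I, norm_of_pos (x := t^2) (z := (t:ℂ)^2) (by positivity) (by push_cast; rfl)]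
    norm_num
    nlinarith
  have q1' : ‖-(2*Complex.I*(t:ℂ)^2)‖ < 1 := by rwa [norm_neg]
  have q2 : ‖(-(t:ℂ)^2)‖ < 1 := by
    rw [norm_neg, norm_of_pos (x := t^2) (by positivity) (by push_cast; rfl)]; nlinarith
  have h1 := Z3_hasSum q1
  have h2 := Z3_hasSum q1'
  have h3 := Z3_hasSum q2
  have := ((h3.mul_left (2*(t:ℂ)^2)).add ((h1.sub h2).mul_left (2*Complex.I*(t:ℂ)^2))).add
    ((h1.add h2).mul_left (2*(t:ℂ)^2*κ))
  refine this.congr_fun (fun k => ?_)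
  have m0 := one_ne k
  have m1 := den_ne q1 k
  have m2 := den_ne q1' k
  have m3 := den_ne q2 k
  have f1 : ((k:ℂ)+1)^2+(t:ℂ)^2 = ((k:ℂ)+1)^2-(-(t:ℂ)^2) := by ring
  have f2 : ((k:ℂ)+1)^4+4*(t:ℂ)^4 = (((k:ℂ)+1)^2-2*Complex.I*(t:ℂ)^2)*(((k:ℂ)+1)^2-(-(2*Complex.I*(t:ℂ)^2))) := by
    linear_combination (4*(t:ℂ)^4)*Complex.I_sq
  rw [f1, f2]
  have hI := Complex.I_sq
  generalize Complex.I = J at *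
  generalize (k:ℂ)+1 = l at *
  generalize (t:ℂ) = a at *
  generalize hx : l^2-2*J*a^2 = x at *
  generalize hy : l^2-(-(2*J*a^2)) = y at *
  have r1 : 8*a^4/(l*(x*y)) = -(2*J*a^2*(1/(l*x)-1/(l*y))) := by
    field_simp
    rw [← hx, ← hy]
    linear_combination (8*a^4)*hI
  have r2 : 4*a^2*κ*l/(x*y) = 2*a^2*κ*(1/(l*x)+1/(l*y)) := by
    field_simp
    rw [← hx, ← hy]
    ring
  rw [r1, r2]
  ring

lemma MM_formula {t : ℝ} (ht : 0 < t) (ht' : t < 1/10) :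
    MM t (t*Complex.I) = 2*Z3 (4*t^2)
      - (1/4)*(Z3 (t^2) + Z3 (-t^2) + Complex.I*(Z3 (2*Complex.I*t^2) - Z3 (-(2*Complex.I*t^2))))
      - (1/4)*kap t*(Z3 (2*Complex.I*t^2) + Z3 (-(2*Complex.I*t^2))) := by
  have t0 : (t:ℂ) ≠ 0 := by exact_mod_cast ht.ne'
  have h1 := tendsto_nhds_unique (Mhalf ht ht') (EE_sum ht ht').tendsto_sum_nat
  have h2 := Mi ht ht' (kap_tendsto ht ht')
  simp only [GGpair ht] at h2
  have h3 := tendsto_nhds_unique h2 (S_sum ht ht' (kap t)).tendsto_sum_nat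
  have h8 : 8*(t:ℂ)^2 ≠ 0 := by simpa using t0
  apply mul_left_cancel₀ h8
  linear_combination h1 - h3

end ZH

namespace ZH
open Finset Filter Topology

lemma zeta_hasSum (s : ℕ) (hs : 2 ≤ s) :
    HasSum (fun m : ℕ => 1/((m:ℂ)+1)^s) (riemannZeta s) := by
  have h1 : Summable (fun m : ℕ => 1/((m:ℂ)+1)^s) := by
    have := (summable_nat_add_iff 1).2 ((Complex.summable_one_div_nat_cpow (p := (s:ℂ))).2 (by
      simp; omega))
    refine this.congr (fun m => ?_)
    rw [Complex.cpow_natCast]; push_cast; rfl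
  have h2 := zeta_eq_tsum_one_div_nat_add_one_cpow (s := (s:ℂ)) (by simp; omega)
  simp only [Complex.cpow_natCast] at h2
  rw [h2]
  exact h1.hasSum

lemma geo (s : ℕ) (hs : 2 ≤ s) {q : ℂ} (hq : ‖q‖ < 1) :
    HasSum (fun c : ℕ => riemannZeta (2*c+s) * q^c)
      (∑' m : ℕ, 1/((m:ℂ)+1)^s * (1 - q/((m:ℂ)+1)^2)⁻¹) := by
  have hb : ∀ p : ℕ × ℕ, ‖1/((p.2:ℂ)+1)^(2*p.1+s) * q^p.1‖ ≤ ‖q‖^p.1 * (1/((p.2:ℝ)+1)^2) := by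
    rintro ⟨c, m⟩
    have h1 : ‖(m:ℂ)+1‖ = (m:ℝ)+1 := norm_of_pos (by positivity) (by push_cast; rfl)
    rw [norm_mul, norm_div, norm_pow, norm_pow, norm_one, h1, mul_comm]
    gcongr
    · have : (0:ℝ) ≤ m := by positivity
      linarith
    · omega
  have hsq : Summable (fun m : ℕ => 1/((m:ℝ)+1)^2) := by
    have := (summable_nat_add_iff 1).2 (Real.summable_one_div_nat_pow (p := 2).2 (by norm_num))
    refine this.congr (fun l => ?_)
    push_cast; rfl
  have hS : Summable (fun p : ℕ × ℕ => 1/((p.2:ℂ)+1)^(2*p.1+s) * q^p.1) := by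
    refine Summable.of_norm_bounded ?_ hb
    exact (summable_geometric_of_lt_one (norm_nonneg _) hq).mul_of_nonneg hsq
      (fun _ => by positivity) (fun _ => by positivity)
  have h1 : HasSum (fun c : ℕ => riemannZeta (2*c+s) * q^c) _ := hS.hasSum.prod_fiberwise (fun c => by
    have := (zeta_hasSum (2*c+s) (by omega)).mul_right (q^c)
    push_cast at this
    exact this)
  have h2 : HasSum (fun m : ℕ => 1/((m:ℂ)+1)^s * (1 - q/((m:ℂ)+1)^2)⁻¹) _ :=
    ((Equiv.prodComm ℕ ℕ).hasSum_iff.2 hS.hasSum).prod_fiberwise (fun m => by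
      have hn : ‖q/((m:ℂ)+1)^2‖ < 1 := by
        have h1 : ‖(m:ℂ)+1‖ = (m:ℝ)+1 := norm_of_pos (by positivity) (by push_cast; rfl)
        rw [norm_div, norm_pow, h1]
        refine lt_of_le_of_lt (div_le_self (norm_nonneg _) ?_) hq
        have : (0:ℝ) ≤ m := by positivity
        nlinarith
      have := (hasSum_geometric_of_norm_lt_one hn).mul_left (1/((m:ℂ)+1)^s)
      refine this.congr_fun (fun c => ?_)
      simp only [Function.comp, Equiv.prodComm_apply, Prod.swap]
      have h0 := one_ne m
      rw [div_pow, pow_add, ← pow_mul]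
      field_simp)
  rw [h2.tsum_eq]
  exact h1

lemma Z3_geo {q : ℂ} (hq : ‖q‖ < 1) :
    HasSum (fun c : ℕ => riemannZeta (2*c+3) * q^c) (Z3 q) := by
  have := geo 3 (by norm_num) hq
  push_cast at this
  convert this using 1
  rw [Z3]
  congr 1
  ext m
  have h0 := one_ne m
  have h1 := den_ne hq m
  have : 1 - q/((m:ℂ)+1)^2 = (((m:ℂ)+1)^2 - q)/((m:ℂ)+1)^2 := by field_simp
  rw [this]
  generalize ((m:ℂ)+1)^2 - q = E at *
  field_simp

lemma B_geo {x : ℂ} (hx : ‖x‖ < 1) (h0 : x ≠ 0) :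
    HasSum (fun b : ℕ => riemannZeta (2*b) * (x^2)^b)
      (-(1/2)*(Real.pi*x*(Complex.cos (Real.pi*x)/Complex.sin (Real.pi*x)))) := by
  have hq : ‖x^2‖ < 1 := by rw [norm_pow]; nlinarith [norm_nonneg x]
  rw [← hasSum_nat_add_iff' 1]
  have h1 := (geo 2 (by norm_num) hq).mul_left (x^2)
  push_cast at h1
  have hZ : x ∈ Complex.integerComplement := by
    rw [Complex.mem_integerComplement_iff]
    rintro ⟨n, rfl⟩
    rw [Complex.norm_intCast] at hx
    have : |n| < 1 := by exact_mod_cast hx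
    have : n = 0 := by rw [abs_lt] at this; omega
    subst this; simp at h0
  have hc := cot_series_rep' hZ
  have e : ∑' n : ℕ, (1/(x-(n+1)) + 1/(x+(n+1)))
      = -2*x* ∑' m : ℕ, 1/((m:ℂ)+1)^2 * (1 - x^2/((m:ℂ)+1)^2)⁻¹ := by
    rw [← tsum_mul_left]
    congr 1
    ext m
    have k0 := one_ne m
    have k1 := den_ne hq m
    have : 1 - x^2/((m:ℂ)+1)^2 = (((m:ℂ)+1)^2 - x^2)/((m:ℂ)+1)^2 := by field_simp
    rw [this]
    generalize (m:ℂ)+1 = y at *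
    have k2 : y^2-x^2 = -((x-y)*(x+y)) := by ring
    rw [k2] at k1 ⊢
    have k3 : x - y ≠ 0 := by rintro h; apply k1; rw [h]; ring
    have k4 : x + y ≠ 0 := by rintro h; apply k1; rw [h]; ring
    field_simp
    ring
  rw [e, Complex.cot_eq_cos_div_sin] at hc
  have e2 : -(1/2)*(Real.pi*x*(Complex.cos (Real.pi*x)/Complex.sin (Real.pi*x)))
     - ∑ i ∈ range 1, riemannZeta (2*(i:ℕ)) * (x^2)^i
     = x^2 * ∑' m : ℕ, 1/((m:ℂ)+1)^2 * (1 - x^2/((m:ℂ)+1)^2)⁻¹ := by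
    simp [riemannZeta_zero]
    have : (x:ℂ) * (1/x) = 1 := by field_simp
    simp only [one_div] at *
    linear_combination -(1/2)*x*hc - (1/2)*this
  rw [e2]
  refine h1.congr_fun (fun b => ?_)
  push_cast
  rw [pow_succ, mul_add, mul_one]; ring

noncomputable def Ac (a : ℕ) : ℂ := (-1)^a * (1 - 2^(2*a)) * riemannZeta (2*a)
noncomputable def Bc (b : ℕ) : ℂ := riemannZeta (2*b)
noncomputable def Cc (c : ℕ) : ℂ := riemannZeta (2*c+3) *
  (2 * (if Even c then 1 else 0) + (2*Complex.I)^(c+1) * (if Odd c then 1 else 0) - 8*4^c)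

noncomputable def tri (N : ℕ) : ℂ :=
  ∑ p ∈ (range (N+1) ×ˢ range (N+1) ×ˢ range (N+1)).filter (fun p => p.1+p.2.1+p.2.2 = N),
    Ac p.1 * Bc p.2.1 * Cc p.2.2

lemma tri_eq (N : ℕ) : tri N = ∑ p ∈ antidiagonal N, Ac p.1 * ∑ q ∈ antidiagonal p.2, Bc q.1 * Cc q.2 := by
  simp only [mul_sum]
  rw [sum_sigma', tri]
  refine sum_nbij' (fun p => ⟨(p.1, p.2.1+p.2.2), (p.2.1, p.2.2)⟩) (fun s => (s.1.1, s.2.1, s.2.2))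
    ?_ ?_ ?_ ?_ ?_
  · rintro ⟨a, b, c⟩ h
    simp at h ⊢
    omega
  · rintro ⟨⟨a, d⟩, b, c⟩ h
    simp at h ⊢
    omega
  · rintro ⟨a, b, c⟩ h
    rfl
  · rintro ⟨⟨a, d⟩, b, c⟩ h
    simp at h ⊢
    exact h.2
  · rintro ⟨a, b, c⟩ h
    simp [mul_assoc]

lemma Ac_sum {t : ℝ} (ht : 0 < t) (ht' : t < 1/10) :
    HasSum (fun a => Ac a * ((t:ℂ)^2)^a)
      (-(1/2)*(Real.pi*(t*Complex.I)*(Complex.sin (Real.pi*(t*Complex.I))/Complex.cos (Real.pi*(t*Complex.I))))) := by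
  obtain ⟨h1, h2, h3, h4⟩ := trig_ne ht ht'
  have t0 : (t:ℂ) ≠ 0 := by exact_mod_cast ht.ne'
  have n1 : ‖(t:ℂ)*Complex.I‖ < 1 := by
    rw [norm_mul, Complex.norm_I, norm_of_pos ht rfl]; linarith
  have n2 : ‖2*((t:ℂ)*Complex.I)‖ < 1 := by
    rw [norm_mul, norm_mul, Complex.norm_I, norm_of_pos ht rfl]; norm_num; linarith
  have b1 := B_geo n1 (mul_ne_zero t0 Complex.I_ne_zero)
  have b2 := B_geo n2 (mul_ne_zero two_ne_zero (mul_ne_zero t0 Complex.I_ne_zero))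
  have := b1.sub b2
  have e : (Real.pi:ℂ)*(2*(t*Complex.I)) = 2*(Real.pi*(t*Complex.I)) := by ring
  rw [e, Complex.sin_two_mul, Complex.cos_two_mul'] at this
  have ev : ∀ P S C : ℂ, S ≠ 0 → C ≠ 0 → -(1/2)*(P*(S/C)) = -(1/2)*(P*(C/S)) - -(1/2)*(2*P*((C^2-S^2)/(2*S*C))) := by
    intro P S C hS hC
    field_simp
    ring
  rw [ev _ _ _ h3 h4]
  refine this.congr_fun (fun a => ?_)
  rw [Ac, mul_pow 2, mul_pow (t:ℂ), Complex.I_sq, mul_pow (2^2:ℂ), mul_pow, ← pow_mul 2 2 a]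
  ring

lemma Cc_sum {t : ℝ} (ht : 0 < t) (ht' : t < 1/10) :
    HasSum (fun c => Cc c * ((t:ℂ)^2)^c)
      (Z3 (t^2) + Z3 (-t^2) + Complex.I*(Z3 (2*Complex.I*t^2) - Z3 (-(2*Complex.I*t^2))) - 8*Z3 (4*t^2)) := by
  have q1 : ‖(2*Complex.I*(t:ℂ)^2)‖ < 1 := by
    rw [norm_mul, norm_mul, Complex.norm_I, norm_of_pos (x := t^2) (z := (t:ℂ)^2) (by positivity) (by push_cast; rfl)]
    norm_num
    nlinarith
  have q1' : ‖-(2*Complex.I*(t:ℂ)^2)‖ < 1 := by rwa [norm_neg]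
  have q2' : ‖((t:ℂ)^2)‖ < 1 := by
    rw [norm_of_pos (x := t^2) (by positivity) (by push_cast; rfl)]; nlinarith
  have q2 : ‖(-(t:ℂ)^2)‖ < 1 := by rwa [norm_neg]
  have q4 : ‖(4*(t:ℂ)^2)‖ < 1 := by
    rw [norm_of_pos (x := 4*t^2) (by positivity) (by push_cast; rfl)]; nlinarith
  have := (((Z3_geo q2').add (Z3_geo q2)).add (((Z3_geo q1).sub (Z3_geo q1')).mul_left Complex.I)).sub
    ((Z3_geo q4).mul_left 8)
  refine this.congr_fun (fun c => ?_)
  rw [Cc]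
  rcases Nat.even_or_odd c with hc | hc
  · have hc' : ¬ Odd c := by simpa using hc
    rw [hc.neg_pow, hc.neg_pow, mul_pow 4, if_pos hc, if_neg hc']; ring
  · have hc' : ¬ Even c := by simpa using hc
    rw [hc.neg_pow, hc.neg_pow, mul_pow 4, mul_pow (2*Complex.I), if_neg hc', if_pos hc]; ring

/-- the coefficient on the right-hand side -/
noncomputable def Rc (n : ℕ) : ℂ :=
  -(Complex.I ^ n * (if Even n then 1 else 0) / 2 ^ (2 * n + 1)) * riemannZeta (2 * n + 3)
   + 1/(6*riemannZeta 2) * (tri (n+1)/8^n)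

lemma first_sum {t : ℝ} (ht : 0 < t) (ht' : t < 1/10) :
    HasSum (fun n : ℕ => -(Complex.I ^ n * (if Even n then 1 else 0) / 2 ^ (2 * n + 1)) * riemannZeta (2 * n + 3)
      * (8*(t:ℂ)^2)^n) (-(1/4)*(Z3 (2*Complex.I*t^2) + Z3 (-(2*Complex.I*t^2)))) := by
  have q1 : ‖(2*Complex.I*(t:ℂ)^2)‖ < 1 := by
    rw [norm_mul, norm_mul, Complex.norm_I, norm_of_pos (x := t^2) (z := (t:ℂ)^2) (by positivity) (by push_cast; rfl)]
    norm_num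
    nlinarith
  have q1' : ‖-(2*Complex.I*(t:ℂ)^2)‖ < 1 := by rwa [norm_neg]
  have := ((Z3_geo q1).add (Z3_geo q1')).mul_left (-(1/4))
  refine this.congr_fun (fun n => ?_)
  rcases Nat.even_or_odd n with hc | hc
  · rw [hc.neg_pow, if_pos hc]
    have e : (8*(t:ℂ)^2)^n = 2^(2*n) * (2*(t:ℂ)^2)^n := by
      rw [pow_mul, ← mul_pow]; ring
    have e2 : (2*Complex.I*(t:ℂ)^2)^n = Complex.I^n*(2*(t:ℂ)^2)^n := by
      rw [← mul_pow]; ring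
    rw [e, e2, pow_succ]
    field_simp
    ring
  · have hc' : ¬ Even n := by simpa using hc
    rw [hc.neg_pow, if_neg hc']; ring

lemma tri_sum {w x y z : ℂ} (A : HasSum (fun a => Ac a * w^a) x) (B : HasSum (fun a => Bc a * w^a) y)
    (C : HasSum (fun a => Cc a * w^a) z) : HasSum (fun N => tri (N+1) * w^(N+1)) (x*(y*z)) := by
  have nA : Summable (fun a => ‖Ac a * w^a‖) := A.summable.norm
  have nB : Summable (fun a => ‖Bc a * w^a‖) := B.summable.norm
  have nC : Summable (fun a => ‖Cc a * w^a‖) := C.summable.norm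
  have BCs := summable_norm_sum_mul_antidiagonal_of_summable_norm
    (f := fun a => Bc a * w^a) (g := fun a => Cc a * w^a) nB nC
  have BC := tsum_mul_tsum_eq_tsum_sum_antidiagonal_of_summable_norm
    (f := fun a => Bc a * w^a) (g := fun a => Cc a * w^a) nB nC
  have ABCs := summable_norm_sum_mul_antidiagonal_of_summable_norm
    (f := fun a => Ac a * w^a)
    (g := fun n => ∑ kl ∈ antidiagonal n, Bc kl.1 * w^kl.1 * (Cc kl.2 * w^kl.2)) nA BCs
  have ABC := tsum_mul_tsum_eq_tsum_sum_antidiagonal_of_summable_norm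
    (f := fun a => Ac a * w^a)
    (g := fun n => ∑ kl ∈ antidiagonal n, Bc kl.1 * w^kl.1 * (Cc kl.2 * w^kl.2)) nA BCs
  rw [← BC, A.tsum_eq, B.tsum_eq, C.tsum_eq] at ABC
  have H := (summable_norm_iff.1 ABCs).hasSum
  rw [← ABC] at H
  have H2 : HasSum (fun N => tri N * w^N) (x*(y*z)) := by
    refine H.congr_fun (fun N => ?_)
    rw [tri_eq, sum_mul]
    apply sum_congr rfl
    intro p hp
    rw [mul_sum, mul_sum, sum_mul]
    apply sum_congr rfl
    intro q hq
    rw [HasAntidiagonal.mem_antidiagonal] at hp hq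
    rw [← hp, ← hq, pow_add, pow_add]; ring
  rw [← hasSum_nat_add_iff' 1] at H2
  have tri0 : tri 0 = 0 := by rw [tri_eq]; simp [Ac]
  simpa only [range_one, sum_singleton, tri0, zero_mul, sub_zero] using H2

lemma AB_eq {t : ℝ} (ht : 0 < t) (ht' : t < 1/10) :
    (-(1/2)*(Real.pi*(t*Complex.I)*(Complex.sin (Real.pi*(t*Complex.I))/Complex.cos (Real.pi*(t*Complex.I)))))
       * (-(1/2)*(Real.pi*t*(Complex.cos (Real.pi*t)/Complex.sin (Real.pi*t))))
       = -(1/4)*Real.pi^2*t^2/kap t := by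
  obtain ⟨h1, h2, h3, h4⟩ := trig_ne ht ht'
  rw [kap]
  have hI := Complex.I_sq
  have hI0 := Complex.I_ne_zero
  generalize Complex.sin (Real.pi*(t*Complex.I)) = S at *
  generalize Complex.cos (Real.pi*(t*Complex.I)) = C at *
  generalize Complex.sin (Real.pi*t) = S' at *
  generalize Complex.cos (Real.pi*t) = C' at *
  generalize Complex.I = J at *
  generalize (Real.pi:ℂ) = p at *
  generalize (t:ℂ) = a at *
  field_simp
  linear_combination (4*p^2*a^2) * hI

lemma R_sum {t : ℝ} (ht : 0 < t) (ht' : t < 1/10) :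
    HasSum (fun n => Rc n * (8*(t:ℂ)^2)^n) (MM t (t*Complex.I)/kap t) := by
  have t0 : (t:ℂ) ≠ 0 := by exact_mod_cast ht.ne'
  have hp : (Real.pi:ℂ) ≠ 0 := by exact_mod_cast Real.pi_ne_zero
  have n1 : ‖(t:ℂ)‖ < 1 := by rw [norm_of_pos ht rfl]; linarith
  have H2 := tri_sum (Ac_sum ht ht') (B_geo n1 t0) (Cc_sum ht ht')
  rw [← mul_assoc, AB_eq ht ht'] at H2
  have H3 := (first_sum ht ht').add ((H2.mul_left (1/(6*riemannZeta 2)/(t:ℂ)^2)))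
  have hv : MM t (t*Complex.I)/kap t = -(1/4)*(Z3 (2*Complex.I*t^2) + Z3 (-(2*Complex.I*t^2)))
      + 1/(6*riemannZeta 2)/(t:ℂ)^2 * (-(1/4)*Real.pi^2*t^2/kap t *
       (Z3 (t^2) + Z3 (-t^2) + Complex.I*(Z3 (2*Complex.I*t^2) - Z3 (-(2*Complex.I*t^2))) - 8*Z3 (4*t^2))) := by
    rw [MM_formula ht ht', riemannZeta_two]
    have hk := kap_ne ht ht'
    generalize kap t = k at *
    generalize Z3 (2*Complex.I*t^2) = z1
    generalize Z3 (-(2*Complex.I*t^2)) = z2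
    generalize Z3 (t^2) = z3
    generalize Z3 (-t^2) = z4
    generalize Z3 (4*t^2) = z5
    generalize (Real.pi:ℂ) = p at *
    field_simp
    ring
  rw [hv]
  refine H3.congr_fun (fun n => ?_)
  rw [Rc, mul_pow 8, pow_succ ((t:ℂ)^2) n]
  have h8 : (8:ℂ)^n ≠ 0 := pow_ne_zero _ (by norm_num)
  generalize (8:ℂ)^n = e at *
  generalize 1/(6*riemannZeta 2) = d at *
  generalize tri (n+1) = r at *
  generalize hu : (t:ℂ)^2 = u at *
  have hu0 : u ≠ 0 := by rw [← hu]; exact pow_ne_zero _ t0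
  have : d/u*(r*(u^n*u)) = d*(r/e)*(e*u^n) := by field_simp
  rw [this]; ring

end ZH

namespace ZH
open Finset Filter Topology

lemma cons_sum {n : ℕ} {c : ℕ → ℝ} (hc : Summable (fun k => |c k|)) {F : ℕ → (Fin n → ℕ) → ℝ} {B : ℝ}
    (hF : ∀ k, Summable (fun h => |F k h|)) (hB : ∀ k, ∑' h, |F k h| ≤ B) :
    Summable (fun g : Fin (n+1) → ℕ => |c (g 0) * F (g 0) (Fin.tail g)|) ∧
    (∑' g : Fin (n+1) → ℕ, |c (g 0) * F (g 0) (Fin.tail g)|) ≤ B * ∑' k, |c k| ∧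
    (∑' g : Fin (n+1) → ℕ, c (g 0) * F (g 0) (Fin.tail g)) = ∑' k, c k * ∑' h, F k h := by
  let e : ℕ × (Fin n → ℕ) ≃ (Fin (n+1) → ℕ) := Fin.consEquiv (fun _ => ℕ)
  have he : ∀ p, e p 0 = p.1 := fun p => rfl
  have he' : ∀ p, Fin.tail (e p) = p.2 := fun p => rfl
  have hs0 : Summable (fun p : ℕ × (Fin n → ℕ) => |c p.1 * F p.1 p.2|) := by
    rw [summable_prod_of_nonneg (fun _ => abs_nonneg _)]
    refine ⟨fun k => ?_, ?_⟩
    · simp only [abs_mul]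
      exact (hF k).mul_left _
    · simp only [abs_mul, tsum_mul_left]
      refine Summable.of_nonneg_of_le (fun k => mul_nonneg (abs_nonneg _) (tsum_nonneg fun _ => abs_nonneg _))
        (fun k => mul_le_mul_of_nonneg_left (hB k) (abs_nonneg _)) (hc.mul_right B)
  have hs : Summable (fun g : Fin (n+1) → ℕ => |c (g 0) * F (g 0) (Fin.tail g)|) := by
    rw [← e.summable_iff]
    exact hs0
  refine ⟨hs, ?_, ?_⟩
  · rw [← e.tsum_eq]
    simp only [he, he']
    rw [hs0.tsum_prod]
    simp only [abs_mul, tsum_mul_left]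
    rw [mul_comm B, ← tsum_mul_right]
    refine Summable.tsum_le_tsum (fun k => mul_le_mul_of_nonneg_left (hB k) (abs_nonneg _)) ?_ (hc.mul_right B)
    refine Summable.of_nonneg_of_le (fun k => mul_nonneg (abs_nonneg _) (tsum_nonneg fun _ => abs_nonneg _))
        (fun k => mul_le_mul_of_nonneg_left (hB k) (abs_nonneg _)) (hc.mul_right B)
  · rw [← e.tsum_eq]
    simp only [he, he']
    have hs1 : Summable (fun p : ℕ × (Fin n → ℕ) => c p.1 * F p.1 p.2) := summable_abs_iff.1 hs0
    rw [hs1.tsum_prod]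
    simp only [tsum_mul_left]

noncomputable def ww (k : ℕ) : ℝ := (-1)^k/(k:ℝ)^2
noncomputable def ee (k : ℕ) : ℝ := if k = 0 then 1/2 else 1

lemma ww_abs (k : ℕ) : |ww k| = 1/(k:ℝ)^2 := by
  rw [ww, abs_div, abs_pow, abs_neg, abs_one, one_pow, abs_of_nonneg (by positivity)]
lemma ww_summable : Summable (fun k => |ww k|) := by
  simp only [ww_abs]
  exact hasSum_zeta_two.summable
lemma ww_tsum : ∑' k, |ww k| ≤ 2 := by
  simp only [ww_abs]
  rw [hasSum_zeta_two.tsum_eq]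
  nlinarith [Real.pi_lt_d2, Real.pi_pos]
lemma ww_shift (m : ℕ) : Summable (fun k => |ww (m+k)|) := by
  have := (summable_nat_add_iff m).2 ww_summable
  simpa only [add_comm] using this
lemma ww_shift_le (m : ℕ) : ∑' k, |ww (m+k)| ≤ 2 := by
  have := ww_summable.sum_add_tsum_nat_add m
  have h2 : 0 ≤ ∑ i ∈ range m, |ww i| := sum_nonneg fun _ _ => abs_nonneg _
  simp only [add_comm m]
  linarith [ww_tsum]
lemma ee_abs (k : ℕ) (x : ℝ) : |ee k * x| ≤ |x| := by
  rw [ee, abs_mul]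
  split_ifs
  · rw [abs_of_pos (by norm_num : (0:ℝ) < 1/2)]; linarith [abs_nonneg x]
  · simp
lemma ew_summable (m : ℕ) : Summable (fun k => |ee k * ww (m+k)|) :=
  Summable.of_nonneg_of_le (fun _ => abs_nonneg _) (fun k => ee_abs k _) (ww_shift m)
lemma ew_le (m : ℕ) : ∑' k, |ee k * ww (m+k)| ≤ ∑' k, |ww (m+k)| :=
  (ew_summable m).tsum_le_tsum (fun k => ee_abs k _) (ww_shift m)

noncomputable def TT : (n : ℕ) → ℕ → (Fin n → ℕ) → ℝ
  | 0, _, _ => 1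
  | (n+1), m, h => (ee (h 0) * ww (m + h 0)) * TT n (m + h 0) (Fin.tail h)

noncomputable def Vn (n m : ℕ) : ℝ := ∑' h, TT n m h

lemma TT_sum (n : ℕ) : ∀ m, Summable (fun h => |TT n m h|) ∧ ∑' h, |TT n m h| ≤ 2^n := by
  induction n with
  | zero =>
    intro m
    refine ⟨(hasSum_fintype _).summable, ?_⟩
    rw [tsum_fintype]; simp [TT]
  | succ n ih =>
    intro m
    obtain ⟨h1, h2, h3⟩ := cons_sum (ew_summable m) (F := fun k => TT n (m+k)) (B := 2^n)
      (fun k => (ih (m+k)).1) (fun k => (ih (m+k)).2)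
    refine ⟨h1, h2.trans ?_⟩
    rw [pow_succ]
    exact mul_le_mul_of_nonneg_left ((ew_le m).trans (ww_shift_le m)) (by positivity)

lemma Vn_zero (m : ℕ) : Vn 0 m = 1 := by rw [Vn, tsum_fintype]; simp [TT]
lemma Vn_abs (n m : ℕ) : |Vn n m| ≤ 2^n := by
  have h := (TT_sum n m)
  have := norm_tsum_le_tsum_norm (f := fun h => TT n m h) h.1
  exact this.trans h.2
lemma Vn_succ' (n m : ℕ) : Vn (n+1) m = ∑' k, ee k * ww (m+k) * Vn n (m+k) :=
  (cons_sum (ew_summable m) (F := fun k => TT n (m+k)) (B := 2^n)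
      (fun k => (TT_sum n (m+k)).1) (fun k => (TT_sum n (m+k)).2)).2.2
lemma Vn_succ_abs (n m : ℕ) : |Vn (n+1) m| ≤ 2^n * ∑' k, |ww (m+k)| := by
  have h := (cons_sum (ew_summable m) (F := fun k => TT n (m+k)) (B := 2^n)
      (fun k => (TT_sum n (m+k)).1) (fun k => (TT_sum n (m+k)).2))
  have := norm_tsum_le_tsum_norm (f := fun h => TT (n+1) m h) h.1
  exact (this.trans h.2.1).trans (mul_le_mul_of_nonneg_left (ew_le m) (by positivity))
lemma wV_summable (n m : ℕ) : Summable (fun k => ww (m+k) * Vn n (m+k)) := by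
  refine Summable.of_norm_bounded ((ww_shift m).mul_right (2^n)) (fun k => ?_)
  rw [Real.norm_eq_abs, abs_mul]
  exact mul_le_mul_of_nonneg_left (Vn_abs _ _) (abs_nonneg _)
lemma ewV_summable (n m : ℕ) : Summable (fun k => ee k * ww (m+k) * Vn n (m+k)) := by
  refine Summable.of_norm_bounded ((ew_summable m).mul_right (2^n)) (fun k => ?_)
  rw [Real.norm_eq_abs, abs_mul]
  exact mul_le_mul_of_nonneg_left (Vn_abs _ _) (abs_nonneg _)
lemma Vn_succ (n m : ℕ) : Vn (n+1) m = 1/2*ww m*Vn n m + ∑' k, ww (m+1+k) * Vn n (m+1+k) := by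
  rw [Vn_succ', (ewV_summable n m).tsum_eq_zero_add]
  congr 1
  apply tsum_congr
  intro k
  rw [ee, if_neg (Nat.succ_ne_zero k), one_mul]
  rw [show m + (k+1) = m+1+k by ring]
lemma Vn_diff (n m : ℕ) : Vn (n+1) m - Vn (n+1) (m+1) = 1/2*ww m*Vn n m + 1/2*ww (m+1)*Vn n (m+1) := by
  rw [Vn_succ n m, Vn_succ n (m+1), (wV_summable n (m+1)).tsum_eq_zero_add]
  have : ∑' k, ww (m+1+(k+1)) * Vn n (m+1+(k+1)) = ∑' k, ww (m+1+1+k) * Vn n (m+1+1+k) := by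
    apply tsum_congr
    intro k
    rw [show m+1+(k+1) = m+1+1+k by ring]
  rw [this, add_zero]
  ring

lemma z3_summable : Summable (fun k : ℕ => |1/((1+k:ℕ):ℝ)^3|) := by
  have := (summable_nat_add_iff 1).2 (Real.summable_one_div_nat_pow.2 (by norm_num : 1 < 3))
  refine this.congr (fun k => ?_)
  rw [abs_of_nonneg (by positivity), add_comm]

lemma idx_zero {n : ℕ} (g : Fin (n+1) → ℕ) : idxSeq g 0 = 1 + g 0 := by
  rw [idxSeq]
  have : (univ.filter (fun x : Fin (n+1) => x ≤ 0)) = {0} := by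
    ext x; simp
  rw [this, sum_singleton]

lemma filt_succ {n : ℕ} (g : Fin (n+1) → ℕ) (i : Fin n) :
    ∑ j ∈ univ.filter (· ≤ i.succ), g j = g 0 + ∑ j ∈ univ.filter (· ≤ i), Fin.tail g j := by
  rw [sum_filter, sum_filter, Fin.sum_univ_succ]
  simp [Fin.tail]

lemma repCount_pow {n : ℕ} (g : Fin (n+1) → ℕ) : (1/2:ℝ)^repCount g = ∏ i : Fin n, ee (Fin.tail g i) := by
  rw [repCount, card_filter, Fin.sum_univ_succ, pow_add, ← prod_pow_eq_pow_sum]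
  rw [if_neg (by simp), pow_zero, one_mul]
  apply prod_congr rfl
  intro i _
  rw [ee, Fin.tail]
  by_cases h : g i.succ = 0
  · simp [h]
  · simp [h]

lemma TT_prod (n : ℕ) : ∀ (m : ℕ) (h : Fin n → ℕ), TT n m h =
    (∏ i, ee (h i)) * ∏ i, ww (m + ∑ j ∈ univ.filter (· ≤ i), h j) := by
  induction n with
  | zero => intro m h; simp [TT]
  | succ n ih =>
    intro m h
    rw [TT, ih, Fin.prod_univ_succ, Fin.prod_univ_succ]
    have h0 : ∑ j ∈ univ.filter (· ≤ (0 : Fin (n+1))), h j = h 0 := by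
      have : (univ.filter (fun x : Fin (n+1) => x ≤ 0)) = {0} := by ext x; simp
      rw [this, sum_singleton]
    simp only [filt_succ, h0, ← add_assoc, Fin.tail]
    ring

noncomputable def Zn (n : ℕ) : ℝ := zetaInterp (1/2) (Fin.cons 3 (fun _ : Fin n => 2))
        (Fin.cons 1 (fun _ : Fin n => (-1 : ℝ)))

lemma Zn_eq (n : ℕ) : Zn n = ∑' k : ℕ, 1/((1+k:ℕ):ℝ)^3 * Vn n (1+k) := by
  have := (cons_sum z3_summable (F := fun k => TT n (1+k)) (B := 2^n)
      (fun k => (TT_sum n (1+k)).1) (fun k => (TT_sum n (1+k)).2)).2.2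
  rw [Zn, zetaInterp]
  simp only [Vn]
  rw [← this]
  apply tsum_congr
  intro g
  rw [repCount_pow, Fin.prod_univ_succ, TT_prod]
  simp only [Fin.cons_zero, Fin.cons_succ, idx_zero, one_pow]
  have : ∀ i : Fin n, (-1:ℝ)^idxSeq g i.succ / (idxSeq g i.succ:ℝ)^2
     = ww (1 + g 0 + ∑ j ∈ univ.filter (· ≤ i), Fin.tail g j) := by
    intro i
    rw [idxSeq, filt_succ, ww, add_assoc]
  simp only [this]
  ring

lemma zV_summable (n : ℕ) : Summable (fun k : ℕ => 1/((1+k:ℕ):ℝ)^3 * Vn n (1+k)) := by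
  refine Summable.of_norm_bounded (z3_summable.mul_right (2^n)) (fun k => ?_)
  rw [Real.norm_eq_abs, abs_mul]
  exact mul_le_mul_of_nonneg_left (Vn_abs _ _) (abs_nonneg _)

end ZH

namespace ZH
open Finset Filter Topology

noncomputable def Vg (t : ℝ) (m : ℕ) : ℝ := ∑' n, Vn n m * (8*t^2)^n

lemma geo_summable {t : ℝ} (ht : 0 < t) (ht' : t < 1/10) : Summable (fun n : ℕ => (2*(8*t^2))^n) :=
  summable_geometric_of_lt_one (by positivity) (by nlinarith)

lemma Vg_bd {t : ℝ} (n m : ℕ) : ‖Vn n m * (8*t^2)^n‖ ≤ (2*(8*t^2))^n := by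
  rw [norm_mul, Real.norm_eq_abs, norm_pow, mul_pow 2, Real.norm_of_nonneg (by positivity)]
  exact mul_le_mul_of_nonneg_right (Vn_abs _ _) (by positivity)

lemma Vg_summable {t : ℝ} (ht : 0 < t) (ht' : t < 1/10) (m : ℕ) : Summable (fun n => Vn n m * (8*t^2)^n) :=
  Summable.of_norm_bounded (geo_summable ht ht') (fun n => Vg_bd n m)

lemma Vg_abs {t : ℝ} (ht : 0 < t) (ht' : t < 1/10) (m : ℕ) : ‖Vg t m‖ ≤ ∑' n : ℕ, (2*(8*t^2))^n :=
  tsum_of_norm_bounded (geo_summable ht ht').hasSum (fun n => Vg_bd n m)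

lemma Vg_rec {t : ℝ} (ht : 0 < t) (ht' : t < 1/10) (m : ℕ) :
    Vg t m * (1 - 4*t^2*ww m) = Vg t (m+1) * (1 + 4*t^2*ww (m+1)) := by
  have h1 := Vg_summable ht ht' m
  have h2 := Vg_summable ht ht' (m+1)
  have e1 : Vg t m = 1 + ∑' n, Vn (n+1) m * (8*t^2)^(n+1) := by
    rw [Vg, h1.tsum_eq_zero_add, Vn_zero]; simp
  have e2 : Vg t (m+1) = 1 + ∑' n, Vn (n+1) (m+1) * (8*t^2)^(n+1) := by
    rw [Vg, h2.tsum_eq_zero_add, Vn_zero]; simp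
  have s1 := (summable_nat_add_iff 1).2 h1
  have s2 := (summable_nat_add_iff 1).2 h2
  have key : Vg t m - Vg t (m+1) = 8*t^2*(1/2*ww m * Vg t m + 1/2*ww (m+1) * Vg t (m+1)) := by
    have : Vg t m - Vg t (m+1) = ∑' n, (Vn (n+1) m * (8*t^2)^(n+1) - Vn (n+1) (m+1) * (8*t^2)^(n+1)) := by
      rw [e1, e2, s1.tsum_sub s2]; ring
    rw [this, Vg, Vg, ← tsum_mul_left, ← tsum_mul_left, ← (h1.mul_left _).tsum_add (h2.mul_left _),
      ← tsum_mul_left]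
    apply tsum_congr
    intro n
    rw [← sub_mul, Vn_diff, pow_succ]; ring
  linear_combination key

lemma Vn_tendsto (n : ℕ) : Tendsto (fun m => Vn n m) atTop (𝓝 (if n = 0 then 1 else 0)) := by
  cases n with
  | zero => simp [Vn_zero]
  | succ n =>
    simp only [Nat.succ_ne_zero, if_false, Nat.add_eq_zero_iff, one_ne_zero, and_false]
    apply squeeze_zero_norm (fun m => Vn_succ_abs n m)
    have := (_root_.tendsto_sum_nat_add (fun k => |ww k|)).const_mul (2^n : ℝ)
    simpa only [add_comm, mul_zero] using this

lemma Vg_tendsto {t : ℝ} (ht : 0 < t) (ht' : t < 1/10) : Tendsto (Vg t) atTop (𝓝 1) := by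
  have := tendsto_tsum_of_dominated_convergence (𝓕 := atTop) (f := fun m n => Vn n m * (8*t^2)^n)
    (g := fun n => (if n = 0 then 1 else 0) * (8*t^2)^n) (geo_summable ht ht')
    (fun n => (Vn_tendsto n).mul_const _) (Eventually.of_forall fun m n => Vg_bd n m)
  have e : ∑' n, (if n = 0 then (1:ℝ) else 0) * (8*t^2)^n = 1 := by
    rw [tsum_eq_single 0]
    · simp
    · intro n hn; simp [hn]
  rw [e] at this
  exact this

/-- generating function -/
lemma F_sum {t : ℝ} (ht : 0 < t) (ht' : t < 1/10) :
    HasSum (fun n => Zn n * (8*t^2)^n) (∑' k : ℕ, 1/((1+k:ℕ):ℝ)^3 * Vg t (1+k)) := by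
  have hs : Summable (fun p : ℕ × ℕ => (1/((1+p.1:ℕ):ℝ)^3 * Vn p.2 (1+p.1)) * (8*t^2)^p.2) := by
    have hb := z3_summable.mul_of_nonneg (geo_summable ht ht') (fun _ => abs_nonneg _) (fun n => by positivity)
    refine Summable.of_norm_bounded hb (fun p => ?_)
    rw [mul_assoc, norm_mul, Real.norm_eq_abs]
    exact mul_le_mul_of_nonneg_left (Vg_bd _ _) (abs_nonneg _)
  have h1 : (∑' k : ℕ, 1/((1+k:ℕ):ℝ)^3 * Vg t (1+k)) =
      ∑' k : ℕ, ∑' n : ℕ, (1/((1+k:ℕ):ℝ)^3 * Vn n (1+k)) * (8*t^2)^n := by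
    apply tsum_congr; intro k
    rw [Vg, ← tsum_mul_left]
    simp only [mul_assoc]
  have h2 : ∀ n, Zn n * (8*t^2)^n = ∑' k : ℕ, (1/((1+k:ℕ):ℝ)^3 * Vn n (1+k)) * (8*t^2)^n := by
    intro n; rw [Zn_eq, tsum_mul_right]
  rw [h1, ← hs.tsum_prod]
  have hs' := (Equiv.prodComm ℕ ℕ).hasSum_iff.2 hs.hasSum
  have := hs'.prod_fiberwise (g := fun n => Zn n * (8*t^2)^n) (fun n => by
    rw [h2]
    exact ((zV_summable n).mul_right _).hasSum)
  exact this

lemma Vg3_summable {t : ℝ} (ht : 0 < t) (ht' : t < 1/10) :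
    Summable (fun k : ℕ => 1/((1+k:ℕ):ℝ)^3 * Vg t (1+k)) := by
  refine Summable.of_norm_bounded (z3_summable.mul_right (∑' n : ℕ, (2*(8*t^2))^n)) (fun k => ?_)
  rw [norm_mul, Real.norm_eq_abs]
  exact mul_le_mul_of_nonneg_left (Vg_abs ht ht' _) (abs_nonneg _)

lemma sq_ne {t : ℝ} (ht : 0 < t) (ht' : t < 1/10) (j : ℕ) : ((j:ℂ)+1)^2 - (t:ℂ)^2 ≠ 0 := by
  have : ((j:ℝ)+1)^2 - t^2 ≠ 0 := by
    have : (0:ℝ) ≤ j := by positivity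
    nlinarith
  have := Complex.ofReal_ne_zero.2 this
  push_cast at this
  exact this

lemma sq_ne_im {t : ℝ} (j : ℕ) : ((j:ℂ)+1)^2 - (t*Complex.I)^2 ≠ 0 := by
  rw [mul_pow, Complex.I_sq]
  have : ((j:ℝ)+1)^2 + t^2 ≠ 0 := by positivity
  have := Complex.ofReal_ne_zero.2 this
  push_cast at this
  rw [mul_neg_one, sub_neg_eq_add]
  exact this

lemma ww_odd (l : ℕ) : ww (2*l+1) = -1/(2*(l:ℝ)+1)^2 := by
  rw [ww, pow_succ, pow_mul]; push_cast; simp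
lemma ww_even (l : ℕ) : ww (2*l+2) = 1/(2*(l:ℝ)+2)^2 := by
  rw [ww, pow_add, pow_mul]; push_cast; simp

lemma odd_step {t : ℝ} (ht : 0 < t) (ht' : t < 1/10) (l : ℕ) {X : ℂ}
    (hX : ((Vg t (2*l) * (1 - 4*t^2*ww (2*l)) : ℝ) : ℂ) = X) :
    ((Vg t (2*l+1) : ℝ) : ℂ) = X * ((l:ℂ)+1/2)^2/(((l:ℂ)+1/2)^2-(t:ℂ)^2) := by
  rw [Vg_rec ht ht', ww_odd] at hX
  push_cast at hX
  rw [← hX]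
  have h1 := hA_real ht ht' l
  have h2 := half_ne l
  have h3 : (2*(l:ℂ)+1) ≠ 0 := by
    intro h; apply h2; linear_combination h/2
  have e2 : 1 + 4*(t:ℂ)^2*(-1/(2*(l:ℂ)+1)^2) = (((l:ℂ)+1/2)^2-(t:ℂ)^2)/((l:ℂ)+1/2)^2 := by
    field_simp; ring
  rw [e2]
  generalize ((l:ℂ)+1/2)^2-(t:ℂ)^2 = d at *
  generalize (l:ℂ)+1/2 = y at *
  field_simp

lemma even_step {t : ℝ} (ht : 0 < t) (ht' : t < 1/10) (l : ℕ) {X : ℂ}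
    (hX : ((Vg t (2*l) * (1 - 4*t^2*ww (2*l)) : ℝ) : ℂ) = X) :
    ((Vg t (2*l+2) : ℝ) : ℂ) = X * (((l:ℂ)+1/2)^2+(t:ℂ)^2)/(((l:ℂ)+1/2)^2-(t:ℂ)^2)
       * ((l:ℂ)+1)^2/(((l:ℂ)+1)^2+(t:ℂ)^2) := by
  have h0 := odd_step ht ht' l hX
  have hr := congrArg (Complex.ofReal) (Vg_rec ht ht' (2*l+1))
  rw [ww_odd, show 2*l+1+1 = 2*l+2 by ring, ww_even] at hr
  push_cast at hr
  rw [h0] at hr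
  have h1 := hA_real ht ht' l
  have h2 := half_ne l
  have h3 : (2*(l:ℂ)+1) ≠ 0 := by
    intro h; apply h2; linear_combination h/2
  have h4 := one_ne l
  have h5 : (2*(l:ℂ)+2) ≠ 0 := by
    intro h; apply h4; linear_combination h/2
  have h6 : ((l:ℂ)+1)^2+(t:ℂ)^2 ≠ 0 := by
    have := sq_ne_im (t := t) l
    rwa [mul_pow, Complex.I_sq, mul_neg_one, sub_neg_eq_add] at this
  have e1 : 1 + 4*(t:ℂ)^2*(1/(2*(l:ℂ)+2)^2) = (((l:ℂ)+1)^2+(t:ℂ)^2)/((l:ℂ)+1)^2 := by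
    field_simp; ring
  have e2 : 1 - 4*(t:ℂ)^2*(-1/(2*(l:ℂ)+1)^2) = (((l:ℂ)+1/2)^2+(t:ℂ)^2)/((l:ℂ)+1/2)^2 := by
    field_simp; ring
  rw [e1, e2] at hr
  generalize ((Vg t (2*l+2) : ℝ) : ℂ) = V at *
  rw [eq_div_iff h6]
  rw [mul_div_assoc' V, eq_div_iff (pow_ne_zero _ h4)] at hr
  rw [← hr]
  generalize ((l:ℂ)+1/2)^2-(t:ℂ)^2 = d at *
  generalize (l:ℂ)+1/2 = y at *
  field_simp

lemma X_even {t : ℝ} (ht : 0 < t) (ht' : t < 1/10) (l : ℕ) :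
    ((Vg t (2*l) * (1 - 4*t^2*ww (2*l)) : ℝ) : ℂ) = Vg t 0 * (cc t l * DD (t*Complex.I) l) := by
  induction l with
  | zero => simp [ww, cc, DD]
  | succ l ih =>
    have := even_step ht ht' l ih
    rw [show 2*(l+1) = 2*l+2 by ring, ww_even]
    push_cast
    rw [this, cc_succ, DD_succ]
    have h1 := hA_real ht ht' l
    have h4 := one_ne l
    have h5 : (2*(l:ℂ)+2) ≠ 0 := by
      intro h; apply h4; linear_combination h/2
    have h6 := sq_ne_im (t := t) l
    rw [mul_pow, Complex.I_sq, mul_neg_one, sub_neg_eq_add] at *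
    have e1 : 1 - 4*(t:ℂ)^2*(1/(2*(l:ℂ)+2)^2) = (((l:ℂ)+1)^2-(t:ℂ)^2)/((l:ℂ)+1)^2 := by
      field_simp; ring
    rw [e1, sub_neg_eq_add]
    generalize ((l:ℂ)+1/2)^2-(t:ℂ)^2 = d at *
    generalize ((l:ℂ)+1)^2+(t:ℂ)^2 = d' at *
    generalize (l:ℂ)+1 = y at *
    generalize (l:ℂ)+1/2 = y' at *
    field_simp

lemma V0_kap {t : ℝ} (ht : 0 < t) (ht' : t < 1/10) : (Vg t 0 : ℂ) * kap t = 1 := by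
  have h1 := (kap_tendsto ht ht').const_mul (Vg t 0 : ℂ)
  have hw : Tendsto ww atTop (𝓝 0) := (summable_abs_iff.1 ww_summable).tendsto_atTop_zero
  have h2 : Tendsto (fun m => Vg t m * (1 - 4*t^2*ww m)) atTop (𝓝 (1*(1-4*t^2*0))) :=
    (Vg_tendsto ht ht').mul (tendsto_const_nhds.sub (hw.const_mul _))
  rw [mul_zero, sub_zero, mul_one] at h2
  have h3 := h2.comp (tendsto_id.const_mul_atTop' (by norm_num : 0 < 2))
  have h4 := (Complex.continuous_ofReal.tendsto 1).comp h3
  have h5 : Tendsto (fun l => (Vg t 0 : ℂ) * (cc t l * DD (t*Complex.I) l)) atTop (𝓝 ((1:ℝ):ℂ)) := by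
    refine h4.congr (fun l => ?_)
    exact X_even ht ht' l
  have := tendsto_nhds_unique h1 h5
  rw [this]; simp

lemma pair_term {t : ℝ} (ht : 0 < t) (ht' : t < 1/10) (l : ℕ) :
    1/(2*(l:ℂ)+2)^3 * (Vg t (2*l+2) : ℝ) + 1/(2*(l:ℂ)+3)^3 * (Vg t (2*l+3) : ℝ)
      = Vg t 0 * (al t (l+1) * DD (t*Complex.I) (l+1)) := by
  have h0 := X_even ht ht' (l+1)
  have h1 := odd_step ht ht' (l+1) h0
  rw [show 2*(l+1) = 2*l+2 by ring, ww_even] at h0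
  rw [show 2*(l+1)+1 = 2*l+3 by ring] at h1
  push_cast at h0 h1
  have a1 := hA_real ht ht' l
  have a2 := hA_real ht ht' (l+1)
  have a3 := sq_ne ht ht' l
  have h4 := one_ne l
  have h5 : (2*(l:ℂ)+2) ≠ 0 := by
    intro h; apply h4; linear_combination h/2
  have h6 := half_ne (l+1)
  push_cast at h6 a2
  have e1 : 1 - 4*(t:ℂ)^2*(1/(2*(l:ℂ)+2)^2) = (((l:ℂ)+1)^2-(t:ℂ)^2)/((l:ℂ)+1)^2 := by
    field_simp; ring
  have e3 : 2*(l:ℂ)+2 = 2*((l:ℂ)+1) := by ring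
  have e4 : 2*(l:ℂ)+3 = 2*((l:ℂ)+1+1/2) := by ring
  have e5 : (l:ℂ)+3/2 = (l:ℂ)+1+1/2 := by ring
  rw [e1] at h0
  rw [h1, al, e3, e4, e5, cc_succ]
  rw [cc_succ] at h0
  generalize ((Vg t (2*l+2) : ℝ) : ℂ) = V at *
  generalize ((Vg t 0 : ℝ) : ℂ) = V0 at *
  generalize DD (t*Complex.I) (l+1) = Q at *
  generalize cc t l = P at *
  generalize ((l:ℂ)+1/2)^2-(t:ℂ)^2 = d1 at *
  generalize ((l:ℂ)+1+1/2)^2-(t:ℂ)^2 = d2 at *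
  generalize ((l:ℂ)+1)^2-(t:ℂ)^2 = d3 at *
  generalize (l:ℂ)+1+1/2 = y2 at *
  generalize (l:ℂ)+1 = y at *
  have hV : V = V0*P*Q*y^2/d1 := by
    field_simp at h0 ⊢
    linear_combination h0
  rw [hV]
  field_simp
  ring

lemma zero_term {t : ℝ} (ht : 0 < t) (ht' : t < 1/10) :
    ((Vg t 1 : ℝ) : ℂ) = Vg t 0 * (al t 0 * DD (t*Complex.I) 0) := by
  have h0 := odd_step ht ht' 0 (X_even ht ht' 0)
  simp only [cc, DD, al, range_zero, prod_empty, mul_one, Nat.cast_zero, mul_zero, zero_add] at h0 ⊢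
  rw [h0, show (1/2:ℂ)^2 = 1/4 by norm_num]; ring

lemma tsum_pair {f : ℕ → ℝ} (hs : Summable f) {g : ℕ → ℂ} (hg : Summable g) {c : ℂ}
    (h0 : (f 0 : ℂ) = c * g 0) (h1 : ∀ l, (f (2*l+1) : ℂ) + f (2*l+2) = c * g (l+1)) :
    ((∑' k, f k : ℝ) : ℂ) = c * ∑' l, g l := by
  have hs1 := (summable_nat_add_iff 1).2 hs
  have se : Summable (fun k => f (2*k+1)) :=
    hs1.comp_injective (i := fun k : ℕ => 2*k) (fun a b h => by simpa using h)
  have so : Summable (fun k => f (2*k+1+1)) :=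
    hs1.comp_injective (i := fun k : ℕ => 2*k+1) (fun a b h => by simpa using h)
  have split := tsum_even_add_odd (f := fun k => f (k+1)) se so
  rw [hs.tsum_eq_zero_add, ← split, ← se.tsum_add so, hg.tsum_eq_zero_add, mul_add, ← tsum_mul_left,
    Complex.ofReal_add, h0, Complex.ofReal_tsum]
  congr 1
  apply tsum_congr
  intro l
  rw [← h1, Complex.ofReal_add]

lemma F_MM {t : ℝ} (ht : 0 < t) (ht' : t < 1/10) :
    ((∑' k : ℕ, 1/((1+k:ℕ):ℝ)^3 * Vg t (1+k) : ℝ) : ℂ) = Vg t 0 * MM t (t*Complex.I) := by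
  have okI : Ok ((t:ℂ)*Complex.I) := ⟨NI_of_im (by simp; exact ht.ne'), by simp, by simp⟩
  have hM := MM_summable ht ht' okI 0
  simp only [Nat.cast_zero, add_zero] at hM
  refine tsum_pair (Vg3_summable ht ht') hM ?_ ?_
  · rw [← zero_term ht ht']; simp
  · intro l
    rw [← pair_term ht ht' l]
    rw [show 1+(2*l+1) = 2*l+2 by ring, show 1+(2*l+2) = 2*l+3 by ring]
    push_cast
    rfl

lemma Z_sum {t : ℝ} (ht : 0 < t) (ht' : t < 1/10) :
    HasSum (fun n => (Zn n : ℂ) * (8*(t:ℂ)^2)^n) (MM t (t*Complex.I)/kap t) := by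
  have h := Complex.hasSum_ofReal.2 (F_sum ht ht')
  rw [F_MM ht ht'] at h
  have e : MM t (t*Complex.I)/kap t = Vg t 0 * MM t (t*Complex.I) := by
    rw [div_eq_iff (kap_ne ht ht')]
    linear_combination (-MM t (t*Complex.I)) * V0_kap ht ht'
  rw [e]
  refine h.congr_fun (fun n => ?_)
  push_cast
  rfl

lemma coeff_zero {d : ℕ → ℂ} (h : ∀ t : ℝ, 0 < t → t < 1/10 → HasSum (fun n => d n * (8*(t:ℂ)^2)^n) 0) :
    ∀ n, d n = 0 := by
  intro n
  induction n using Nat.strong_induction_on with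
  | _ N ih =>
  have h2 : ∀ t : ℝ, 0 < t → t < 1/10 → HasSum (fun n => d (n+N) * (8*(t:ℂ)^2)^n) 0 := by
    intro t ht ht'
    have := h t ht ht'
    rw [← hasSum_nat_add_iff' N, sum_eq_zero (fun i hi => by rw [ih i (mem_range.1 hi), zero_mul]), sub_zero] at this
    have t0 : (8*(t:ℂ)^2) ≠ 0 := mul_ne_zero (by norm_num) (pow_ne_zero _ (by exact_mod_cast ht.ne'))
    have h3 := this.mul_right ((8*(t:ℂ)^2)^N)⁻¹
    rw [zero_mul] at h3
    refine h3.congr_fun (fun n => ?_)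
    rw [pow_add, mul_assoc, mul_assoc, mul_inv_cancel₀ (pow_ne_zero _ t0), mul_one]
  have hb := (h2 (1/20) (by norm_num) (by norm_num)).summable.norm
  have hev : ∀ᶠ t : ℝ in 𝓝[>] 0, 0 < t ∧ t < 1/20 :=
    Ioo_mem_nhdsGT (by norm_num : (0:ℝ) < 1/20)
  have hl := tendsto_tsum_of_dominated_convergence (𝓕 := 𝓝[>] (0:ℝ))
    (f := fun t n => d (n+N) * (8*(t:ℂ)^2)^n) (g := fun n => d (n+N) * (8*((0:ℝ):ℂ)^2)^n) hb
    (fun n => by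
      have : Continuous (fun t : ℝ => d (n+N) * (8*(t:ℂ)^2)^n) := by fun_prop
      exact (this.tendsto 0).mono_left nhdsWithin_le_nhds)
    (by
      filter_upwards [hev] with t ht n
      rw [norm_mul, norm_mul]
      apply mul_le_mul_of_nonneg_left _ (norm_nonneg _)
      rw [norm_pow, norm_pow]
      apply pow_le_pow_left₀ (norm_nonneg _)
      rw [norm_of_pos (x := 8*t^2) (by have := ht.1; positivity) (by push_cast; rfl),
        norm_of_pos (x := 8*(1/20)^2) (by norm_num) (by push_cast; rfl)]
      have := ht.1
      have := ht.2
      nlinarith)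
  have hz : ∑' n, d (n+N) * (8*((0:ℝ):ℂ)^2)^n = d N := by
    rw [tsum_eq_single 0]
    · simp
    · intro n hn; simp [hn]
  rw [hz] at hl
  have hl2 : Tendsto (fun t : ℝ => ∑' n, d (n+N) * (8*(t:ℂ)^2)^n) (𝓝[>] 0) (𝓝 0) := by
    refine tendsto_const_nhds.congr' ?_
    filter_upwards [hev] with t ht
    exact (h2 t ht.1 (by linarith [ht.2])).tsum_eq.symm
  exact tendsto_nhds_unique hl hl2

lemma main (n : ℕ) : (Zn n : ℂ) = Rc n := by
  have := coeff_zero (d := fun n => (Zn n : ℂ) - Rc n) (fun t ht ht' => by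
    have := (Z_sum ht ht').sub (R_sum ht ht')
    rw [sub_self] at this
    refine this.congr_fun (fun n => ?_)
    rw [sub_mul]) n
  exact sub_eq_zero.1 this

end ZH

/-- The evaluation of `ζ^{1/2}(3, {2̄}^n)` in terms of Riemann zeta
values (with the convention `ζ(0) = −1/2`, which `riemannZeta` satisfies). -/
theorem zetaHalf_3_bar2_rep (n : ℕ) :
    ((zetaInterp (1/2) (Fin.cons 3 (fun _ : Fin n => 2))
        (Fin.cons 1 (fun _ : Fin n => (-1 : ℝ))) : ℝ) : ℂ) =
      -(Complex.I ^ n * (if Even n then 1 else 0) / 2 ^ (2 * n + 1)) *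
          riemannZeta (2 * n + 3)
      + 1 / (6 * riemannZeta 2) *
          ∑ p ∈ (Finset.range (n + 2) ×ˢ Finset.range (n + 2) ×ˢ
              Finset.range (n + 2)).filter
              (fun p => p.1 + p.2.1 + p.2.2 = n + 1),
            (-1 : ℂ) ^ p.1 * (1 - 2 ^ (2 * p.1)) / 8 ^ n *
              riemannZeta (2 * p.1) * riemannZeta (2 * p.2.1) *
              riemannZeta (2 * p.2.2 + 3) *
              (2 * (if Even p.2.2 then 1 else 0)
                + (2 * Complex.I) ^ (p.2.2 + 1) * (if Odd p.2.2 then 1 else 0)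
                - 8 * 4 ^ p.2.2) := by
  have h := ZH.main n
  rw [ZH.Zn, ZH.Rc, ZH.tri, Finset.sum_div] at h
  rw [h]
  congr 2
  apply Finset.sum_congr rfl
  intro p _
  rw [ZH.Ac, ZH.Bc, ZH.Cc]
  ring
end
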